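/- Let n ≥ 2, let F = α + β be a Randers metric on a nonempty open connected set U ⊆ ℝⁿ which is non-Riemannian (the 1-form β does not vanish identically on U) and of isotropic S-curvature: S(x,y) = (n+1) λ(x) F(x,y) for a smooth function λ : U → ℝ. Suppose σ : U → ℝ is a smooth function such that the conformally related Finsler metric F̄ := e^{σ(x)} F is of weakly isotropic scalar curvature, i.e. its scalar curvature satisfies r̄(x,y) = n(n−1)(θ(x,y)/F̄(x,y) + μ(x)) for a smooth 1-form θ = θ_i(x)y^i and smooth function μ. Then σ is constant on U. -/

import Mathlib

open MeasureTheory Matrix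

noncomputable section

/-- `Vec n` is ℝⁿ. -/
abbrev Vec (n : ℕ) := Fin n → ℝ

/-- Partial derivative of `f` in the `i`-th coordinate direction at `x`. -/
noncomputable def pd {n : ℕ} (i : Fin n) (f : Vec n → ℝ) (x : Vec n) : ℝ :=
  fderiv ℝ f x (Pi.single i 1)

/-- Partial derivative in the `i`-th `y`-coordinate of a function of `(x, y)`. -/
noncomputable def dy {n : ℕ} (i : Fin n) (f : Vec n → Vec n → ℝ) (x y : Vec n) : ℝ :=
  pd i (f x) y

/-- Partial derivative in the `i`-th `x`-coordinate of a function of `(x, y)`. -/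
noncomputable def dx {n : ℕ} (i : Fin n) (f : Vec n → Vec n → ℝ) (x y : Vec n) : ℝ :=
  pd i (fun x' => f x' y) x

/-- The square `F²` of a metric function. -/
noncomputable def F2 {n : ℕ} (F : Vec n → Vec n → ℝ) : Vec n → Vec n → ℝ :=
  fun x y => (F x y) ^ 2

/-- The fundamental tensor `g_{ij}(x,y) = ½ ∂²(F²)/∂yⁱ∂yʲ`. -/
noncomputable def gmat {n : ℕ} (F : Vec n → Vec n → ℝ) (x y : Vec n) :
    Matrix (Fin n) (Fin n) ℝ :=
  Matrix.of fun i j => (1 / 2) * dy i (fun x' y' => dy j (F2 F) x' y') x y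

/-- The inverse fundamental tensor `(g^{ij})`. -/
noncomputable def ginv {n : ℕ} (F : Vec n → Vec n → ℝ) (x y : Vec n) :
    Matrix (Fin n) (Fin n) ℝ :=
  (gmat F x y)⁻¹

/-- The geodesic coefficients
`Gⁱ = ¼ g^{il} (∂²(F²)/∂x^m∂y^l · y^m − ∂(F²)/∂x^l)`. -/
noncomputable def Geo {n : ℕ} (F : Vec n → Vec n → ℝ) (i : Fin n) (x y : Vec n) : ℝ :=
  (1 / 4) * ∑ l, ginv F x y i l *
    ((∑ m, dx m (fun x' y' => dy l (F2 F) x' y') x y * y m) - dx l (F2 F) x y)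

/-- The Riemann curvature
`Rⁱ_k = 2 ∂Gⁱ/∂x^k − ∂²Gⁱ/∂x^j∂y^k y^j + 2 G^j ∂²Gⁱ/∂y^j∂y^k − ∂Gⁱ/∂y^j ∂G^j/∂y^k`. -/
noncomputable def Riem {n : ℕ} (F : Vec n → Vec n → ℝ) (i k : Fin n) (x y : Vec n) : ℝ :=
  2 * dx k (Geo F i) x y
    - (∑ j, dy k (fun x' y' => dx j (Geo F i) x' y') x y * y j)
    + 2 * ∑ j, Geo F j x y * dy j (fun x' y' => dy k (Geo F i) x' y') x y
    - ∑ j, dy j (Geo F i) x y * dy k (Geo F j) x y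

/-- The Ricci curvature `Ric = R^m_m`. -/
noncomputable def RicciC {n : ℕ} (F : Vec n → Vec n → ℝ) (x y : Vec n) : ℝ :=
  ∑ m, Riem F m m x y

/-- The Ricci curvature tensor `Ric_{ij} = ½ ∂²Ric/∂yⁱ∂yʲ`. -/
noncomputable def RicciTensor {n : ℕ} (F : Vec n → Vec n → ℝ) (i j : Fin n)
    (x y : Vec n) : ℝ :=
  (1 / 2) * dy i (fun x' y' => dy j (RicciC F) x' y') x y

/-- The Akbar-Zadeh scalar curvature `r = g^{ij} Ric_{ij}`. -/
noncomputable def scalarCurv {n : ℕ} (F : Vec n → Vec n → ℝ) (x y : Vec n) : ℝ :=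
  ∑ i, ∑ j, ginv F x y i j * RicciTensor F i j x y

/-- The Busemann-Hausdorff volume coefficient
`σ_BH(x) = Vol(𝔹ⁿ) / Vol {y | F(x,y) < 1}`. -/
noncomputable def sigmaBH {n : ℕ} (F : Vec n → Vec n → ℝ) (x : Vec n) : ℝ :=
  (volume {y : Vec n | ∑ i, (y i) ^ 2 < 1}).toReal /
    (volume {y : Vec n | F x y < 1}).toReal

/-- The S-curvature `S(x,y) = ∂G^m/∂y^m − y^m ∂/∂x^m (ln σ_BH)`. -/
noncomputable def SCurv {n : ℕ} (F : Vec n → Vec n → ℝ) (x y : Vec n) : ℝ :=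
  (∑ m, dy m (Geo F m) x y) - ∑ m, y m * pd m (fun x' => Real.log (sigmaBH F x')) x

/-- `F` is a Finsler metric on the open set `U ⊆ ℝⁿ`: it is smooth and positive on
`U × (ℝⁿ \ {0})`, positively 1-homogeneous in `y`, and its fundamental tensor is
positive definite. -/
def IsFinslerOn {n : ℕ} (F : Vec n → Vec n → ℝ) (U : Set (Vec n)) : Prop :=
  ContDiffOn ℝ (⊤ : ℕ∞) (fun p : Vec n × Vec n => F p.1 p.2)
    (U ×ˢ {y : Vec n | y ≠ 0}) ∧
  ∀ x ∈ U, ∀ y : Vec n, y ≠ 0 →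
    0 < F x y ∧ (∀ t : ℝ, 0 < t → F x (t • y) = t * F x y) ∧ (gmat F x y).PosDef

/-- The Riemannian part `α(x,y) = √(a_{ij}(x) yⁱ yʲ)` of a Randers metric. -/
noncomputable def ralpha {n : ℕ} (a : Vec n → Matrix (Fin n) (Fin n) ℝ)
    (x y : Vec n) : ℝ :=
  Real.sqrt (∑ i, ∑ j, a x i j * y i * y j)

/-- The 1-form part `β(x,y) = b_i(x) yⁱ` of a Randers metric. -/
noncomputable def rbeta {n : ℕ} (b : Vec n → Vec n) (x y : Vec n) : ℝ :=
  ∑ i, b x i * y i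

/-- `b(x)² = a^{ij}(x) b_i(x) b_j(x)`, the square of the α-norm of β. -/
noncomputable def bnormsq {n : ℕ} (a : Vec n → Matrix (Fin n) (Fin n) ℝ)
    (b : Vec n → Vec n) (x : Vec n) : ℝ :=
  ∑ i, ∑ j, (a x)⁻¹ i j * b x i * b x j

/-- The data `(a, b)` defines a Randers metric `F = α + β` on `U`:
`a` is a smooth field of symmetric positive definite matrices, `b` is a smooth
field of covectors with `‖β‖_α < 1`, and `F = α + β` is a Finsler metric on `U`. -/
def IsRandersOn {n : ℕ} (a : Vec n → Matrix (Fin n) (Fin n) ℝ) (b : Vec n → Vec n)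
    (U : Set (Vec n)) : Prop :=
  (∀ i j, ContDiffOn ℝ (⊤ : ℕ∞) (fun x => a x i j) U) ∧
  ContDiffOn ℝ (⊤ : ℕ∞) b U ∧
  (∀ x ∈ U, (a x).IsSymm ∧ (a x).PosDef ∧ bnormsq a b x < 1) ∧
  IsFinslerOn (fun x y => ralpha a x y + rbeta b x y) U

noncomputable section

/-! ### Calculus layer -/

def Sm {n : ℕ} (U : Set (Vec n)) (f : Vec n → Vec n → ℝ) : Prop :=
  ContDiffOn ℝ (⊤ : ℕ∞) (fun p : Vec n × Vec n => f p.1 p.2) (U ×ˢ {y : Vec n | y ≠ 0})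

lemma isOpen_dom {n : ℕ} {U : Set (Vec n)} (hU : IsOpen U) :
    IsOpen (U ×ˢ {y : Vec n | y ≠ 0}) :=
  hU.prod isOpen_ne

lemma Sm.contDiffAt {n : ℕ} {U : Set (Vec n)} {f : Vec n → Vec n → ℝ} (hf : Sm U f)
    (hU : IsOpen U) {x y : Vec n} (hx : x ∈ U) (hy : y ≠ 0) :
    ContDiffAt ℝ (⊤ : ℕ∞) (fun p : Vec n × Vec n => f p.1 p.2) (x, y) :=
  ContDiffOn.contDiffAt hf ((isOpen_dom hU).mem_nhds ⟨hx, hy⟩)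

lemma Sm.diff {n : ℕ} {U : Set (Vec n)} {f : Vec n → Vec n → ℝ} (hf : Sm U f)
    (hU : IsOpen U) {x y : Vec n} (hx : x ∈ U) (hy : y ≠ 0) :
    DifferentiableAt ℝ (fun p : Vec n × Vec n => f p.1 p.2) (x, y) :=
  (hf.contDiffAt hU hx hy).differentiableAt (by simp)

lemma Sm.hasy {n : ℕ} {U : Set (Vec n)} {f : Vec n → Vec n → ℝ} (hf : Sm U f)
    (hU : IsOpen U) {x y : Vec n} (hx : x ∈ U) (hy : y ≠ 0) :
    HasFDerivAt (f x) ((fderiv ℝ (fun p : Vec n × Vec n => f p.1 p.2) (x, y)).comp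
      (ContinuousLinearMap.inr ℝ (Vec n) (Vec n))) y := by
  have h := (hf.diff hU hx hy).hasFDerivAt
  have h2 : HasFDerivAt (fun y' : Vec n => (x, y')) (ContinuousLinearMap.inr ℝ (Vec n) (Vec n)) y :=
    hasFDerivAt_prodMk_right x y
  exact HasFDerivAt.comp (f := fun y' : Vec n => (x, y')) y h h2

lemma Sm.hasx {n : ℕ} {U : Set (Vec n)} {f : Vec n → Vec n → ℝ} (hf : Sm U f)
    (hU : IsOpen U) {x y : Vec n} (hx : x ∈ U) (hy : y ≠ 0) :
    HasFDerivAt (fun x' => f x' y) ((fderiv ℝ (fun p : Vec n × Vec n => f p.1 p.2) (x, y)).comp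
      (ContinuousLinearMap.inl ℝ (Vec n) (Vec n))) x := by
  have h := (hf.diff hU hx hy).hasFDerivAt
  have h2 : HasFDerivAt (fun x' : Vec n => (x', y)) (ContinuousLinearMap.inl ℝ (Vec n) (Vec n)) x :=
    hasFDerivAt_prodMk_left x y
  exact HasFDerivAt.comp (f := fun x' : Vec n => (x', y)) x h h2

lemma Sm.diffy {n : ℕ} {U : Set (Vec n)} {f : Vec n → Vec n → ℝ} (hf : Sm U f)
    (hU : IsOpen U) {x y : Vec n} (hx : x ∈ U) (hy : y ≠ 0) :
    DifferentiableAt ℝ (f x) y := (hf.hasy hU hx hy).differentiableAt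

lemma Sm.diffx {n : ℕ} {U : Set (Vec n)} {f : Vec n → Vec n → ℝ} (hf : Sm U f)
    (hU : IsOpen U) {x y : Vec n} (hx : x ∈ U) (hy : y ≠ 0) :
    DifferentiableAt ℝ (fun x' => f x' y) x := (hf.hasx hU hx hy).differentiableAt

lemma Sm.congr {n : ℕ} {U : Set (Vec n)} {f g : Vec n → Vec n → ℝ} (hf : Sm U f)
    (h : ∀ x ∈ U, ∀ y : Vec n, y ≠ 0 → g x y = f x y) : Sm U g :=
  ContDiffOn.congr hf (fun p hp => h p.1 hp.1 p.2 hp.2)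

lemma Sm.fderiv_dir {n : ℕ} {U : Set (Vec n)} {f : Vec n → Vec n → ℝ} (hf : Sm U f)
    (hU : IsOpen U) (v : Vec n × Vec n) :
    ContDiffOn ℝ (⊤ : ℕ∞) (fun p : Vec n × Vec n =>
      fderiv ℝ (fun p : Vec n × Vec n => f p.1 p.2) p v) (U ×ˢ {y : Vec n | y ≠ 0}) := by
  have h := ContDiffOn.fderiv_of_isOpen (m := (⊤ : ℕ∞)) hf (isOpen_dom hU) (by simp)
  exact h.clm_apply contDiffOn_const

lemma Sm.dy {n : ℕ} {U : Set (Vec n)} {f : Vec n → Vec n → ℝ} (hf : Sm U f)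
    (hU : IsOpen U) (i : Fin n) : Sm U (dy i f) := by
  refine ContDiffOn.congr (hf.fderiv_dir hU (0, Pi.single i 1)) ?_
  rintro ⟨x, y⟩ ⟨hx, hy⟩
  simp [_root_.dy, pd, (hf.hasy hU hx hy).fderiv]

lemma Sm.dx {n : ℕ} {U : Set (Vec n)} {f : Vec n → Vec n → ℝ} (hf : Sm U f)
    (hU : IsOpen U) (i : Fin n) : Sm U (dx i f) := by
  refine ContDiffOn.congr (hf.fderiv_dir hU (Pi.single i 1, 0)) ?_
  rintro ⟨x, y⟩ ⟨hx, hy⟩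
  simp [_root_.dx, pd, (hf.hasx hU hx hy).fderiv]

lemma dy_congr {n : ℕ} {U : Set (Vec n)} {f g : Vec n → Vec n → ℝ}
    (h : ∀ x ∈ U, ∀ y : Vec n, y ≠ 0 → f x y = g x y) (i : Fin n)
    {x y : Vec n} (hx : x ∈ U) (hy : y ≠ 0) : dy i f x y = dy i g x y := by
  unfold dy pd
  have : f x =ᶠ[nhds y] g x := by
    filter_upwards [isOpen_ne.mem_nhds hy] with y' hy'
    exact h x hx y' hy'
  rw [this.fderiv_eq]

lemma dx_congr {n : ℕ} {U : Set (Vec n)} (hU : IsOpen U) {f g : Vec n → Vec n → ℝ}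
    (h : ∀ x ∈ U, ∀ y : Vec n, y ≠ 0 → f x y = g x y) (i : Fin n)
    {x y : Vec n} (hx : x ∈ U) (hy : y ≠ 0) : dx i f x y = dx i g x y := by
  unfold dx pd
  have : (fun x' => f x' y) =ᶠ[nhds x] (fun x' => g x' y) := by
    filter_upwards [hU.mem_nhds hx] with x' hx'
    exact h x' hx' y hy
  rw [this.fderiv_eq]

lemma pd_add {n : ℕ} (i : Fin n) {f g : Vec n → ℝ} {x : Vec n} (hf : DifferentiableAt ℝ f x)
    (hg : DifferentiableAt ℝ g x) : pd i (fun x => f x + g x) x = pd i f x + pd i g x := by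
  unfold pd; rw [fderiv_fun_add hf hg]; simp

lemma pd_mul {n : ℕ} (i : Fin n) {f g : Vec n → ℝ} {x : Vec n} (hf : DifferentiableAt ℝ f x)
    (hg : DifferentiableAt ℝ g x) :
    pd i (fun x => f x * g x) x = pd i f x * g x + f x * pd i g x := by
  unfold pd; rw [fderiv_fun_mul hf hg]; simp; ring

lemma pd_inv {n : ℕ} (i : Fin n) {f : Vec n → ℝ} {x : Vec n} (hf : DifferentiableAt ℝ f x)
    (h0 : f x ≠ 0) : pd i (fun x => (f x)⁻¹) x = - pd i f x * ((f x)⁻¹) ^ 2 := by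
  unfold pd
  have h := (hasDerivAt_inv h0).comp_hasFDerivAt x hf.hasFDerivAt
  have h' : HasFDerivAt (fun x => (f x)⁻¹) (-(f x ^ 2)⁻¹ • fderiv ℝ f x) x := h
  rw [h'.fderiv]
  simp; ring

lemma pd_const {n : ℕ} (i : Fin n) (c : ℝ) (x : Vec n) : pd i (fun _ => c) x = 0 := by
  unfold pd; simp

lemma pd_coord {n : ℕ} (i j : Fin n) (x : Vec n) :
    pd i (fun y : Vec n => y j) x = if j = i then 1 else 0 := by
  unfold pd
  have : HasFDerivAt (fun y : Vec n => y j) (ContinuousLinearMap.proj (R := ℝ) (φ := fun _ : Fin n => ℝ) j) x :=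
    hasFDerivAt_apply j x
  rw [this.fderiv]
  simp [Pi.single_apply]

lemma pd_sum {n : ℕ} {ι : Type*} (s : Finset ι) (i : Fin n) {f : ι → Vec n → ℝ} {x : Vec n}
    (hf : ∀ k ∈ s, DifferentiableAt ℝ (f k) x) :
    pd i (fun x => ∑ k ∈ s, f k x) x = ∑ k ∈ s, pd i (f k) x := by
  unfold pd; rw [fderiv_fun_sum hf]; simp

section rules
variable {n : ℕ} {U : Set (Vec n)} {f g : Vec n → Vec n → ℝ}

lemma Sm.add (hf : Sm U f) (hg : Sm U g) : Sm U (fun x y => f x y + g x y) :=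
  ContDiffOn.add hf hg
lemma Sm.sub (hf : Sm U f) (hg : Sm U g) : Sm U (fun x y => f x y - g x y) :=
  ContDiffOn.sub hf hg
lemma Sm.mul (hf : Sm U f) (hg : Sm U g) : Sm U (fun x y => f x y * g x y) :=
  ContDiffOn.mul hf hg
lemma Sm.inv (hf : Sm U f) (h0 : ∀ x ∈ U, ∀ y : Vec n, y ≠ 0 → f x y ≠ 0) :
    Sm U (fun x y => (f x y)⁻¹) :=
  ContDiffOn.inv hf (fun p hp => h0 p.1 hp.1 p.2 hp.2)
lemma Sm.coef {c : Vec n → ℝ} (hc : ContDiffOn ℝ (⊤ : ℕ∞) c U) : Sm U (fun x _ => c x) :=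
  ContDiffOn.comp hc contDiffOn_fst (fun _ hp => hp.1)
lemma Sm.const (c : ℝ) : Sm U (fun _ _ => c) := contDiffOn_const
lemma Sm.coord (i : Fin n) : Sm U (fun _ y => y i) :=
  ((contDiff_apply ℝ ℝ i).comp contDiff_snd).contDiffOn
lemma Sm.sum {ι : Type*} {s : Finset ι} {f : ι → Vec n → Vec n → ℝ} (hf : ∀ k ∈ s, Sm U (f k)) :
    Sm U (fun x y => ∑ k ∈ s, f k x y) :=
  ContDiffOn.sum (f := fun k (p : Vec n × Vec n) => f k p.1 p.2) (fun k hk => hf k hk)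

variable (hU : IsOpen U) {x y : Vec n} (hx : x ∈ U) (hy : y ≠ 0)
include hU hx hy

lemma dy_add (hf : Sm U f) (hg : Sm U g) (i : Fin n) :
    dy i (fun x y => f x y + g x y) x y = dy i f x y + dy i g x y :=
  pd_add i (hf.diffy hU hx hy) (hg.diffy hU hx hy)
lemma dx_add (hf : Sm U f) (hg : Sm U g) (i : Fin n) :
    dx i (fun x y => f x y + g x y) x y = dx i f x y + dx i g x y :=
  pd_add i (hf.diffx hU hx hy) (hg.diffx hU hx hy)
lemma dy_mul (hf : Sm U f) (hg : Sm U g) (i : Fin n) :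
    dy i (fun x y => f x y * g x y) x y = dy i f x y * g x y + f x y * dy i g x y :=
  pd_mul i (hf.diffy hU hx hy) (hg.diffy hU hx hy)
lemma dx_mul (hf : Sm U f) (hg : Sm U g) (i : Fin n) :
    dx i (fun x y => f x y * g x y) x y = dx i f x y * g x y + f x y * dx i g x y :=
  pd_mul i (hf.diffx hU hx hy) (hg.diffx hU hx hy)
lemma dy_inv (hf : Sm U f) (h0 : f x y ≠ 0) (i : Fin n) :
    dy i (fun x y => (f x y)⁻¹) x y = - dy i f x y * ((f x y)⁻¹) ^ 2 :=
  pd_inv i (hf.diffy hU hx hy) h0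
lemma dx_inv (hf : Sm U f) (h0 : f x y ≠ 0) (i : Fin n) :
    dx i (fun x y => (f x y)⁻¹) x y = - dx i f x y * ((f x y)⁻¹) ^ 2 :=
  pd_inv i (hf.diffx hU hx hy) h0
lemma dy_sum {ι : Type*} {s : Finset ι} {f : ι → Vec n → Vec n → ℝ} (hf : ∀ k ∈ s, Sm U (f k))
    (i : Fin n) : dy i (fun x y => ∑ k ∈ s, f k x y) x y = ∑ k ∈ s, dy i (f k) x y :=
  pd_sum s i (fun k hk => (hf k hk).diffy hU hx hy)
lemma dx_sum {ι : Type*} {s : Finset ι} {f : ι → Vec n → Vec n → ℝ} (hf : ∀ k ∈ s, Sm U (f k))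
    (i : Fin n) : dx i (fun x y => ∑ k ∈ s, f k x y) x y = ∑ k ∈ s, dx i (f k) x y :=
  pd_sum s i (f := fun k x => f k x y) (fun k hk => (hf k hk).diffx hU hx hy)
end rules

lemma dy_coord {n : ℕ} (i j : Fin n) (x y : Vec n) :
    dy i (fun _ y : Vec n => y j) x y = if j = i then 1 else 0 := pd_coord i j y
lemma dx_coord {n : ℕ} (i j : Fin n) (x y : Vec n) :
    dx i (fun _ y : Vec n => y j) x y = 0 := pd_const i _ x
lemma dy_coef {n : ℕ} (i : Fin n) (c : Vec n → ℝ) (x y : Vec n) :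
    dy i (fun x _ => c x) x y = 0 := pd_const i _ y
lemma dx_coef {n : ℕ} (i : Fin n) (c : Vec n → ℝ) (x y : Vec n) :
    dx i (fun x _ => c x) x y = pd i c x := rfl

lemma pd_smooth {n : ℕ} {U : Set (Vec n)} (hU : IsOpen U) {c : Vec n → ℝ}
    (hc : ContDiffOn ℝ (⊤ : ℕ∞) c U) (i : Fin n) : ContDiffOn ℝ (⊤ : ℕ∞) (pd i c) U := by
  have h := ContDiffOn.fderiv_of_isOpen (m := (⊤ : ℕ∞)) hc hU (by simp)
  exact h.clm_apply contDiffOn_const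

end

noncomputable section

structure RD {n : ℕ} (U : Set (Vec n)) (a : Vec n → Matrix (Fin n) (Fin n) ℝ) (b : Vec n → Vec n) :
    Prop where
  op : IsOpen U
  sa : ∀ i j, ContDiffOn ℝ (⊤ : ℕ∞) (fun x => a x i j) U
  sb : ∀ i, ContDiffOn ℝ (⊤ : ℕ∞) (fun x => b x i) U
  symm : ∀ x ∈ U, ∀ i j, a x i j = a x j i
  pos : ∀ x ∈ U, (a x).PosDef
  Fpos : ∀ x ∈ U, ∀ y : Vec n, y ≠ 0 → 0 < ralpha a x y + rbeta b x y

/-- the Randers metric -/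
def RF {n : ℕ} (a : Vec n → Matrix (Fin n) (Fin n) ℝ) (b : Vec n → Vec n) (x y : Vec n) : ℝ :=
  ralpha a x y + rbeta b x y

/-- lowered y -/
def yl {n : ℕ} (a : Vec n → Matrix (Fin n) (Fin n) ℝ) (i : Fin n) (x y : Vec n) : ℝ :=
  ∑ k, a x i k * y k

/-- derivative of a in direction m, contracted once -/
def A1 {n : ℕ} (a : Vec n → Matrix (Fin n) (Fin n) ℝ) (m i : Fin n) (x y : Vec n) : ℝ :=
  ∑ k, pd m (fun x => a x i k) x * y k

/-- derivative of a in direction m, contracted twice -/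
def A2 {n : ℕ} (a : Vec n → Matrix (Fin n) (Fin n) ℝ) (m : Fin n) (x y : Vec n) : ℝ :=
  ∑ i, A1 a m i x y * y i

section basic
variable {n : ℕ} {U : Set (Vec n)} {a : Vec n → Matrix (Fin n) (Fin n) ℝ} {b : Vec n → Vec n}

lemma RD.Qpos (h : RD U a b) {x y : Vec n} (hx : x ∈ U) (hy : y ≠ 0) :
    0 < ∑ i, ∑ j, a x i j * y i * y j := by
  have h1 := (h.pos x hx).dotProduct_mulVec_pos hy
  simp only [dotProduct, mulVec, star_trivial] at h1
  refine h1.trans_eq ?_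
  refine Finset.sum_congr rfl fun i _ => ?_
  rw [Finset.mul_sum]
  exact Finset.sum_congr rfl fun j _ => by ring

lemma RD.apos (h : RD U a b) {x y : Vec n} (hx : x ∈ U) (hy : y ≠ 0) : 0 < ralpha a x y :=
  Real.sqrt_pos.2 (h.Qpos hx hy)

lemma RD.asq (h : RD U a b) {x y : Vec n} (hx : x ∈ U) (hy : y ≠ 0) :
    ralpha a x y * ralpha a x y = ∑ i, yl a i x y * y i := by
  unfold ralpha
  rw [Real.mul_self_sqrt (h.Qpos hx hy).le]
  refine Finset.sum_congr rfl fun i _ => ?_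
  unfold yl
  rw [Finset.sum_mul]
  exact Finset.sum_congr rfl fun j _ => by ring

lemma RD.yl_sm (h : RD U a b) (i : Fin n) : Sm U (yl a i) :=
  Sm.sum (f := fun k x y => a x i k * y k) fun k _ => (Sm.coef (h.sa i k)).mul (Sm.coord k)

lemma RD.Q_sm (h : RD U a b) : Sm U (fun x y => ∑ i, yl a i x y * y i) :=
  Sm.sum (f := fun i x y => yl a i x y * y i) fun i _ => (h.yl_sm i).mul (Sm.coord i)

lemma RD.al_sm (h : RD U a b) : Sm U (ralpha a) := by
  have : Sm U (fun x y => Real.sqrt (∑ i, yl a i x y * y i)) := by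
    refine ContDiffOn.sqrt h.Q_sm ?_
    rintro ⟨x, y⟩ ⟨hx, hy⟩
    have := h.apos hx hy
    rw [← h.asq hx hy]; positivity
  refine this.congr ?_
  intro x hx y hy
  rw [← h.asq hx hy, Real.sqrt_mul_self (h.apos hx hy).le]

lemma RD.be_sm (h : RD U a b) : Sm U (rbeta b) :=
  Sm.sum (f := fun i x y => b x i * y i) fun i _ => (Sm.coef (h.sb i)).mul (Sm.coord i)

lemma RD.F_sm (h : RD U a b) : Sm U (RF a b) := h.al_sm.add h.be_sm

lemma RD.dy_yl (h : RD U a b) {x y : Vec n} (hx : x ∈ U) (hy : y ≠ 0) (l i : Fin n) :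
    dy l (yl a i) x y = a x i l := by
  have := dy_sum h.op hx hy (s := Finset.univ) (f := fun k x y => a x i k * y k)
    (fun k _ => (Sm.coef (h.sa i k)).mul (Sm.coord k)) l
  refine this.trans ?_
  have : ∀ k, dy l (fun x y => a x i k * y k) x y = a x i k * (if k = l then 1 else 0) := by
    intro k
    rw [dy_mul h.op hx hy (Sm.coef (h.sa i k)) (Sm.coord k), dy_coef l (fun x => a x i k), dy_coord]; ring
  simp [this]

lemma RD.dx_yl (h : RD U a b) {x y : Vec n} (hx : x ∈ U) (hy : y ≠ 0) (l i : Fin n) :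
    dx l (yl a i) x y = A1 a l i x y := by
  have := dx_sum h.op hx hy (s := Finset.univ) (f := fun k x y => a x i k * y k)
    (fun k _ => (Sm.coef (h.sa i k)).mul (Sm.coord k)) l
  refine this.trans ?_
  unfold A1
  refine Finset.sum_congr rfl fun k _ => ?_
  rw [dx_mul h.op hx hy (Sm.coef (h.sa i k)) (Sm.coord k), dx_coef l (fun x => a x i k), dx_coord]; ring

lemma RD.dy_al (h : RD U a b) {x y : Vec n} (hx : x ∈ U) (hy : y ≠ 0) (l : Fin n) :
    dy l (ralpha a) x y = yl a l x y * (ralpha a x y)⁻¹ := by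
  have h1 := dy_congr (fun x hx y hy => h.asq (x := x) (y := y) hx hy) l hx hy
  rw [dy_mul h.op hx hy h.al_sm h.al_sm] at h1
  have h2 := dy_sum h.op hx hy (s := Finset.univ) (f := fun i x y => yl a i x y * y i)
    (fun i _ => (h.yl_sm i).mul (Sm.coord i)) l
  rw [h2] at h1
  have h3 : ∀ i, dy l (fun x y => yl a i x y * y i) x y
      = a x l i * y i + yl a i x y * (if i = l then 1 else 0) := by
    intro i
    rw [dy_mul h.op hx hy (h.yl_sm i) (Sm.coord i), h.dy_yl hx hy, dy_coord, h.symm x hx]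
  simp only [h3, Finset.sum_add_distrib] at h1
  simp only [mul_ite, mul_one, mul_zero, Finset.sum_ite_eq', Finset.mem_univ, if_true] at h1
  have h4 : ∑ i, a x l i * y i = yl a l x y := rfl
  rw [h4] at h1
  have := h.apos hx hy
  field_simp
  linarith

lemma RD.dx_al (h : RD U a b) {x y : Vec n} (hx : x ∈ U) (hy : y ≠ 0) (l : Fin n) :
    dx l (ralpha a) x y = (1/2) * A2 a l x y * (ralpha a x y)⁻¹ := by
  have h1 := dx_congr h.op (fun x hx y hy => h.asq (x := x) (y := y) hx hy) l hx hy
  rw [dx_mul h.op hx hy h.al_sm h.al_sm] at h1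
  have h2 := dx_sum h.op hx hy (s := Finset.univ) (f := fun i x y => yl a i x y * y i)
    (fun i _ => (h.yl_sm i).mul (Sm.coord i)) l
  rw [h2] at h1
  have h3 : ∀ i, dx l (fun x y => yl a i x y * y i) x y = A1 a l i x y * y i := by
    intro i
    rw [dx_mul h.op hx hy (h.yl_sm i) (Sm.coord i), h.dx_yl hx hy, dx_coord]; ring
  simp only [h3] at h1
  have h4 : ∑ i, A1 a l i x y * y i = A2 a l x y := rfl
  rw [h4] at h1
  have := h.apos hx hy
  field_simp
  linarith

lemma RD.dy_be (h : RD U a b) {x y : Vec n} (hx : x ∈ U) (hy : y ≠ 0) (l : Fin n) :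
    dy l (rbeta b) x y = b x l := by
  have := dy_sum h.op hx hy (s := Finset.univ) (f := fun k x y => b x k * y k)
    (fun k _ => (Sm.coef (h.sb k)).mul (Sm.coord k)) l
  refine this.trans ?_
  have : ∀ k, dy l (fun x y => b x k * y k) x y = b x k * (if k = l then 1 else 0) := by
    intro k
    rw [dy_mul h.op hx hy (Sm.coef (h.sb k)) (Sm.coord k), dy_coef l (fun x => b x k), dy_coord]; ring
  simp [this]

lemma RD.dx_be (h : RD U a b) {x y : Vec n} (hx : x ∈ U) (hy : y ≠ 0) (l : Fin n) :
    dx l (rbeta b) x y = ∑ k, pd l (fun x => b x k) x * y k := by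
  have := dx_sum h.op hx hy (s := Finset.univ) (f := fun k x y => b x k * y k)
    (fun k _ => (Sm.coef (h.sb k)).mul (Sm.coord k)) l
  refine this.trans ?_
  refine Finset.sum_congr rfl fun k _ => ?_
  rw [dx_mul h.op hx hy (Sm.coef (h.sb k)) (Sm.coord k), dx_coef l (fun x => b x k), dx_coord]; ring

end basic

/-- Class of functions: pole order `k` along `F = 0`, degree `d` in `y`. -/
inductive PO {n : ℕ} (U : Set (Vec n)) (a : Vec n → Matrix (Fin n) (Fin n) ℝ) (b : Vec n → Vec n) :
    ℕ → ℤ → (Vec n → Vec n → ℝ) → Prop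
  | coef (c : Vec n → ℝ) (hc : ContDiffOn ℝ (⊤ : ℕ∞) c U) : PO U a b 0 0 (fun x _ => c x)
  | coord (i : Fin n) : PO U a b 0 1 (fun _ y => y i)
  | al : PO U a b 0 1 (ralpha a)
  | ali : PO U a b 0 (-1) (fun x y => (ralpha a x y)⁻¹)
  | Fi : PO U a b 1 (-1) (fun x y => (RF a b x y)⁻¹)
  | add {k d f g} : PO U a b k d f → PO U a b k d g → PO U a b k d (fun x y => f x y + g x y)
  | mul {k d f k' d' g} : PO U a b k d f → PO U a b k' d' g →
      PO U a b (k + k') (d + d') (fun x y => f x y * g x y)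
  | mono {k d f} : PO U a b k d f → PO U a b (k + 1) d f
  | congr {k d f g} : PO U a b k d f → (∀ x ∈ U, ∀ y : Vec n, y ≠ 0 → g x y = f x y) → PO U a b k d g

namespace PO
variable {n : ℕ} {U : Set (Vec n)} {a : Vec n → Matrix (Fin n) (Fin n) ℝ} {b : Vec n → Vec n}
  {k k' : ℕ} {d d' : ℤ} {f g : Vec n → Vec n → ℝ}

lemma of_le (hf : PO U a b k d f) (h : k ≤ k') : PO U a b k' d f := by
  induction h with
  | refl => exact hf
  | step _ ih => exact ih.mono

lemma cast (hf : PO U a b k d f) (h : k ≤ k') (hd : d = d') : PO U a b k' d' f := hd ▸ hf.of_le h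

lemma const (c : ℝ) : PO U a b 0 0 (fun _ _ => c) := PO.coef (fun _ => c) contDiffOn_const

lemma zero (k : ℕ) (d : ℤ) : PO U a b k d (fun _ _ => 0) := by
  have h1 : PO U a b 0 0 (fun _ _ => 0) := const 0
  rcases le_total 0 d with hd | hd
  · obtain ⟨m, rfl⟩ := Int.eq_ofNat_of_zero_le hd
    induction m with
    | zero => exact h1.cast (by omega) rfl
    | succ m ih =>
      refine ((PO.mul (ih (by omega)) (PO.al)).cast (k' := k) (d' := _) le_rfl (by push_cast; rfl)).congr ?_
      intros; simp
  · obtain ⟨m, hm⟩ := Int.eq_ofNat_of_zero_le (Int.neg_nonneg.2 hd)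
    obtain rfl : d = -(m : ℤ) := by omega
    induction m with
    | zero => exact h1.cast (by omega) rfl
    | succ m ih =>
      refine ((PO.mul (ih (by omega) (by omega)) (PO.ali)).cast (k' := k) (d' := _) le_rfl (by push_cast; ring)).congr ?_
      intros; simp

lemma cmul (c : ℝ) (hf : PO U a b k d f) : PO U a b k d (fun x y => c * f x y) :=
  ((const c).mul hf).cast (by omega) (by omega)

lemma neg (hf : PO U a b k d f) : PO U a b k d (fun x y => - f x y) :=
  (hf.cmul (-1)).congr (by intros; ring)

lemma sub (hf : PO U a b k d f) (hg : PO U a b k d g) : PO U a b k d (fun x y => f x y - g x y) :=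
  (hf.add hg.neg).congr (by intros; ring)

lemma sum {ι : Type*} {s : Finset ι} {f : ι → Vec n → Vec n → ℝ} (hf : ∀ i ∈ s, PO U a b k d (f i)) :
    PO U a b k d (fun x y => ∑ i ∈ s, f i x y) := by
  classical
  induction s using Finset.induction_on with
  | empty => exact (zero k d).congr (by intros; simp)
  | insert i s hi ih =>
    refine ((hf i (by simp)).add (ih fun j hj => hf j (by simp [hj]))).congr ?_
    intros; rw [Finset.sum_insert hi]

lemma cf (c : Vec n → ℝ) (hc : ContDiffOn ℝ (⊤ : ℕ∞) c U) (hf : PO U a b k d f) :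
    PO U a b k d (fun x y => c x * f x y) :=
  ((PO.coef c hc).mul hf).cast (by omega) (by omega)

variable (h : RD U a b)
include h

lemma sm (hf : PO U a b k d f) : Sm U f := by
  induction hf with
  | coef c hc => exact Sm.coef hc
  | coord i => exact Sm.coord i
  | al => exact h.al_sm
  | ali => exact h.al_sm.inv fun x hx y hy => (h.apos hx hy).ne'
  | Fi => exact h.F_sm.inv fun x hx y hy => (h.Fpos x hx y hy).ne'
  | add _ _ h1 h2 => exact h1.add h2
  | mul _ _ h1 h2 => exact h1.mul h2
  | mono _ h1 => exact h1
  | congr _ h2 h1 => exact h1.congr h2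

lemma be : PO U a b 0 1 (rbeta b) :=
  PO.sum (f := fun i x y => b x i * y i) fun i _ => (PO.coord i).cf _ (h.sb i)

lemma F : PO U a b 0 1 (RF a b) := PO.al.add (be h)

lemma yl (i : Fin n) : PO U a b 0 1 (yl a i) :=
  PO.sum (f := fun k x y => a x i k * y k) fun k _ => (PO.coord k).cf _ (h.sa i k)

lemma A1 (m i : Fin n) : PO U a b 0 1 (A1 a m i) :=
  PO.sum (f := fun k x y => pd m (fun x => a x i k) x * y k)
    fun k _ => (PO.coord k).cf _ (pd_smooth h.op (h.sa i k) m)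

lemma A2 (m : Fin n) : PO U a b 0 2 (A2 a m) :=
  PO.sum (f := fun i x y => _root_.A1 a m i x y * y i) fun i _ => (A1 h m i).mul (PO.coord i)

lemma euler (hf : PO U a b k d f) {x y : Vec n} (hx : x ∈ U) (hy : y ≠ 0) :
    ∑ m, y m * dy m f x y = d * f x y := by
  have hal : ∑ m, y m * dy m (ralpha a) x y = ralpha a x y := by
    have h1 := h.asq hx hy
    have h2 : ∑ m, y m * dy m (ralpha a) x y = (∑ i, _root_.yl a i x y * y i) * (ralpha a x y)⁻¹ := by
      rw [Finset.sum_mul]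
      exact Finset.sum_congr rfl fun m _ => by rw [h.dy_al hx hy]; ring
    have := (h.apos hx hy).ne'
    rw [h2, ← h1]; field_simp
  induction hf with
  | coef c hc => simp [dy_coef]
  | coord i => simp [dy_coord]
  | al => simpa using hal
  | ali =>
    have : ∀ m, y m * dy m (fun x y => (ralpha a x y)⁻¹) x y =
        (y m * dy m (ralpha a) x y) * (-((ralpha a x y)⁻¹)^2) := by
      intro m; rw [dy_inv h.op hx hy h.al_sm (h.apos hx hy).ne']; ring
    simp only [this]
    rw [← Finset.sum_mul, hal]
    have := (h.apos hx hy).ne'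
    push_cast; field_simp
  | Fi =>
    have h0 : RF a b x y ≠ 0 := (h.Fpos x hx y hy).ne'
    have : ∀ m, y m * dy m (fun x y => (RF a b x y)⁻¹) x y =
        (y m * dy m (ralpha a) x y + b x m * y m) * (-((RF a b x y)⁻¹)^2) := by
      intro m; rw [dy_inv h.op hx hy h.F_sm h0]
      unfold RF
      rw [dy_add h.op hx hy h.al_sm h.be_sm, h.dy_be hx hy]; ring
    simp only [this]
    rw [← Finset.sum_mul, Finset.sum_add_distrib, hal]
    have h3 : ralpha a x y + ∑ i, b x i * y i = RF a b x y := rfl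
    rw [h3]
    push_cast; field_simp
  | @add k d f g hf hg h1 h2 =>
    have : ∀ m, y m * dy m (fun x y => f x y + g x y) x y = y m * dy m f x y + y m * dy m g x y := by
      intro m; rw [dy_add h.op hx hy (hf.sm h) (hg.sm h)]; ring
    simp only [this, Finset.sum_add_distrib, h1, h2]; ring
  | @mul k d f k' d' g hf hg h1 h2 =>
    have : ∀ m, y m * dy m (fun x y => f x y * g x y) x y
        = (y m * dy m f x y) * g x y + (y m * dy m g x y) * f x y := by
      intro m; rw [dy_mul h.op hx hy (hf.sm h) (hg.sm h)]; ring
    simp only [this, Finset.sum_add_distrib, ← Finset.sum_mul, h1, h2]; push_cast; ring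
  | mono _ h1 => exact h1
  | congr hf h2 h1 =>
    rw [h2 x hx y hy, ← h1]
    exact Finset.sum_congr rfl fun m _ => by rw [dy_congr h2 m hx hy]

lemma dy' (hf : PO U a b k d f) (m : Fin n) : PO U a b (k + min k 1) (d - 1) (dy m f) := by
  induction hf with
  | coef c hc => exact (zero 0 _).congr fun x _ y _ => by simp [dy_coef]
  | coord i => exact (const (if i = m then 1 else 0)).congr fun x _ y _ => by simp [dy_coord]
  | al => exact ((yl h m).mul PO.ali).congr fun x hx y hy => h.dy_al hx hy m
  | ali =>
    refine (((yl h m).mul (PO.ali.mul (PO.ali.mul PO.ali))).neg.cast (by omega) (by omega)).congr ?_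
    intro x hx y hy
    rw [dy_inv h.op hx hy h.al_sm (h.apos hx hy).ne', h.dy_al hx hy]; ring
  | Fi =>
    refine ((((((yl h m).mul PO.ali).add (PO.coef _ (h.sb m))).mul (PO.Fi.mul PO.Fi)).neg).cast
      (by omega) (by omega)).congr ?_
    intro x hx y hy
    rw [dy_inv h.op hx hy h.F_sm (h.Fpos x hx y hy).ne']
    have : dy m (RF a b) x y = _root_.yl a m x y * (ralpha a x y)⁻¹ + b x m := by
      unfold RF; rw [dy_add h.op hx hy h.al_sm h.be_sm, h.dy_be hx hy, h.dy_al hx hy]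
    rw [this]; ring
  | add hf hg h1 h2 => exact (h1.add h2).congr fun x hx y hy => dy_add h.op hx hy (hf.sm h) (hg.sm h) m
  | mul hf hg h1 h2 =>
    refine (((h1.mul hg).cast (by omega) (by omega)).add ((hf.mul h2).cast (by omega) (by omega))).congr
      fun x hx y hy => dy_mul h.op hx hy (hf.sm h) (hg.sm h) m
  | mono _ h1 => exact h1.cast (by omega) rfl
  | congr hf h2 h1 => exact h1.congr fun x hx y hy => dy_congr h2 m hx hy

lemma dx' (hf : PO U a b k d f) (m : Fin n) : PO U a b (k + min k 1) d (dx m f) := by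
  have hal : PO U a b 0 1 (dx m (ralpha a)) :=
    ((((A2 h m).cmul (1/2)).mul PO.ali).cast (by omega) (by omega)).congr
      fun x hx y hy => h.dx_al hx hy m
  induction hf with
  | coef c hc => exact PO.coef _ (pd_smooth h.op hc m)
  | coord i => exact (zero 0 _).congr fun x _ y _ => by simp [dx_coord]
  | al => exact hal
  | ali =>
    refine ((hal.mul (PO.ali.mul PO.ali)).neg.cast (by omega) (by omega)).congr ?_
    intro x hx y hy
    rw [dx_inv h.op hx hy h.al_sm (h.apos hx hy).ne']; ring
  | Fi =>
    have hb : PO U a b 0 1 (dx m (rbeta b)) :=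
      (PO.sum (f := fun i x y => pd m (fun x => b x i) x * y i) fun i (_ : i ∈ Finset.univ) =>
        (PO.coord i).cf _ (pd_smooth h.op (h.sb i) m)).congr fun x hx y hy => h.dx_be hx hy m
    refine (((hal.add hb).mul (PO.Fi.mul PO.Fi)).neg.cast (by omega) (by omega)).congr ?_
    intro x hx y hy
    rw [dx_inv h.op hx hy h.F_sm (h.Fpos x hx y hy).ne']
    have : dx m (RF a b) x y = dx m (ralpha a) x y + dx m (rbeta b) x y := by
      unfold RF; rw [dx_add h.op hx hy h.al_sm h.be_sm]
    rw [this]; ring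
  | add hf hg h1 h2 => exact (h1.add h2).congr fun x hx y hy => dx_add h.op hx hy (hf.sm h) (hg.sm h) m
  | mul hf hg h1 h2 =>
    refine (((h1.mul hg).cast (by omega) (by omega)).add ((hf.mul h2).cast (by omega) (by omega))).congr
      fun x hx y hy => dx_mul h.op hx hy (hf.sm h) (hg.sm h) m
  | mono _ h1 => exact h1.cast (by omega) rfl
  | congr hf h2 h1 => exact h1.congr fun x hx y hy => dx_congr h.op h2 m hx hy

lemma dy0 (hf : PO U a b 0 d f) (m : Fin n) : PO U a b 0 (d - 1) (dy m f) := hf.dy' h m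
lemma dx0 (hf : PO U a b 0 d f) (m : Fin n) : PO U a b 0 d (dx m f) := hf.dx' h m

/-- clearing the poles -/
lemma clear (hf : PO U a b k d f) :
    PO U a b 0 (d + k) (fun x y => f x y * RF a b x y ^ k) := by
  have hpow : ∀ (m : ℕ), PO U a b 0 m (fun x y => RF a b x y ^ m) := by
    intro m
    induction m with
    | zero => exact (const 1).congr (by intros; simp)
    | succ m ih => exact ((ih.mul (F h)).cast (by omega) (by push_cast; ring)).congr (by intros; ring)
  induction hf with
  | coef c hc => exact (PO.coef c hc).congr (by intros; simp)
  | coord i => exact (PO.coord i).congr (by intros; simp)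
  | al => exact (PO.al).congr (by intros; simp)
  | ali => exact (PO.ali).congr (by intros; simp)
  | Fi =>
    refine ((const 1).cast le_rfl (by simp)).congr ?_
    intro x hx y hy
    have h0 : RF a b x y ≠ 0 := (h.Fpos x hx y hy).ne'
    field_simp
  | add hf hg h1 h2 => exact (h1.add h2).congr (by intros; ring)
  | mul hf hg h1 h2 => exact ((h1.mul h2).cast (by omega) (by push_cast; ring)).congr (by intros; ring)
  | mono _ h1 => exact ((h1.mul (F h)).cast (by omega) (by push_cast; ring)).congr (by intros; ring)
  | congr hf h2 h1 => exact h1.congr fun x hx y hy => by rw [h2 x hx y hy]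

end PO
end

noncomputable section

section defs
variable {n : ℕ} (a : Vec n → Matrix (Fin n) (Fin n) ℝ) (b : Vec n → Vec n)

def bs (i : Fin n) (x : Vec n) : ℝ := ∑ j, (a x)⁻¹ i j * b x j
def bb (x : Vec n) : ℝ := ∑ i, b x i * bs a b i x
def B1 (l : Fin n) (x y : Vec n) : ℝ := ∑ k, pd l (fun x => b x k) x * y k
def s0 (l : Fin n) (x y : Vec n) : ℝ :=
  (1/2) * (∑ m, pd m (fun x => b x l) x * y m - B1 b l x y)
def Cc (l : Fin n) (x y : Vec n) : ℝ := 2 * ∑ m, A1 a m l x y * y m - A2 a l x y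
def Ga (i : Fin n) (x y : Vec n) : ℝ := (1/4) * ∑ l, (a x)⁻¹ i l * Cc a l x y
def sU (i : Fin n) (x y : Vec n) : ℝ := ∑ l, (a x)⁻¹ i l * s0 b l x y
def ss (x y : Vec n) : ℝ := ∑ j, b x j * sU a b j x y
def r00 (x y : Vec n) : ℝ := ∑ m, B1 b m x y * y m - 2 * ∑ j, b x j * Ga a j x y
def rho (x y : Vec n) : ℝ := r00 a b x y - 2 * ralpha a x y * ss a b x y
def Gh (i : Fin n) (x y : Vec n) : ℝ := Ga a i x y + ralpha a x y * sU a b i x y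
def Hinv (i j : Fin n) (x y : Vec n) : ℝ :=
  ralpha a x y * (RF a b x y)⁻¹ * (a x)⁻¹ i j
  - ralpha a x y * (RF a b x y)⁻¹ ^ 2 * (bs a b i x * y j + y i * bs a b j x)
  + (bb a b x * ralpha a x y + rbeta b x y) * (RF a b x y)⁻¹ ^ 3 * (y i * y j)
end defs

section geo
variable {n : ℕ} {U : Set (Vec n)} {a : Vec n → Matrix (Fin n) (Fin n) ℝ} {b : Vec n → Vec n}
  (h : RD U a b) {x y : Vec n} (hx : x ∈ U) (hy : y ≠ 0)
include h hx

lemma a_mul_inv : a x * (a x)⁻¹ = 1 :=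
  Matrix.mul_nonsing_inv _ ((Matrix.isUnit_iff_isUnit_det _).1 (h.pos x hx).isUnit)

lemma a_inv_mul : (a x)⁻¹ * a x = 1 :=
  Matrix.nonsing_inv_mul _ ((Matrix.isUnit_iff_isUnit_det _).1 (h.pos x hx).isUnit)

lemma inv_symm (i j : Fin n) : (a x)⁻¹ i j = (a x)⁻¹ j i := by
  have h1 : (a x)ᵀ = a x := by ext i j; exact h.symm x hx j i
  have h2 : ((a x)⁻¹)ᵀ = (a x)⁻¹ := by rw [Matrix.transpose_nonsing_inv, h1]
  exact (congrFun (congrFun h2 j) i).trans rfl |>.trans rfl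

/-- `a · a⁻¹ w = w` -/
lemma a_up (w : Vec n) (i : Fin n) : ∑ j, a x i j * ∑ l, (a x)⁻¹ j l * w l = w i := by
  have : a x *ᵥ ((a x)⁻¹ *ᵥ w) = w := by rw [Matrix.mulVec_mulVec, a_mul_inv h hx, Matrix.one_mulVec]
  exact congrFun this i

lemma up_a (w : Vec n) (i : Fin n) : ∑ j, (a x)⁻¹ i j * ∑ l, a x j l * w l = w i := by
  have : (a x)⁻¹ *ᵥ (a x *ᵥ w) = w := by rw [Matrix.mulVec_mulVec, a_inv_mul h hx, Matrix.one_mulVec]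
  exact congrFun this i

/-- pairing lowered `u` with raised `w` -/
lemma pair_up (u w : Vec n) : ∑ j, (∑ k, a x j k * u k) * ∑ l, (a x)⁻¹ j l * w l = ∑ k, u k * w k := by
  have h1 : ∀ j, (∑ k, a x j k * u k) * ∑ l, (a x)⁻¹ j l * w l
      = ∑ k, u k * (a x k j * ∑ l, (a x)⁻¹ j l * w l) := by
    intro j
    rw [Finset.sum_mul]
    exact Finset.sum_congr rfl fun k _ => by rw [h.symm x hx j k]; ring
  simp only [h1]
  rw [Finset.sum_comm]
  exact Finset.sum_congr rfl fun k _ => by rw [← Finset.mul_sum, a_up h hx]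

lemma a_bs (i : Fin n) : ∑ j, a x i j * bs a b j x = b x i := a_up h hx (b x) i

lemma yl_bs : ∑ j, yl a j x y * bs a b j x = rbeta b x y :=
  (pair_up h hx y (b x)).trans (Finset.sum_congr rfl fun _ _ => by ring)

lemma yl_inv (k : Fin n) : ∑ j, yl a j x y * (a x)⁻¹ j k = y k := by
  rw [← up_a h hx y k]
  exact Finset.sum_congr rfl fun j _ => by rw [inv_symm h hx j k]; unfold yl; ring

lemma b_inv (k : Fin n) : ∑ j, b x j * (a x)⁻¹ j k = bs a b k x :=
  Finset.sum_congr rfl fun j _ => by rw [inv_symm h hx j k]; ring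

include hy

lemma dyF (l : Fin n) : dy l (RF a b) x y = yl a l x y * (ralpha a x y)⁻¹ + b x l := by
  unfold RF; rw [dy_add h.op hx hy h.al_sm h.be_sm, h.dy_be hx hy, h.dy_al hx hy]

lemma dxF (l : Fin n) : dx l (RF a b) x y
    = (1/2) * A2 a l x y * (ralpha a x y)⁻¹ + B1 b l x y := by
  unfold RF; rw [dx_add h.op hx hy h.al_sm h.be_sm, h.dx_be hx hy, h.dx_al hx hy]; rfl

omit hx hy in
lemma ali_sm : Sm U (fun x y => (ralpha a x y)⁻¹) :=
  h.al_sm.inv fun x hx y hy => (h.apos hx hy).ne'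

lemma dydyF (i l : Fin n) : dy i (dy l (RF a b)) x y
    = a x i l * (ralpha a x y)⁻¹ - yl a i x y * yl a l x y * (ralpha a x y)⁻¹ ^ 3 := by
  rw [dy_congr (fun x hx y hy => dyF h (x := x) (y := y) hx hy l) i hx hy,
    dy_add h.op hx hy ((h.yl_sm l).mul (ali_sm h)) (Sm.coef (h.sb l)),
    dy_mul h.op hx hy (h.yl_sm l) (ali_sm h), h.dy_yl hx hy,
    dy_inv h.op hx hy h.al_sm (h.apos hx hy).ne', h.dy_al hx hy, dy_coef i (fun x => b x l),
    h.symm x hx l i]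
  ring

lemma dxdyF (m l : Fin n) : dx m (dy l (RF a b)) x y
    = A1 a m l x y * (ralpha a x y)⁻¹ - (1/2) * yl a l x y * A2 a m x y * (ralpha a x y)⁻¹ ^ 3
      + pd m (fun x => b x l) x := by
  rw [dx_congr h.op (fun x hx y hy => dyF h (x := x) (y := y) hx hy l) m hx hy,
    dx_add h.op hx hy ((h.yl_sm l).mul (ali_sm h)) (Sm.coef (h.sb l)),
    dx_mul h.op hx hy (h.yl_sm l) (ali_sm h), h.dx_yl hx hy,
    dx_inv h.op hx hy h.al_sm (h.apos hx hy).ne', h.dx_al hx hy, dx_coef m (fun x => b x l)]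
  ring

lemma dyF2 (l : Fin n) : dy l (F2 (RF a b)) x y = 2 * RF a b x y * dy l (RF a b) x y := by
  have : F2 (RF a b) = fun x y => RF a b x y * RF a b x y := by
    funext x y; unfold F2; ring
  rw [this, dy_mul h.op hx hy h.F_sm h.F_sm]; ring

lemma dxF2 (l : Fin n) : dx l (F2 (RF a b)) x y = 2 * RF a b x y * dx l (RF a b) x y := by
  have : F2 (RF a b) = fun x y => RF a b x y * RF a b x y := by
    funext x y; unfold F2; ring
  rw [this, dx_mul h.op hx hy h.F_sm h.F_sm]; ring

lemma gmat_eq (i j : Fin n) : gmat (RF a b) x y i j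
    = RF a b x y * dy i (dy j (RF a b)) x y + dy i (RF a b) x y * dy j (RF a b) x y := by
  have h1 : dy i (fun x' y' => dy j (F2 (RF a b)) x' y') x y
      = dy i (fun x y => (2 * RF a b x y) * dy j (RF a b) x y) x y :=
    dy_congr (fun x hx y hy => dyF2 h (x := x) (y := y) hx hy j) i hx hy
  simp only [gmat, Matrix.of_apply]
  rw [h1, dy_mul h.op hx hy ((Sm.const 2).mul h.F_sm) (h.F_sm.dy h.op j),
    dy_mul h.op hx hy (Sm.const 2) h.F_sm]
  rw [show dy i (fun _ _ => (2:ℝ)) x y = 0 from pd_const i _ y]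
  ring

lemma gmat_split (w : Vec n) (i : Fin n) : ∑ j, gmat (RF a b) x y i j * w j =
    RF a b x y * (ralpha a x y)⁻¹ * ∑ j, a x i j * w j
    + (- RF a b x y * yl a i x y * (ralpha a x y)⁻¹ ^ 3
        + (yl a i x y * (ralpha a x y)⁻¹ + b x i) * (ralpha a x y)⁻¹) * ∑ j, yl a j x y * w j
    + (yl a i x y * (ralpha a x y)⁻¹ + b x i) * ∑ j, b x j * w j := by
  simp only [Finset.mul_sum, ← Finset.sum_add_distrib]
  refine Finset.sum_congr rfl fun j _ => ?_
  rw [gmat_eq h hx hy, dydyF h hx hy, dyF h hx hy, dyF h hx hy]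
  ring

omit h hx hy in
lemma Hinv_pair (w : Vec n) (k : Fin n) : ∑ j, w j * Hinv a b j k x y =
    ralpha a x y * (RF a b x y)⁻¹ * ∑ j, w j * (a x)⁻¹ j k
    - ralpha a x y * (RF a b x y)⁻¹ ^ 2 * ((∑ j, w j * bs a b j x) * y k + (∑ j, w j * y j) * bs a b k x)
    + (bb a b x * ralpha a x y + rbeta b x y) * (RF a b x y)⁻¹ ^ 3 * ((∑ j, w j * y j) * y k) := by
  simp only [Finset.mul_sum, Finset.sum_mul, ← Finset.sum_add_distrib, ← Finset.sum_sub_distrib]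
  refine Finset.sum_congr rfl fun j _ => ?_
  unfold Hinv; ring

lemma g_Hinv (i k : Fin n) : ∑ j, gmat (RF a b) x y i j * Hinv a b j k x y = if i = k then 1 else 0 := by
  rw [gmat_split h hx hy (fun j => Hinv a b j k x y) i, Hinv_pair, Hinv_pair, Hinv_pair, a_bs h hx,
    yl_bs h hx, yl_inv h hx, b_inv h hx, ← h.asq hx hy]
  have e1 : ∑ j, a x i j * (a x)⁻¹ j k = if i = k then 1 else 0 := by
    have := congrFun (congrFun (a_mul_inv h hx) i) k
    rwa [Matrix.mul_apply, Matrix.one_apply] at this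
  have e2 : ∑ j, a x i j * y j = yl a i x y := rfl
  have e3 : ∑ j, b x j * bs a b j x = bb a b x := rfl
  have e4 : ∑ j, b x j * y j = rbeta b x y := rfl
  rw [e1, e2, e3, e4]
  have hF : RF a b x y ≠ 0 := (h.Fpos x hx y hy).ne'
  have hal := (h.apos hx hy).ne'
  have hbe : rbeta b x y = RF a b x y - ralpha a x y := by unfold RF; ring
  rw [hbe]
  generalize RF a b x y = F at *
  generalize ralpha a x y = al at *
  generalize (if i = k then (1:ℝ) else 0) = δ
  field_simp
  ring

lemma ginv_eq (i j : Fin n) : ginv (RF a b) x y i j = Hinv a b i j x y := by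
  have : ginv (RF a b) x y = Matrix.of (fun i j => Hinv a b i j x y) := by
    unfold ginv
    apply Matrix.inv_eq_right_inv
    ext i k
    rw [Matrix.mul_apply, Matrix.one_apply]
    exact g_Hinv h hx hy i k
  rw [this]; rfl

lemma ginv_g (w : Vec n) (i : Fin n) :
    ∑ l, ginv (RF a b) x y i l * ∑ j, gmat (RF a b) x y l j * w j = w i := by
  have h1 : gmat (RF a b) x y * Matrix.of (fun i j => Hinv a b i j x y) = 1 := by
    ext i k
    rw [Matrix.mul_apply, Matrix.one_apply]
    exact g_Hinv h hx hy i k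
  have h2 : ginv (RF a b) x y * gmat (RF a b) x y = 1 := by
    unfold ginv
    rw [Matrix.inv_eq_right_inv h1]
    exact mul_eq_one_comm.1 h1
  have : ginv (RF a b) x y *ᵥ (gmat (RF a b) x y *ᵥ w) = w := by
    rw [Matrix.mulVec_mulVec, h2, Matrix.one_mulVec]
  exact congrFun this i

omit hy in
lemma a_Ga (i : Fin n) : ∑ j, a x i j * Ga a j x y = (1/4) * Cc a i x y := by
  rw [← a_up h hx (fun l => Cc a l x y) i, Finset.mul_sum]
  exact Finset.sum_congr rfl fun j _ => by unfold Ga; ring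

omit hy in
lemma a_sU (i : Fin n) : ∑ j, a x i j * sU a b j x y = s0 b i x y :=
  a_up h hx (fun l => s0 b l x y) i

omit h hx hy in
lemma s0_y : ∑ l, s0 b l x y * y l = 0 := by
  have h1 : ∑ l, (∑ m, pd m (fun x => b x l) x * y m) * y l = ∑ l, B1 b l x y * y l := by
    unfold B1
    simp only [Finset.sum_mul]
    rw [Finset.sum_comm]
    exact Finset.sum_congr rfl fun j _ => Finset.sum_congr rfl fun k _ => by ring
  have h2 : ∑ l, s0 b l x y * y l = (1/2) * (∑ l, (∑ m, pd m (fun x => b x l) x * y m) * y l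
      - ∑ l, B1 b l x y * y l) := by
    rw [← Finset.sum_sub_distrib, Finset.mul_sum]
    exact Finset.sum_congr rfl fun j _ => by unfold s0; ring
  rw [h2, h1]; ring

omit h hx hy in
lemma Cc_y : ∑ l, Cc a l x y * y l = ∑ m, A2 a m x y * y m := by
  have h1 : ∑ l, (∑ m, A1 a m l x y * y m) * y l = ∑ l, A2 a l x y * y l := by
    unfold A2
    simp only [Finset.sum_mul]
    rw [Finset.sum_comm]
    exact Finset.sum_congr rfl fun j _ => Finset.sum_congr rfl fun k _ => by ring
  have h2 : ∑ l, Cc a l x y * y l = 2 * ∑ l, (∑ m, A1 a m l x y * y m) * y l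
      - ∑ l, A2 a l x y * y l := by
    rw [Finset.mul_sum, ← Finset.sum_sub_distrib]
    exact Finset.sum_congr rfl fun j _ => by unfold Cc; ring
  rw [h2, h1]; ring

omit hy in
lemma yl_Ga : ∑ j, yl a j x y * Ga a j x y = (1/4) * ∑ m, A2 a m x y * y m := by
  rw [← Cc_y, ← (Finset.sum_congr rfl fun j _ => mul_comm (y j) (Cc a j x y) :
    ∑ j, y j * Cc a j x y = ∑ j, Cc a j x y * y j), ← pair_up h hx y (fun l => Cc a l x y), Finset.mul_sum]
  exact Finset.sum_congr rfl fun j _ => by unfold Ga yl; ring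

omit hy in
lemma yl_sU : ∑ j, yl a j x y * sU a b j x y = 0 := by
  rw [← s0_y (b := b) (x := x) (y := y), ← (Finset.sum_congr rfl fun j _ => mul_comm (y j) (s0 b j x y) :
    ∑ j, y j * s0 b j x y = ∑ j, s0 b j x y * y j), ← pair_up h hx y (fun l => s0 b l x y)]
  rfl

omit h hx hy in
lemma sum_Gc (w : Vec n) : ∑ j, w j * (Gh a b j x y + y j * (rho a b x y * (2 * RF a b x y)⁻¹))
    = ∑ j, w j * Ga a j x y + ralpha a x y * ∑ j, w j * sU a b j x y
      + (∑ j, w j * y j) * (rho a b x y * (2 * RF a b x y)⁻¹) := by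
  simp only [Finset.mul_sum, Finset.sum_mul, ← Finset.sum_add_distrib]
  exact Finset.sum_congr rfl fun j _ => by unfold Gh; ring

omit h hx hy in
lemma F0_aux : ∑ m, y m * ((1/2) * A2 a m x y * (ralpha a x y)⁻¹ + B1 b m x y)
    = (1/2) * (ralpha a x y)⁻¹ * (∑ m, A2 a m x y * y m) + ∑ m, B1 b m x y * y m := by
  simp only [Finset.mul_sum, ← Finset.sum_add_distrib]
  exact Finset.sum_congr rfl fun j _ => by ring

omit h hx hy in
lemma E_aux (l : Fin n) : ∑ m, y m * (A1 a m l x y * (ralpha a x y)⁻¹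
      - (1/2) * yl a l x y * A2 a m x y * (ralpha a x y)⁻¹ ^ 3 + pd m (fun x => b x l) x)
    = (ralpha a x y)⁻¹ * ∑ m, A1 a m l x y * y m
      - (1/2) * yl a l x y * (ralpha a x y)⁻¹ ^ 3 * ∑ m, A2 a m x y * y m
      + ∑ m, pd m (fun x => b x l) x * y m := by
  simp only [Finset.mul_sum, ← Finset.sum_add_distrib, ← Finset.sum_sub_distrib]
  exact Finset.sum_congr rfl fun j _ => by ring

/-- the geodesic coefficients of a Randers metric -/
lemma Geo_eq (i : Fin n) : Geo (RF a b) i x y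
    = Gh a b i x y + y i * (rho a b x y * (2 * RF a b x y)⁻¹) := by
  rw [← ginv_g h hx hy (fun i => Gh a b i x y + y i * (rho a b x y * (2 * RF a b x y)⁻¹)) i]
  unfold Geo
  rw [Finset.mul_sum]
  refine Finset.sum_congr rfl fun l _ => ?_
  have h1 : ∀ m, dx m (fun x' y' => dy l (F2 (RF a b)) x' y') x y * y m
      = 2 * dy l (RF a b) x y * (y m * dx m (RF a b) x y)
        + 2 * RF a b x y * (y m * dx m (dy l (RF a b)) x y) := by
    intro m
    have : dx m (fun x' y' => dy l (F2 (RF a b)) x' y') x y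
      = dx m (fun x y => (2 * RF a b x y) * dy l (RF a b) x y) x y :=
      dx_congr h.op (fun x hx y hy => dyF2 h (x := x) (y := y) hx hy l) m hx hy
    rw [this, dx_mul h.op hx hy ((Sm.const 2).mul h.F_sm) (h.F_sm.dy h.op l),
      dx_mul h.op hx hy (Sm.const 2) h.F_sm, show dx m (fun _ _ => (2:ℝ)) x y = 0 from pd_const m _ x]
    ring
  simp only [h1, Finset.sum_add_distrib, ← Finset.mul_sum]
  rw [dxF2 h hx hy, gmat_split h hx hy (fun i => Gh a b i x y + y i * (rho a b x y * (2 * RF a b x y)⁻¹)) l]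
  simp only [dxF h hx hy, dxdyF h hx hy, dyF h hx hy]
  rw [sum_Gc, sum_Gc, sum_Gc, F0_aux, E_aux, a_Ga h hx, a_sU h hx, yl_Ga h hx, yl_sU h hx, ← h.asq hx hy]
  have e2 : ∑ j, a x l j * y j = yl a l x y := rfl
  have e3 : ∑ j, b x j * sU a b j x y = ss a b x y := rfl
  have e4 : ∑ j, b x j * y j = rbeta b x y := rfl
  have e5 : ∑ m, pd m (fun x => b x l) x * y m = 2 * s0 b l x y + B1 b l x y := by unfold s0; ring
  have e6 : ∑ m, A1 a m l x y * y m = (1/2) * (Cc a l x y + A2 a l x y) := by unfold Cc; ring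
  have e7 : ∑ m, B1 b m x y * y m = rho a b x y + 2 * ralpha a x y * ss a b x y
    + 2 * ∑ j, b x j * Ga a j x y := by unfold rho r00; ring
  rw [e2, e3, e4, e5, e6, e7]
  have hF : RF a b x y ≠ 0 := (h.Fpos x hx y hy).ne'
  have hal := (h.apos hx hy).ne'
  have hbe : rbeta b x y = RF a b x y - ralpha a x y := by unfold RF; ring
  rw [hbe]
  generalize RF a b x y = F at *
  generalize ralpha a x y = al at *

  field_simp
  ring

/-- `F_0 - 2 Ĝ^j F_j = ρ` -/
lemma F0_eq : ∑ m, y m * dx m (RF a b) x y - 2 * ∑ j, Gh a b j x y * dy j (RF a b) x y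
    = rho a b x y := by
  simp only [dxF h hx hy, dyF h hx hy]
  rw [F0_aux]
  have e1 : ∑ j, Gh a b j x y * (yl a j x y * (ralpha a x y)⁻¹ + b x j)
      = (ralpha a x y)⁻¹ * (∑ j, yl a j x y * Ga a j x y + ralpha a x y * ∑ j, yl a j x y * sU a b j x y)
        + (∑ j, b x j * Ga a j x y + ralpha a x y * ss a b x y) := by
    unfold ss
    simp only [Finset.mul_sum, ← Finset.sum_add_distrib]
    exact Finset.sum_congr rfl fun j _ => by unfold Gh; ring
  rw [e1, yl_Ga h hx, yl_sU h hx]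
  unfold rho r00
  ring

end geo
end

noncomputable section

lemma det_smooth {n : ℕ} {U : Set (Vec n)} {M : Vec n → Matrix (Fin n) (Fin n) ℝ}
    (hM : ∀ i j, ContDiffOn ℝ (⊤ : ℕ∞) (fun x => M x i j) U) :
    ContDiffOn ℝ (⊤ : ℕ∞) (fun x => (M x).det) U := by
  simp only [Matrix.det_apply]
  refine ContDiffOn.sum fun s _ => ?_
  have : ContDiffOn ℝ (⊤ : ℕ∞) (fun x => ∏ i, M x (s i) i) U :=
    contDiffOn_prod fun i _ => hM (s i) i
  simp only [Units.smul_def, zsmul_eq_mul]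
  exact contDiffOn_const.mul this

lemma RD.sinv {n : ℕ} {U : Set (Vec n)} {a : Vec n → Matrix (Fin n) (Fin n) ℝ} {b : Vec n → Vec n}
    (h : RD U a b) (i j : Fin n) : ContDiffOn ℝ (⊤ : ℕ∞) (fun x => (a x)⁻¹ i j) U := by
  have h1 : ∀ x ∈ U, (a x).det ≠ 0 := fun x hx => (h.pos x hx).det_pos.ne'
  have h2 : ContDiffOn ℝ (⊤ : ℕ∞) (fun x => ((a x).det)⁻¹ * (a x).adjugate i j) U := by
    refine ((det_smooth h.sa).inv h1).mul ?_
    simp only [Matrix.adjugate_apply]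
    refine det_smooth fun k l => ?_
    simp only [Matrix.updateRow_apply]
    split_ifs
    · exact contDiffOn_const
    · exact h.sa k l
  refine h2.congr fun x hx => ?_
  rw [Matrix.inv_def, Ring.inverse_eq_inv']; rfl

section mem
variable {n : ℕ} {U : Set (Vec n)} {a : Vec n → Matrix (Fin n) (Fin n) ℝ} {b : Vec n → Vec n}
  (h : RD U a b)
include h

lemma RD.sbs (i : Fin n) : ContDiffOn ℝ (⊤ : ℕ∞) (bs a b i) U :=
  ContDiffOn.sum (f := fun j x => (a x)⁻¹ i j * b x j) fun j _ => (h.sinv i j).mul (h.sb j)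
lemma RD.sbb : ContDiffOn ℝ (⊤ : ℕ∞) (bb a b) U :=
  ContDiffOn.sum (f := fun j x => b x j * bs a b j x) fun j _ => (h.sb j).mul (h.sbs j)

lemma B1_PO (l : Fin n) : PO U a b 0 1 (B1 b l) :=
  PO.sum (f := fun k x y => pd l (fun x => b x k) x * y k)
    fun k _ => (PO.coord k).cf _ (pd_smooth h.op (h.sb k) l)

lemma s0_PO (l : Fin n) : PO U a b 0 1 (s0 b l) :=
  ((PO.sum (f := fun m x y => pd m (fun x => b x l) x * y m)
    fun m (_ : m ∈ Finset.univ) => (PO.coord m).cf _ (pd_smooth h.op (h.sb l) m)).sub (B1_PO h l)).cmul (1/2)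

lemma Cc_PO (l : Fin n) : PO U a b 0 2 (Cc a l) :=
  ((PO.sum (f := fun m x y => A1 a m l x y * y m)
    fun m (_ : m ∈ Finset.univ) => (PO.A1 h m l).mul (PO.coord m)).cmul 2).sub (PO.A2 h l)

lemma Ga_PO (i : Fin n) : PO U a b 0 2 (Ga a i) :=
  (PO.sum (f := fun l x y => (a x)⁻¹ i l * Cc a l x y)
    fun l (_ : l ∈ Finset.univ) => (Cc_PO h l).cf _ (h.sinv i l)).cmul (1/4)

lemma sU_PO (i : Fin n) : PO U a b 0 1 (sU a b i) :=
  PO.sum (f := fun l x y => (a x)⁻¹ i l * s0 b l x y)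
    fun l (_ : l ∈ Finset.univ) => (s0_PO h l).cf _ (h.sinv i l)

lemma ss_PO : PO U a b 0 1 (ss a b) :=
  PO.sum (f := fun j x y => b x j * sU a b j x y)
    fun j (_ : j ∈ Finset.univ) => (sU_PO h j).cf _ (h.sb j)

lemma r00_PO : PO U a b 0 2 (r00 a b) :=
  (PO.sum (f := fun m x y => B1 b m x y * y m)
    fun m (_ : m ∈ Finset.univ) => (B1_PO h m).mul (PO.coord m)).sub
  ((PO.sum (f := fun j x y => b x j * Ga a j x y)
    fun j (_ : j ∈ Finset.univ) => (Ga_PO h j).cf _ (h.sb j)).cmul 2)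

lemma rho_PO : PO U a b 0 2 (rho a b) :=
  (r00_PO h).sub (((PO.al.cmul 2)).mul (ss_PO h))

lemma Gh_PO (i : Fin n) : PO U a b 0 2 (Gh a b i) :=
  (Ga_PO h i).add (PO.al.mul (sU_PO h i))

end mem

def PP {n : ℕ} (a : Vec n → Matrix (Fin n) (Fin n) ℝ) (b : Vec n → Vec n) (x y : Vec n) : ℝ :=
  rho a b x y * (2 * RF a b x y)⁻¹

section ric
variable {n : ℕ} {U : Set (Vec n)} {a : Vec n → Matrix (Fin n) (Fin n) ℝ} {b : Vec n → Vec n}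
  (h : RD U a b)
include h

lemma PP_PO : PO U a b 1 1 (PP a b) :=
  ((((rho_PO h).mul PO.Fi).cmul (1/2)).cast (by omega) (by omega)).congr (by
    intro x hx y hy; unfold PP; rw [mul_inv]; ring)

lemma PP_eq : ∀ x ∈ U, ∀ y : Vec n, y ≠ 0 →
    PP a b x y = ((1/2) * rho a b x y) * (RF a b x y)⁻¹ := by
  intro x hx y hy; unfold PP; rw [mul_inv]; ring

variable {x y : Vec n} (hx : x ∈ U) (hy : y ≠ 0)
include hx hy

omit hx hy in
lemma halfrho_sm : Sm U (fun x y => (1/2) * rho a b x y) := ((rho_PO h).cmul (1/2)).sm h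

lemma dxPP (m : Fin n) : dx m (PP a b) x y =
    (1/2) * dx m (rho a b) x y * (RF a b x y)⁻¹
      - (1/2) * rho a b x y * dx m (RF a b) x y * (RF a b x y)⁻¹ ^ 2 := by
  rw [dx_congr h.op (PP_eq h) m hx hy, dx_mul h.op hx hy (halfrho_sm h) (PO.Fi.sm h),
    dx_mul h.op hx hy (Sm.const (1/2)) ((rho_PO h).sm h),
    dx_inv h.op hx hy h.F_sm (h.Fpos x hx y hy).ne', show dx m (fun _ _ => (1/2:ℝ)) x y = 0 from pd_const m _ x]
  ring

lemma dyPP (m : Fin n) : dy m (PP a b) x y =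
    (1/2) * dy m (rho a b) x y * (RF a b x y)⁻¹
      - (1/2) * rho a b x y * dy m (RF a b) x y * (RF a b x y)⁻¹ ^ 2 := by
  rw [dy_congr (PP_eq h) m hx hy, dy_mul h.op hx hy (halfrho_sm h) (PO.Fi.sm h),
    dy_mul h.op hx hy (Sm.const (1/2)) ((rho_PO h).sm h),
    dy_inv h.op hx hy h.F_sm (h.Fpos x hx y hy).ne', show dy m (fun _ _ => (1/2:ℝ)) x y = 0 from pd_const m _ y]
  ring

omit hx hy in
lemma yP_sm (i : Fin n) : Sm U (fun x y => y i * PP a b x y) := (Sm.coord i).mul ((PP_PO h).sm h)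

lemma dxGeo (k i : Fin n) : dx k (Geo (RF a b) i) x y
    = dx k (Gh a b i) x y + y i * dx k (PP a b) x y := by
  rw [dx_congr h.op (fun x hx y hy => Geo_eq h (x := x) (y := y) hx hy i) k hx hy]
  have := dx_add h.op hx hy ((Gh_PO h i).sm h) (yP_sm h i) k
  refine this.trans ?_
  rw [dx_mul h.op hx hy (Sm.coord i) ((PP_PO h).sm h), dx_coord]; ring

lemma dyGeo (k i : Fin n) : dy k (Geo (RF a b) i) x y
    = dy k (Gh a b i) x y + ((if i = k then 1 else 0) * PP a b x y + y i * dy k (PP a b) x y) := by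
  rw [dy_congr (fun x hx y hy => Geo_eq h (x := x) (y := y) hx hy i) k hx hy]
  have := dy_add h.op hx hy ((Gh_PO h i).sm h) (yP_sm h i) k
  refine this.trans ?_
  rw [dy_mul h.op hx hy (Sm.coord i) ((PP_PO h).sm h), dy_coord]

lemma dydxGeo (k j i : Fin n) : dy k (fun x' y' => dx j (Geo (RF a b) i) x' y') x y
    = dy k (dx j (Gh a b i)) x y + ((if i = k then 1 else 0) * dx j (PP a b) x y
      + y i * dy k (dx j (PP a b)) x y) := by
  rw [dy_congr (fun x hx y hy => dxGeo h (x := x) (y := y) hx hy j i) k hx hy,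
    dy_add h.op hx hy (((Gh_PO h i).sm h).dx h.op j) ((Sm.coord i).mul (((PP_PO h).sm h).dx h.op j)),
    dy_mul h.op hx hy (Sm.coord i) (((PP_PO h).sm h).dx h.op j), dy_coord]

def Dh (a : Vec n → Matrix (Fin n) (Fin n) ℝ) (b : Vec n → Vec n) (x y : Vec n) : ℝ :=
  ∑ m, dy m (Gh a b m) x y

omit hx hy in
lemma Dh_PO : PO U a b 0 1 (Dh a b) :=
  PO.sum (f := fun m => dy m (Gh a b m)) fun m _ => (Gh_PO h m).dy0 h m

lemma divGeo : ∑ m, dy m (Geo (RF a b) m) x y = Dh a b x y + ((n:ℝ) + 1) * PP a b x y := by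
  simp only [dyGeo h hx hy, Finset.sum_add_distrib]
  rw [(PP_PO h).euler h hx hy]
  simp [Dh]; ring

lemma dydivGeo (j : Fin n) : ∑ m, dy j (fun x' y' => dy m (Geo (RF a b) m) x' y') x y
    = dy j (Dh a b) x y + ((n:ℝ) + 1) * dy j (PP a b) x y := by
  have hs : ∀ m ∈ Finset.univ, Sm U (dy m (Geo (RF a b) m)) := fun m _ =>
    (((((Gh_PO h m).sm h).add (yP_sm h m))).congr
      (fun x hx y hy => Geo_eq h (x := x) (y := y) hx hy m)).dy h.op m
  have h1 := dy_sum h.op hx hy hs j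
  have h2 := dy_congr (fun x hx y hy => divGeo h (x := x) (y := y) hx hy) j hx hy
  have h3 := h1.symm.trans h2
  refine h3.trans ?_
  rw [dy_add h.op hx hy ((Dh_PO h).sm h) ((Sm.const _).mul ((PP_PO h).sm h)),
    dy_mul h.op hx hy (Sm.const _) ((PP_PO h).sm h),
    show dy j (fun _ _ => ((n:ℝ)+1)) x y = 0 from pd_const j _ y]
  ring

def XX (a : Vec n → Matrix (Fin n) (Fin n) ℝ) (b : Vec n → Vec n) (x y : Vec n) : ℝ :=
  2 * (∑ m, dx m (Gh a b m) x y) - (∑ m, ∑ j, dy m (dx j (Gh a b m)) x y * y j)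
  + 2 * (∑ j, Gh a b j x y * dy j (Dh a b) x y)
  - ∑ m, ∑ j, dy j (Gh a b m) x y * dy m (Gh a b j) x y

omit hx hy in
lemma XX_PO : PO U a b 0 2 (XX a b) := by
  refine (((PO.cmul 2 (PO.sum (f := fun m => dx m (Gh a b m)) fun m (_ : m ∈ Finset.univ) => (Gh_PO h m).dx0 h m)).sub
    (PO.sum (f := fun m x y => ∑ j, dy m (dx j (Gh a b m)) x y * y j) fun m (_ : m ∈ Finset.univ) =>
      PO.sum (f := fun j x y => dy m (dx j (Gh a b m)) x y * y j) fun j (_ : j ∈ Finset.univ) =>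
      (((Gh_PO h m).dx0 h j).dy0 h m).mul (PO.coord j))).add
    (PO.cmul 2 (PO.sum (f := fun j x y => Gh a b j x y * dy j (Dh a b) x y) fun j (_ : j ∈ Finset.univ) =>
      (Gh_PO h j).mul ((Dh_PO h).dy0 h j)))).sub
    (PO.sum (f := fun m x y => ∑ j, dy j (Gh a b m) x y * dy m (Gh a b j) x y) fun m (_ : m ∈ Finset.univ) =>
      PO.sum (f := fun j x y => dy j (Gh a b m) x y * dy m (Gh a b j) x y) fun j (_ : j ∈ Finset.univ) =>
      ((Gh_PO h m).dy0 h j).mul ((Gh_PO h j).dy0 h m))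

lemma Ric_formula : RicciC (RF a b) x y = XX a b x y + ((n:ℝ) - 1) *
    (PP a b x y ^ 2 - (∑ m, y m * dx m (PP a b) x y) + 2 * ∑ j, Gh a b j x y * dy j (PP a b) x y) := by
  unfold RicciC Riem
  rw [Finset.sum_sub_distrib, Finset.sum_add_distrib, Finset.sum_sub_distrib]
  have t1 : ∑ m, 2 * dx m (Geo (RF a b) m) x y
      = 2 * (∑ m, dx m (Gh a b m) x y) + 2 * ∑ m, y m * dx m (PP a b) x y := by
    rw [← mul_add, ← Finset.sum_add_distrib, Finset.mul_sum]
    exact Finset.sum_congr rfl fun m _ => by rw [dxGeo h hx hy]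
  have t2 : ∑ m, ∑ j, dy m (fun x' y' => dx j (Geo (RF a b) m) x' y') x y * y j
      = (∑ m, ∑ j, dy m (dx j (Gh a b m)) x y * y j) + ((n:ℝ) + 1) * ∑ m, y m * dx m (PP a b) x y := by
    have : ∀ m, ∑ j, dy m (fun x' y' => dx j (Geo (RF a b) m) x' y') x y * y j
      = ∑ j, dy m (dx j (Gh a b m)) x y * y j + (∑ j, y j * dx j (PP a b) x y
        + ∑ j, (y m * dy m (dx j (PP a b)) x y) * y j) := by
      intro m
      rw [← Finset.sum_add_distrib, ← Finset.sum_add_distrib]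
      exact Finset.sum_congr rfl fun j _ => by rw [dydxGeo h hx hy]; simp; ring
    simp only [this, Finset.sum_add_distrib]
    have e : ∑ m, ∑ j, (y m * dy m (dx j (PP a b)) x y) * y j = ∑ j, y j * dx j (PP a b) x y := by
      rw [Finset.sum_comm]
      refine Finset.sum_congr rfl fun j _ => ?_
      rw [← Finset.sum_mul, ((PP_PO h).dx' h j).euler h hx hy]; push_cast; ring
    rw [e]
    simp; ring
  have t3 : ∑ m, 2 * ∑ j, Geo (RF a b) j x y * dy j (fun x' y' => dy m (Geo (RF a b) m) x' y') x y
      = 2 * (∑ j, Gh a b j x y * dy j (Dh a b) x y)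
        + 2 * ((n:ℝ) + 1) * (∑ j, Gh a b j x y * dy j (PP a b) x y)
        + 2 * PP a b x y * (Dh a b x y + ((n:ℝ)+1) * PP a b x y) := by
    rw [← Finset.mul_sum, Finset.sum_comm]
    have : ∀ j, ∑ m, Geo (RF a b) j x y * dy j (fun x' y' => dy m (Geo (RF a b) m) x' y') x y
      = Gh a b j x y * dy j (Dh a b) x y + ((n:ℝ)+1) * (Gh a b j x y * dy j (PP a b) x y)
        + (PP a b x y * (y j * dy j (Dh a b) x y)
          + PP a b x y * (((n:ℝ)+1) * (y j * dy j (PP a b) x y))) := by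
      intro j
      rw [← Finset.mul_sum, dydivGeo h hx hy, Geo_eq h hx hy]
      unfold PP; ring
    simp only [this, Finset.sum_add_distrib, ← Finset.mul_sum]
    rw [(Dh_PO h).euler h hx hy, (PP_PO h).euler h hx hy]
    push_cast; ring
  have t4 : ∑ m, ∑ j, dy j (Geo (RF a b) m) x y * dy m (Geo (RF a b) j) x y
      = (∑ m, ∑ j, dy j (Gh a b m) x y * dy m (Gh a b j) x y)
        + 2 * (2 * (∑ j, Gh a b j x y * dy j (PP a b) x y) + PP a b x y * Dh a b x y)
        + ((n:ℝ) + 3) * PP a b x y ^ 2 := by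
    have key : ∀ m j, dy j (Geo (RF a b) m) x y * dy m (Geo (RF a b) j) x y
        = dy j (Gh a b m) x y * dy m (Gh a b j) x y
          + (y j * dy j (Gh a b m) x y) * dy m (PP a b) x y
          + (y m * dy m (Gh a b j) x y) * dy j (PP a b) x y
          + (if m = j then 1 else 0) * (2 * PP a b x y * dy j (Gh a b j) x y
            + PP a b x y ^ 2 + 2 * PP a b x y * (y j * dy j (PP a b) x y))
          + (y m * dy m (PP a b) x y) * (y j * dy j (PP a b) x y) := by
      intro m j
      rw [dyGeo h hx hy, dyGeo h hx hy]
      by_cases hmj : m = j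
      · subst hmj; simp; ring
      · simp [hmj, Ne.symm hmj]; ring
    simp only [key, Finset.sum_add_distrib]
    have e1 : ∑ m, ∑ j, (y j * dy j (Gh a b m) x y) * dy m (PP a b) x y
        = 2 * ∑ j, Gh a b j x y * dy j (PP a b) x y := by
      rw [Finset.mul_sum]
      refine Finset.sum_congr rfl fun m _ => ?_
      rw [← Finset.sum_mul, (Gh_PO h m).euler h hx hy]; push_cast; ring
    have e2 : ∑ m, ∑ j, (y m * dy m (Gh a b j) x y) * dy j (PP a b) x y
        = 2 * ∑ j, Gh a b j x y * dy j (PP a b) x y := by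
      rw [Finset.sum_comm]; exact e1
    have e3 : ∑ m, ∑ j, (if m = j then 1 else 0) * (2 * PP a b x y * dy j (Gh a b j) x y
            + PP a b x y ^ 2 + 2 * PP a b x y * (y j * dy j (PP a b) x y))
        = 2 * PP a b x y * Dh a b x y + n * PP a b x y ^ 2 + 2 * PP a b x y ^ 2 := by
      have : ∀ m, ∑ j, (if m = j then 1 else 0) * (2 * PP a b x y * dy j (Gh a b j) x y
            + PP a b x y ^ 2 + 2 * PP a b x y * (y j * dy j (PP a b) x y))
          = (2 * PP a b x y * dy m (Gh a b m) x y
            + PP a b x y ^ 2 + 2 * PP a b x y * (y m * dy m (PP a b) x y)) := by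
        intro m; simp
      simp only [this, Finset.sum_add_distrib, ← Finset.mul_sum]
      rw [(PP_PO h).euler h hx hy]
      simp [Dh]; ring
    have e4 : ∑ m, ∑ j, (y m * dy m (PP a b) x y) * (y j * dy j (PP a b) x y) = PP a b x y ^ 2 := by
      simp only [← Finset.mul_sum, ← Finset.sum_mul]
      rw [(PP_PO h).euler h hx hy]; push_cast; ring
    rw [e1, e2, e3, e4]; ring
  rw [t1, t2, t3, t4]
  unfold XX
  ring

omit hx hy in
lemma Ric_lead : ∃ H, PO U a b 0 3 H ∧ ∀ x ∈ U, ∀ y : Vec n, y ≠ 0 →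
    RicciC (RF a b) x y = ((3/4) * ((n:ℝ) - 1) * rho a b x y ^ 2 + RF a b x y * H x y)
      * (RF a b x y)⁻¹ ^ 2 := by
  refine ⟨fun x y => RF a b x y * XX a b x y - (((n:ℝ) - 1) / 2) * ((∑ m, y m * dx m (rho a b) x y)
    - 2 * ∑ j, Gh a b j x y * dy j (rho a b) x y), ?_, ?_⟩
  · refine (((PO.F h).mul (XX_PO h)).cast (by omega) (by omega)).sub (PO.cmul _ (PO.sub ?_ (PO.cmul 2 ?_)))
    · exact PO.sum (f := fun m x y => y m * dx m (rho a b) x y)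
        fun m _ => (PO.coord m).mul ((rho_PO h).dx0 h m)
    · exact PO.sum (f := fun j x y => Gh a b j x y * dy j (rho a b) x y)
        fun j _ => ((Gh_PO h j).mul ((rho_PO h).dy0 h j)).cast (by omega) (by omega)
  · intro x hx y hy
    rw [Ric_formula h hx hy]
    have e1 : ∑ m, y m * dx m (PP a b) x y = (1/2) * (RF a b x y)⁻¹ * (∑ m, y m * dx m (rho a b) x y)
        - (1/2) * rho a b x y * (RF a b x y)⁻¹ ^ 2 * ∑ m, y m * dx m (RF a b) x y := by
      rw [Finset.mul_sum, Finset.mul_sum, ← Finset.sum_sub_distrib]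
      exact Finset.sum_congr rfl fun m _ => by rw [dxPP h hx hy]; ring
    have e2 : ∑ j, Gh a b j x y * dy j (PP a b) x y
        = (1/2) * (RF a b x y)⁻¹ * (∑ j, Gh a b j x y * dy j (rho a b) x y)
        - (1/2) * rho a b x y * (RF a b x y)⁻¹ ^ 2 * ∑ j, Gh a b j x y * dy j (RF a b) x y := by
      rw [Finset.mul_sum, Finset.mul_sum, ← Finset.sum_sub_distrib]
      exact Finset.sum_congr rfl fun m _ => by rw [dyPP h hx hy]; ring
    have e3 : ∑ m, y m * dx m (RF a b) x y = rho a b x y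
      + 2 * ∑ j, Gh a b j x y * dy j (RF a b) x y := by rw [← F0_eq h hx hy]; ring
    rw [e1, e2, e3, PP_eq h x hx y hy]
    have hF : RF a b x y ≠ 0 := (h.Fpos x hx y hy).ne'
    field_simp
    ring

end ric
end

noncomputable section

section scal
variable {n : ℕ} {U : Set (Vec n)} {a : Vec n → Matrix (Fin n) (Fin n) ℝ} {b : Vec n → Vec n}
  (h : RD U a b) {E : Vec n → Vec n → ℝ} (hE : PO U a b 0 4 E)
  (hR : ∀ x ∈ U, ∀ y : Vec n, y ≠ 0 → RicciC (RF a b) x y = E x y * (RF a b x y)⁻¹ ^ 2)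
include h hE hR

lemma R_PO : PO U a b 2 2 (RicciC (RF a b)) :=
  ((hE.mul (PO.Fi.mul PO.Fi)).cast (by omega) (by omega)).congr fun x hx y hy => by
    rw [hR x hx y hy]; ring

variable {x y : Vec n} (hx : x ∈ U) (hy : y ≠ 0)
include hx hy

lemma dyR (j : Fin n) : dy j (RicciC (RF a b)) x y =
    dy j E x y * (RF a b x y)⁻¹ ^ 2 - 2 * (E x y * dy j (RF a b) x y) * (RF a b x y)⁻¹ ^ 3 := by
  have e : ∀ x ∈ U, ∀ y : Vec n, y ≠ 0 → RicciC (RF a b) x y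
      = E x y * ((RF a b x y)⁻¹ * (RF a b x y)⁻¹) := fun x hx y hy => by rw [hR x hx y hy]; ring
  rw [dy_congr e j hx hy, dy_mul h.op hx hy (hE.sm h) ((PO.Fi.mul PO.Fi).sm h),
    dy_mul h.op hx hy (PO.Fi.sm h) (PO.Fi.sm h),
    dy_inv h.op hx hy h.F_sm (h.Fpos x hx y hy).ne']
  ring

lemma dydyR (i j : Fin n) : dy i (dy j (RicciC (RF a b))) x y =
    dy i (dy j E) x y * (RF a b x y)⁻¹ ^ 2
    - 2 * (dy j E x y * dy i (RF a b) x y + dy i E x y * dy j (RF a b) x y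
      + E x y * dy i (dy j (RF a b)) x y) * (RF a b x y)⁻¹ ^ 3
    + 6 * (E x y * (dy i (RF a b) x y * dy j (RF a b) x y)) * (RF a b x y)⁻¹ ^ 4 := by
  have e : ∀ x ∈ U, ∀ y : Vec n, y ≠ 0 → dy j (RicciC (RF a b)) x y
      = (dy j E x y * (RF a b x y)⁻¹ - (2 * E x y * dy j (RF a b) x y) * ((RF a b x y)⁻¹ * (RF a b x y)⁻¹))
        * (RF a b x y)⁻¹ := fun x hx y hy => by rw [dyR h hE hR hx hy]; ring
  have s1 := (hE.sm h).dy h.op j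
  have s2 : Sm U (fun x y => 2 * E x y) := (Sm.const 2).mul (hE.sm h)
  have s3 := h.F_sm.dy h.op j
  have si : Sm U (fun x y => (RF a b x y)⁻¹) := PO.Fi.sm h
  rw [dy_congr e i hx hy, dy_mul h.op hx hy ((s1.mul si).sub ((s2.mul s3).mul (si.mul si))) si,
    show dy i (fun x y => dy j E x y * (RF a b x y)⁻¹ - (2 * E x y * dy j (RF a b) x y) * ((RF a b x y)⁻¹ * (RF a b x y)⁻¹)) x y = dy i (fun x y => dy j E x y * (RF a b x y)⁻¹ + (-1) * ((2 * E x y * dy j (RF a b) x y) * ((RF a b x y)⁻¹ * (RF a b x y)⁻¹))) x y from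
      dy_congr (U := U) (fun x hx y hy => by ring) i hx hy,
    dy_add h.op hx hy (s1.mul si) ((Sm.const (-1)).mul ((s2.mul s3).mul (si.mul si))),
    dy_mul h.op hx hy (Sm.const (-1)) ((s2.mul s3).mul (si.mul si)),
    dy_mul h.op hx hy (s2.mul s3) (si.mul si), dy_mul h.op hx hy si si,
    dy_mul h.op hx hy s2 s3, dy_mul h.op hx hy s1 si, dy_mul h.op hx hy (Sm.const 2) (hE.sm h),
    dy_inv h.op hx hy h.F_sm (h.Fpos x hx y hy).ne', 
    show dy i (fun _ _ => (2:ℝ)) x y = 0 from pd_const i _ y,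
    show dy i (fun _ _ => (-1:ℝ)) x y = 0 from pd_const i _ y]
  ring

lemma eulR : ∑ i, y i * dy i (RicciC (RF a b)) x y = 2 * RicciC (RF a b) x y := by
  rw [(R_PO h hE hR).euler h hx hy]; norm_num

lemma yM (j : Fin n) : ∑ i, y i * dy i (dy j (RicciC (RF a b))) x y = dy j (RicciC (RF a b)) x y := by
  rw [((R_PO h hE hR).dy' h j).euler h hx hy]; norm_num

lemma My (i : Fin n) : ∑ j, y j * dy i (dy j (RicciC (RF a b))) x y = dy i (RicciC (RF a b)) x y := by
  have sR := (R_PO h hE hR).sm h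
  have e := dy_congr (fun x hx y hy => eulR h hE hR (x := x) (y := y) hx hy) i hx hy
  have e1 := dy_sum h.op hx hy (f := fun j x y => y j * dy j (RicciC (RF a b)) x y)
    (s := Finset.univ) (fun j _ => (Sm.coord j).mul (sR.dy h.op j)) i
  have e2 : dy i (fun x y => 2 * RicciC (RF a b) x y) x y = 2 * dy i (RicciC (RF a b)) x y := by
    rw [dy_mul h.op hx hy (Sm.const 2) sR, show dy i (fun _ _ => (2:ℝ)) x y = 0 from pd_const i _ y]; ring
  have e3 : ∀ j, dy i (fun x y => y j * dy j (RicciC (RF a b)) x y) x y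
      = (if j = i then 1 else 0) * dy j (RicciC (RF a b)) x y + y j * dy i (dy j (RicciC (RF a b))) x y := by
    intro j
    rw [dy_mul h.op hx hy (Sm.coord j) (sR.dy h.op j), dy_coord]
  rw [e2] at e
  have e4 := e1.symm.trans e
  simp only [e3, Finset.sum_add_distrib] at e4
  simp at e4
  linarith

lemma scal_contr : scalarCurv (RF a b) x y =
    (1/2) * (ralpha a x y * (RF a b x y)⁻¹ * (∑ i, ∑ j, (a x)⁻¹ i j * dy i (dy j (RicciC (RF a b))) x y)
    - 2 * ralpha a x y * (RF a b x y)⁻¹ ^ 2 * (∑ i, bs a b i x * dy i (RicciC (RF a b)) x y)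
    + 2 * (bb a b x * ralpha a x y + rbeta b x y) * (RF a b x y)⁻¹ ^ 3 * RicciC (RF a b) x y) := by
  obtain ⟨M, hM⟩ : ∃ M : Fin n → Fin n → ℝ, ∀ i j, M i j = dy i (dy j (RicciC (RF a b))) x y :=
    ⟨_, fun _ _ => rfl⟩
  have k1 : ∑ i, ∑ j, bs a b i x * (y j * M i j) = ∑ i, bs a b i x * dy i (RicciC (RF a b)) x y := by
    simp only [← Finset.mul_sum, hM, My h hE hR hx hy]
  have k2 : ∑ i, ∑ j, bs a b j x * (y i * M i j) = ∑ i, bs a b i x * dy i (RicciC (RF a b)) x y := by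
    rw [Finset.sum_comm]
    simp only [← Finset.mul_sum, hM, yM h hE hR hx hy]
  have k3 : ∑ i, ∑ j, y i * (y j * M i j) = 2 * RicciC (RF a b) x y := by
    simp only [← Finset.mul_sum, hM, My h hE hR hx hy, eulR h hE hR hx hy]
  have : ∀ i j, ginv (RF a b) x y i j * RicciTensor (RF a b) i j x y =
      (1/2) * ralpha a x y * (RF a b x y)⁻¹ * ((a x)⁻¹ i j * M i j)
      - (1/2) * ralpha a x y * (RF a b x y)⁻¹ ^ 2 * (bs a b i x * (y j * M i j) + bs a b j x * (y i * M i j))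
      + (1/2) * (bb a b x * ralpha a x y + rbeta b x y) * (RF a b x y)⁻¹ ^ 3 * (y i * (y j * M i j)) := by
    intro i j
    rw [ginv_eq h hx hy, hM]
    unfold Hinv RicciTensor
    ring
  unfold scalarCurv
  simp only [← Finset.mul_sum] at k1 k2 k3
  simp only [← hM]
  simp only [this, Finset.sum_add_distrib, Finset.sum_sub_distrib, ← Finset.mul_sum, k1, k2, k3]
  ring

lemma inv_FF : ∑ i, ∑ j, (a x)⁻¹ i j * (dy i (RF a b) x y * dy j (RF a b) x y)
    = 1 + 2 * rbeta b x y * (ralpha a x y)⁻¹ + bb a b x := by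
  have hα := (h.apos hx hy).ne'
  have k1 : ∑ i, ∑ j, (yl a i x y * (a x)⁻¹ i j) * yl a j x y = ralpha a x y * ralpha a x y := by
    rw [Finset.sum_comm, h.asq hx hy]
    simp only [← Finset.sum_mul, yl_inv h hx]
    exact Finset.sum_congr rfl fun j _ => by ring
  have k2 : ∑ i, ∑ j, (yl a i x y * (a x)⁻¹ i j) * b x j = rbeta b x y := by
    rw [Finset.sum_comm]
    simp only [← Finset.sum_mul, yl_inv h hx]
    exact Finset.sum_congr rfl fun j _ => by ring
  have k3 : ∑ i, ∑ j, (b x i * (a x)⁻¹ i j) * yl a j x y = rbeta b x y := by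
    rw [Finset.sum_comm, ← yl_bs h hx]
    simp only [← Finset.sum_mul, b_inv h hx]
    exact Finset.sum_congr rfl fun j _ => by ring
  have k4 : ∑ i, ∑ j, (b x i * (a x)⁻¹ i j) * b x j = bb a b x := by
    rw [Finset.sum_comm]
    simp only [← Finset.sum_mul, b_inv h hx]
    exact Finset.sum_congr rfl fun j _ => by ring
  have : ∀ i j, (a x)⁻¹ i j * (dy i (RF a b) x y * dy j (RF a b) x y) =
      (ralpha a x y)⁻¹ ^ 2 * ((yl a i x y * (a x)⁻¹ i j) * yl a j x y)
      + (ralpha a x y)⁻¹ * ((yl a i x y * (a x)⁻¹ i j) * b x j)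
      + (ralpha a x y)⁻¹ * ((b x i * (a x)⁻¹ i j) * yl a j x y)
      + (b x i * (a x)⁻¹ i j) * b x j := by
    intro i j; rw [dyF h hx hy, dyF h hx hy]; ring
  simp only [this, Finset.sum_add_distrib, ← Finset.mul_sum, k1, k2, k3, k4]
  field_simp
  ring

lemma bs_F : ∑ i, bs a b i x * dy i (RF a b) x y = rbeta b x y * (ralpha a x y)⁻¹ + bb a b x := by
  have : ∀ i, bs a b i x * dy i (RF a b) x y = (ralpha a x y)⁻¹ * (yl a i x y * bs a b i x)
    + b x i * bs a b i x := by intro i; rw [dyF h hx hy]; ring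
  simp only [this, Finset.sum_add_distrib, ← Finset.mul_sum, yl_bs h hx]
  unfold bb; ring
end scal

section scal2
variable {n : ℕ} {U : Set (Vec n)} {a : Vec n → Matrix (Fin n) (Fin n) ℝ} {b : Vec n → Vec n}
  (h : RD U a b)
include h

lemma scal_lead : ∃ K, PO U a b 0 4 K ∧ ∀ x ∈ U, ∀ y : Vec n, y ≠ 0 →
    scalarCurv (RF a b) x y * RF a b x y ^ 5 =
      (9/2) * ((n:ℝ) - 1) * (bb a b x * ralpha a x y + rbeta b x y) * rho a b x y ^ 2
        + RF a b x y * K x y := by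
  obtain ⟨H, hH, hR⟩ := Ric_lead h
  set E : Vec n → Vec n → ℝ := fun x y =>
    (3/4) * ((n:ℝ) - 1) * rho a b x y ^ 2 + RF a b x y * H x y with hEdef
  have hE : PO U a b 0 4 E := by
    refine PO.add ?_ (((PO.F h).mul hH).cast (by omega) (by omega))
    exact ((((rho_PO h).mul (rho_PO h)).cmul ((3/4) * ((n:ℝ) - 1))).cast (by omega) (by omega)).congr
      fun x _ y _ => by ring
  have hc : PO U a b 0 1 (fun x y => bb a b x * ralpha a x y + rbeta b x y) :=
    (PO.al.cf _ h.sbb).add (PO.be h)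
  refine ⟨fun x y => 6 * ((bb a b x * ralpha a x y + rbeta b x y) * H x y) + 3 * E x y
    + (1/2) * (ralpha a x y * (RF a b x y * (∑ i, ∑ j, (a x)⁻¹ i j * dy i (dy j E) x y)
      - 2 * (∑ i, ∑ j, (a x)⁻¹ i j * (dy j E x y * dy i (RF a b) x y + dy i E x y * dy j (RF a b) x y
        + E x y * dy i (dy j (RF a b)) x y))))
    - ralpha a x y * ∑ i, bs a b i x * dy i E x y, ?_, ?_⟩
  · refine (((((hc.mul hH).cmul 6).cast (by omega) (by omega)).add (hE.cmul 3)).add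
      (PO.cmul (1/2) ((PO.al.mul (PO.sub ((PO.F h).mul (?_ : PO U a b 0 2 _)) (PO.cmul 2 (?_ : PO U a b 0 3 _)))).cast
        (by omega) (by omega)))).sub ((PO.al.mul (?_ : PO U a b 0 3 _)).cast (by omega) (by omega))
    · exact PO.sum (f := fun i x y => ∑ j, (a x)⁻¹ i j * dy i (dy j E) x y) fun i _ =>
        PO.sum (f := fun j x y => (a x)⁻¹ i j * dy i (dy j E) x y) fun j _ =>
        (((hE.dy0 h j).dy0 h i).cf _ (h.sinv i j)).cast (by omega) (by omega)
    · refine PO.sum (f := fun i x y => ∑ j, (a x)⁻¹ i j * (dy j E x y * dy i (RF a b) x y + dy i E x y * dy j (RF a b) x y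
        + E x y * dy i (dy j (RF a b)) x y)) fun i _ =>
        PO.sum (f := fun j x y => (a x)⁻¹ i j * (dy j E x y * dy i (RF a b) x y + dy i E x y * dy j (RF a b) x y
        + E x y * dy i (dy j (RF a b)) x y)) fun j _ => PO.cf _ (h.sinv i j) ?_
      exact ((((hE.dy0 h j).mul ((PO.F h).dy0 h i)).cast (by omega) (by omega)).add
        (((hE.dy0 h i).mul ((PO.F h).dy0 h j)).cast (by omega) (by omega))).add
        ((hE.mul (((PO.F h).dy0 h j).dy0 h i)).cast (by omega) (by omega))
    · exact PO.sum (f := fun i x y => bs a b i x * dy i E x y) fun i _ => ((hE.dy0 h i).cf _ (h.sbs i)).cast (by omega) (by omega)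
  · intro x hx y hy
    beta_reduce
    have hα := (h.apos hx hy).ne'
    have hF : RF a b x y ≠ 0 := (h.Fpos x hx y hy).ne'
    have t1 : ∑ i, ∑ j, (a x)⁻¹ i j * dy i (dy j (RicciC (RF a b))) x y =
      (RF a b x y)⁻¹ ^ 2 * (∑ i, ∑ j, (a x)⁻¹ i j * dy i (dy j E) x y)
      - 2 * (RF a b x y)⁻¹ ^ 3 * (∑ i, ∑ j, (a x)⁻¹ i j * (dy j E x y * dy i (RF a b) x y + dy i E x y * dy j (RF a b) x y
        + E x y * dy i (dy j (RF a b)) x y))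
      + 6 * E x y * (RF a b x y)⁻¹ ^ 4 *
        ∑ i, ∑ j, (a x)⁻¹ i j * (dy i (RF a b) x y * dy j (RF a b) x y) := by
      simp only [Finset.mul_sum, ← Finset.sum_add_distrib, ← Finset.sum_sub_distrib]
      refine Finset.sum_congr rfl fun i _ => Finset.sum_congr rfl fun j _ => ?_
      rw [dydyR h hE hR hx hy]; ring
    have t2 : ∑ i, bs a b i x * dy i (RicciC (RF a b)) x y =
      (RF a b x y)⁻¹ ^ 2 * (∑ i, bs a b i x * dy i E x y)
      - 2 * E x y * (RF a b x y)⁻¹ ^ 3 * ∑ i, bs a b i x * dy i (RF a b) x y := by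
      simp only [Finset.mul_sum, ← Finset.sum_sub_distrib]
      refine Finset.sum_congr rfl fun i _ => ?_
      rw [dyR h hE hR hx hy]; ring
    rw [scal_contr h hE hR hx hy, t1, t2, inv_FF h hE hR hx hy, bs_F h hE hR hx hy, hR x hx y hy]
    generalize (∑ i, ∑ j, (a x)⁻¹ i j * dy i (dy j E) x y) = S1
    generalize (∑ i, ∑ j, (a x)⁻¹ i j * (dy j E x y * dy i (RF a b) x y + dy i E x y * dy j (RF a b) x y
        + E x y * dy i (dy j (RF a b)) x y)) = S2
    generalize (∑ i, bs a b i x * dy i E x y) = S3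
    have hFe : rbeta b x y = RF a b x y - ralpha a x y := by unfold RF; ring
    have hEe : (3/4) * ((n:ℝ) - 1) * rho a b x y ^ 2 = E x y - RF a b x y * H x y := by
      simp only [hEdef]; ring
    have : (9/2) * ((n:ℝ) - 1) * (bb a b x * ralpha a x y + rbeta b x y) * rho a b x y ^ 2 =
      6 * (bb a b x * ralpha a x y + rbeta b x y) * (E x y - RF a b x y * H x y) := by rw [← hEe]; ring
    rw [this, hFe]
    change (1/2) * (ralpha a x y * (RF a b x y)⁻¹ * _ - _ * _ + _ * (E x y * _)) * _ = _
    generalize E x y = e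
    field_simp
    ring
end scal2
end

noncomputable section

section par
variable {n : ℕ} {a : Vec n → Matrix (Fin n) (Fin n) ℝ} {b : Vec n → Vec n} {x y : Vec n}
lemma al_neg : ralpha a x (-y) = ralpha a x y := by simp [ralpha]
lemma be_neg : rbeta b x (-y) = - rbeta b x y := by simp [rbeta]
lemma B1_neg (l : Fin n) : B1 b l x (-y) = - B1 b l x y := by simp [B1]
lemma s0_neg (l : Fin n) : s0 b l x (-y) = - s0 b l x y := by
  unfold s0; rw [B1_neg]; simp; ring
lemma A1_neg (m l : Fin n) : A1 a m l x (-y) = - A1 a m l x y := by simp [A1]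
lemma A2_neg (m : Fin n) : A2 a m x (-y) = A2 a m x y := by simp [A2, A1_neg]
lemma Cc_neg (l : Fin n) : Cc a l x (-y) = Cc a l x y := by simp [Cc, A1_neg, A2_neg]
lemma Ga_neg (l : Fin n) : Ga a l x (-y) = Ga a l x y := by simp [Ga, Cc_neg]
lemma sU_neg (l : Fin n) : sU a b l x (-y) = - sU a b l x y := by simp [sU, s0_neg]
lemma ss_neg : ss a b x (-y) = - ss a b x y := by simp [ss, sU_neg]
lemma r00_neg : r00 a b x (-y) = r00 a b x y := by simp [r00, B1_neg, Ga_neg]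
lemma dyGa_neg (l m : Fin n) : dy m (Ga a l) x (-y) = - dy m (Ga a l) x y := by
  unfold dy pd
  have : Ga a l x = fun y => Ga a l x (-y) := by funext y; rw [Ga_neg]
  conv_rhs => rw [this]
  have := (ContinuousLinearEquiv.neg ℝ (M := Vec n)).comp_right_fderiv (f := Ga a l x) (x := y)
  have e : (fun y => Ga a l x (-y)) = (Ga a l x) ∘ (ContinuousLinearEquiv.neg ℝ (M := Vec n)) := by
    funext y; simp
  rw [e, this]; simp
end par

section scurv
variable {n : ℕ} {U : Set (Vec n)} {a : Vec n → Matrix (Fin n) (Fin n) ℝ} {b : Vec n → Vec n}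
  (h : RD U a b) {x y : Vec n} (hx : x ∈ U) (hy : y ≠ 0)
include h hx hy

lemma dy_s0 (m l : Fin n) : dy m (s0 b l) x y
    = (1/2) * (pd m (fun x => b x l) x - pd l (fun x => b x m) x) := by
  have e : s0 b l = fun x y => ∑ k, ((1/2) * (pd k (fun x => b x l) x - pd l (fun x => b x k) x)) * y k := by
    funext x y
    unfold s0 B1
    rw [← Finset.sum_sub_distrib, Finset.mul_sum]
    exact Finset.sum_congr rfl fun k _ => by ring
  rw [e]
  have := dy_sum h.op hx hy (f := fun k x y => ((1/2) * (pd k (fun x => b x l) x - pd l (fun x => b x k) x)) * y k)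
    (s := Finset.univ) (fun k _ => (Sm.coef (contDiffOn_const.mul
      ((pd_smooth h.op (h.sb l) k).sub (pd_smooth h.op (h.sb k) l)))).mul (Sm.coord k)) m
  refine this.trans ?_
  have e2 : ∀ k, dy m (fun x y => ((1/2) * (pd k (fun x => b x l) x - pd l (fun x => b x k) x)) * y k) x y
    = ((1/2) * (pd k (fun x => b x l) x - pd l (fun x => b x k) x)) * (if k = m then 1 else 0) := by
    intro k
    rw [dy_mul h.op hx hy (Sm.coef (contDiffOn_const.mul
      ((pd_smooth h.op (h.sb l) k).sub (pd_smooth h.op (h.sb k) l)))) (Sm.coord k), dy_coord]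
    rw [show dy m (fun x _ => (1/2) * (pd k (fun x => b x l) x - pd l (fun x => b x k) x)) x y = 0 from
      pd_const m _ y]
    ring
  simp only [e2]; simp

lemma div_sU : ∑ m, dy m (sU a b m) x y = 0 := by
  have e : ∀ m, dy m (sU a b m) x y = ∑ l, (a x)⁻¹ m l * ((1/2) * (pd m (fun x => b x l) x - pd l (fun x => b x m) x)) := by
    intro m
    have := dy_sum h.op hx hy (f := fun l x y => (a x)⁻¹ m l * s0 b l x y)
      (s := Finset.univ) (fun k _ => (Sm.coef (h.sinv m k)).mul ((s0_PO h k).sm h)) m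
    refine this.trans (Finset.sum_congr rfl fun l _ => ?_)
    rw [dy_mul h.op hx hy (Sm.coef (h.sinv m l)) ((s0_PO h l).sm h), dy_s0 h hx hy,
      show dy m (fun x _ => (a x)⁻¹ m l) x y = 0 from pd_const m _ y]
    ring
  simp only [e]
  set S := ∑ m, ∑ l, (a x)⁻¹ m l * ((1/2) * (pd m (fun x => b x l) x - pd l (fun x => b x m) x)) with hS
  have : S = - S := by
    conv_lhs => rw [hS, Finset.sum_comm]
    rw [hS, ← Finset.sum_neg_distrib]
    refine Finset.sum_congr rfl fun l _ => ?_
    rw [← Finset.sum_neg_distrib]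
    refine Finset.sum_congr rfl fun m _ => ?_
    rw [inv_symm h hx m l]; ring
  linarith

lemma Dh_eq : Dh a b x y = ∑ m, dy m (Ga a m) x y := by
  unfold Dh
  have e : ∀ m, dy m (Gh a b m) x y = dy m (Ga a m) x y
      + ((ralpha a x y)⁻¹ * (yl a m x y * sU a b m x y) + ralpha a x y * dy m (sU a b m) x y) := by
    intro m
    have := dy_add h.op hx hy ((Ga_PO h m).sm h) (h.al_sm.mul ((sU_PO h m).sm h)) m
    refine this.trans ?_
    rw [dy_mul h.op hx hy h.al_sm ((sU_PO h m).sm h), h.dy_al hx hy]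
    ring
  simp only [e, Finset.sum_add_distrib, ← Finset.mul_sum, div_sU h hx hy, yl_sU h hx]
  ring

lemma iso_r00 (lam : ℝ) (hS : ∀ y : Vec n, y ≠ 0 →
      SCurv (RF a b) x y = ((n : ℝ) + 1) * lam * RF a b x y) :
    r00 a b x y + 2 * rbeta b x y * ss a b x y
      = 2 * lam * (ralpha a x y ^ 2 - rbeta b x y ^ 2) := by
  have key : ∀ y : Vec n, y ≠ 0 → 2 * RF a b x y * ((∑ m, dy m (Ga a m) x y)
      - ∑ m, y m * pd m (fun x' => Real.log (sigmaBH (RF a b) x')) x) + (n+1) * rho a b x y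
      = 2 * (n+1) * lam * RF a b x y ^ 2 := by
    intro y hy
    have h1 := hS y hy
    unfold SCurv at h1
    rw [divGeo h hx hy, Dh_eq h hx hy, PP_eq h x hx y hy] at h1
    have hF : RF a b x y ≠ 0 := (h.Fpos x hx y hy).ne'
    field_simp at h1
    linarith
  have h1 := key y hy
  have h2 := key (-y) (neg_ne_zero.2 hy)
  have hα := h.apos hx hy
  unfold RF rho at h1 h2
  simp only [dyGa_neg, al_neg, be_neg, r00_neg, ss_neg, Pi.neg_apply, neg_mul,
    Finset.sum_neg_distrib] at h2
  change _ * (-_ - -∑ m, y m * pd m (fun x' => Real.log (sigmaBH (RF a b) x')) x) + _ = _ at h2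
  change _ * (_ - ∑ m, y m * pd m (fun x' => Real.log (sigmaBH (RF a b) x')) x) + _ = _ at h1
  have hn : (0:ℝ) < n + 1 := by positivity
  set N : ℝ := n + 1
  set L1 := ∑ m, dy m (Ga a m) x y
  set L2 := ∑ m, y m * pd m (fun x' => Real.log (sigmaBH (RF a b) x')) x
  set α := ralpha a x y
  set β := rbeta b x y
  have e1 : L1 - L2 = N * (ss a b x y + 2 * lam * β) := by
    have : α * (L1 - L2 - N * (ss a b x y + 2 * lam * β)) = 0 := by linear_combination (1/4) * h1 - (1/4) * h2
    rcases mul_eq_zero.1 this with h | h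
    · exact absurd h hα.ne'
    · linarith
  have : N * (r00 a b x y + 2 * β * ss a b x y - 2 * lam * (α ^ 2 - β ^ 2)) = 0 := by
    linear_combination (1/2) * h1 + (1/2) * h2 - 2 * β * e1
  rcases mul_eq_zero.1 this with h | h
  · exact absurd h hn.ne'
  · linarith

lemma iso_rho (lam : ℝ) (hS : ∀ y : Vec n, y ≠ 0 →
      SCurv (RF a b) x y = ((n : ℝ) + 1) * lam * RF a b x y) :
    rho a b x y = RF a b x y * (2 * lam * (ralpha a x y - rbeta b x y) - 2 * ss a b x y) := by
  have := iso_r00 h hx hy lam hS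
  unfold rho RF
  linear_combination this
end scurv
end

noncomputable section

def ca {n : ℕ} (σ : Vec n → ℝ) (a : Vec n → Matrix (Fin n) (Fin n) ℝ) : Vec n → Matrix (Fin n) (Fin n) ℝ :=
  fun x => (Real.exp (σ x) ^ 2) • a x
def cb {n : ℕ} (σ : Vec n → ℝ) (b : Vec n → Vec n) : Vec n → Vec n := fun x => Real.exp (σ x) • b x

section conf
variable {n : ℕ} {U : Set (Vec n)} {a : Vec n → Matrix (Fin n) (Fin n) ℝ} {b : Vec n → Vec n}
  {σ : Vec n → ℝ} {x y : Vec n}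

lemma ca_al : ralpha (ca σ a) x y = Real.exp (σ x) * ralpha a x y := by
  unfold ralpha ca
  have : ∑ i, ∑ j, (Real.exp (σ x) ^ 2 • a x) i j * y i * y j
      = Real.exp (σ x) ^ 2 * ∑ i, ∑ j, a x i j * y i * y j := by
    simp only [Finset.mul_sum]
    exact Finset.sum_congr rfl fun i _ => Finset.sum_congr rfl fun j _ => by
      simp [Matrix.smul_apply]; ring
  rw [this, Real.sqrt_mul (by positivity), Real.sqrt_sq (Real.exp_pos _).le]

lemma cb_be : rbeta (cb σ b) x y = Real.exp (σ x) * rbeta b x y := by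
  unfold rbeta cb
  rw [Finset.mul_sum]
  exact Finset.sum_congr rfl fun i _ => by simp; ring

lemma cRF : RF (ca σ a) (cb σ b) x y = Real.exp (σ x) * RF a b x y := by
  unfold RF; rw [ca_al, cb_be]; ring

variable (h : RD U a b) (hσ : ContDiffOn ℝ (⊤ : ℕ∞) σ U)
include h hσ

lemma cRD : RD U (ca σ a) (cb σ b) where
  op := h.op
  sa i j := by
    have := (hσ.exp.pow 2).mul (h.sa i j)
    exact this.congr fun x hx => by simp [ca]
  sb i := by
    have := hσ.exp.mul (h.sb i)
    exact this.congr fun x hx => by simp [cb]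
  symm x hx i j := by simp [ca, h.symm x hx i j]
  pos x hx := (h.pos x hx).smul (by positivity)
  Fpos x hx y hy := by
    have := @cRF n a b σ x y
    unfold RF at this; rw [this]
    exact mul_pos (Real.exp_pos _) (h.Fpos x hx y hy)

variable (hx : x ∈ U)
include hx

lemma cinv (i j : Fin n) : (ca σ a x)⁻¹ i j = (Real.exp (σ x))⁻¹ ^ 2 * (a x)⁻¹ i j := by
  have e0 : (Real.exp (σ x))⁻¹ ^ 2 * Real.exp (σ x) ^ 2 = 1 := by
    have := (Real.exp_pos (σ x)).ne'
    field_simp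
  have : (ca σ a x)⁻¹ = (Real.exp (σ x))⁻¹ ^ 2 • (a x)⁻¹ := by
    apply Matrix.inv_eq_left_inv
    unfold ca
    rw [Matrix.smul_mul, Matrix.mul_smul, smul_smul, e0, one_smul, a_inv_mul h hx]
  rw [this]; simp

lemma pd_e (m : Fin n) : pd m (fun x => Real.exp (σ x)) x = Real.exp (σ x) * pd m σ x := by
  have hd : DifferentiableAt ℝ σ x :=
    (hσ.contDiffAt (h.op.mem_nhds hx)).differentiableAt (by simp)
  unfold pd
  rw [fderiv_exp hd]; simp

lemma df {f : Vec n → ℝ} (hf : ContDiffOn ℝ (⊤ : ℕ∞) f U) : DifferentiableAt ℝ f x :=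
  (hf.contDiffAt (h.op.mem_nhds hx)).differentiableAt (by simp)

lemma pd_ca (m i k : Fin n) : pd m (fun x => ca σ a x i k) x
    = Real.exp (σ x) ^ 2 * (pd m (fun x => a x i k) x + 2 * pd m σ x * a x i k) := by
  have e : (fun x => ca σ a x i k) = fun x => Real.exp (σ x) * (Real.exp (σ x) * a x i k) := by
    funext x; simp [ca]; ring
  have d1 := df h hσ hx hσ.exp
  have d2 := df h hσ hx (h.sa i k)
  rw [e, pd_mul m d1 (g := fun x => Real.exp (σ x) * a x i k) (d1.mul d2), pd_mul m d1 d2, pd_e h hσ hx]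
  ring

lemma pd_cb (m i : Fin n) : pd m (fun x => cb σ b x i) x
    = Real.exp (σ x) * (pd m (fun x => b x i) x + pd m σ x * b x i) := by
  have e : (fun x => cb σ b x i) = fun x => Real.exp (σ x) * b x i := by
    funext x; simp [cb]
  rw [e, pd_mul m (df h hσ hx hσ.exp) (df h hσ hx (h.sb i)), pd_e h hσ hx]
  ring

lemma cA1 (m i : Fin n) : A1 (ca σ a) m i x y
    = Real.exp (σ x) ^ 2 * (A1 a m i x y + 2 * pd m σ x * yl a i x y) := by
  unfold A1 yl
  simp only [Finset.mul_sum, ← Finset.sum_add_distrib]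
  exact Finset.sum_congr rfl fun k _ => by rw [pd_ca h hσ hx]; ring

lemma cB1 (m : Fin n) : B1 (cb σ b) m x y
    = Real.exp (σ x) * (B1 b m x y + pd m σ x * rbeta b x y) := by
  unfold B1 rbeta
  simp only [Finset.mul_sum, ← Finset.sum_add_distrib]
  exact Finset.sum_congr rfl fun k _ => by rw [pd_cb h hσ hx]; ring

lemma cs0 (l : Fin n) : s0 (cb σ b) l x y
    = Real.exp (σ x) * (s0 b l x y + (1/2) * ((∑ m, pd m σ x * y m) * b x l - pd l σ x * rbeta b x y)) := by
  unfold s0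
  rw [cB1 h hσ hx]
  have : ∑ m, pd m (fun x => cb σ b x l) x * y m
    = Real.exp (σ x) * (∑ m, pd m (fun x => b x l) x * y m + (∑ m, pd m σ x * y m) * b x l) := by
    simp only [Finset.mul_sum, Finset.sum_mul, ← Finset.sum_add_distrib]
    exact Finset.sum_congr rfl fun k _ => by rw [pd_cb h hσ hx]; ring
  rw [this]; ring

variable (hy : y ≠ 0)
include hy

lemma cA2 (m : Fin n) : A2 (ca σ a) m x y
    = Real.exp (σ x) ^ 2 * (A2 a m x y + 2 * pd m σ x * ralpha a x y ^ 2) := by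
  unfold A2
  rw [pow_two (ralpha a x y), h.asq hx hy]
  simp only [Finset.mul_sum, ← Finset.sum_add_distrib]
  exact Finset.sum_congr rfl fun k _ => by rw [cA1 h hσ hx]; ring

lemma cCc (l : Fin n) : Cc (ca σ a) l x y
    = Real.exp (σ x) ^ 2 * (Cc a l x y + 4 * (∑ m, pd m σ x * y m) * yl a l x y
      - 2 * pd l σ x * ralpha a x y ^ 2) := by
  unfold Cc
  rw [cA2 h hσ hx hy]
  have : ∑ m, A1 (ca σ a) m l x y * y m = Real.exp (σ x) ^ 2 * (∑ m, A1 a m l x y * y m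
    + 2 * (∑ m, pd m σ x * y m) * yl a l x y) := by
    simp only [Finset.mul_sum, Finset.sum_mul, ← Finset.sum_add_distrib]
    exact Finset.sum_congr rfl fun k _ => by rw [cA1 h hσ hx]; ring
  rw [this]; ring

lemma cGa (i : Fin n) : Ga (ca σ a) i x y = Ga a i x y + (∑ m, pd m σ x * y m) * y i
      - (1/2) * ralpha a x y ^ 2 * ∑ l, (a x)⁻¹ i l * pd l σ x := by
  have he := (Real.exp_pos (σ x)).ne'
  have e1 : ∑ l, (a x)⁻¹ i l * yl a l x y = y i := up_a h hx y i
  have e2 : ∀ l, (ca σ a x)⁻¹ i l * Cc (ca σ a) l x y = (a x)⁻¹ i l * Cc a l x y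
      + 4 * (∑ m, pd m σ x * y m) * ((a x)⁻¹ i l * yl a l x y)
      - 2 * ralpha a x y ^ 2 * ((a x)⁻¹ i l * pd l σ x) := by
    intro l
    rw [cinv h hσ hx, cCc h hσ hx hy]
    field_simp
  unfold Ga
  simp only [e2, Finset.sum_add_distrib, Finset.sum_sub_distrib, ← Finset.mul_sum, e1]
  ring

lemma csU (i : Fin n) : sU (ca σ a) (cb σ b) i x y = (Real.exp (σ x))⁻¹ * (sU a b i x y
    + (1/2) * ((∑ m, pd m σ x * y m) * bs a b i x - rbeta b x y * ∑ l, (a x)⁻¹ i l * pd l σ x)) := by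
  have he := (Real.exp_pos (σ x)).ne'
  have e2 : ∀ l, (ca σ a x)⁻¹ i l * s0 (cb σ b) l x y = (Real.exp (σ x))⁻¹ * ((a x)⁻¹ i l * s0 b l x y)
      + (Real.exp (σ x))⁻¹ * (1/2) * (∑ m, pd m σ x * y m) * ((a x)⁻¹ i l * b x l)
      - (Real.exp (σ x))⁻¹ * (1/2) * rbeta b x y * ((a x)⁻¹ i l * pd l σ x) := by
    intro l
    rw [cinv h hσ hx, cs0 h hσ hx]
    field_simp
    ring
  unfold sU bs
  simp only [e2, Finset.sum_add_distrib, Finset.sum_sub_distrib, ← Finset.mul_sum]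
  ring

lemma crho : rho (ca σ a) (cb σ b) x y = Real.exp (σ x) * (rho a b x y
    - (rbeta b x y + ralpha a x y * bb a b x) * (∑ m, pd m σ x * y m)
    + (∑ l, bs a b l x * pd l σ x) * (ralpha a x y * RF a b x y)) := by
  have he := (Real.exp_pos (σ x)).ne'
  have w1 : ∑ j, b x j * ∑ l, (a x)⁻¹ j l * pd l σ x = ∑ l, bs a b l x * pd l σ x := by
    simp only [Finset.mul_sum]
    rw [Finset.sum_comm]
    refine Finset.sum_congr rfl fun l _ => ?_
    rw [← b_inv h hx, Finset.sum_mul]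
    exact Finset.sum_congr rfl fun j _ => by ring
  have r1 : ∑ m, B1 (cb σ b) m x y * y m = Real.exp (σ x) * (∑ m, B1 b m x y * y m
      + (∑ m, pd m σ x * y m) * rbeta b x y) := by
    simp only [Finset.mul_sum, Finset.sum_mul, ← Finset.sum_add_distrib]
    exact Finset.sum_congr rfl fun k _ => by rw [cB1 h hσ hx]; ring
  have r2 : ∑ j, cb σ b x j * Ga (ca σ a) j x y = Real.exp (σ x) * (∑ j, b x j * Ga a j x y
      + (∑ m, pd m σ x * y m) * rbeta b x y
      - (1/2) * ralpha a x y ^ 2 * ∑ j, b x j * ∑ l, (a x)⁻¹ j l * pd l σ x) := by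
    unfold rbeta
    rw [Finset.mul_sum (s := Finset.univ) (a := ∑ m, pd m σ x * y m),
      Finset.mul_sum (s := Finset.univ) (a := (1/2) * ralpha a x y ^ 2), ← Finset.sum_add_distrib,
      ← Finset.sum_sub_distrib, Finset.mul_sum]
    exact Finset.sum_congr rfl fun k _ => by rw [cGa h hσ hx hy]; simp only [cb, Pi.smul_apply, smul_eq_mul]; ring
  have r3 : ss (ca σ a) (cb σ b) x y = ss a b x y + (1/2) * ((∑ m, pd m σ x * y m) * bb a b x
      - rbeta b x y * ∑ j, b x j * ∑ l, (a x)⁻¹ j l * pd l σ x) := by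
    unfold ss bb
    rw [Finset.mul_sum (s := Finset.univ) (a := ∑ m, pd m σ x * y m),
      Finset.mul_sum (s := Finset.univ) (a := rbeta b x y), ← Finset.sum_sub_distrib,
      Finset.mul_sum, ← Finset.sum_add_distrib]
    refine Finset.sum_congr rfl fun k _ => ?_
    rw [csU h hσ hx hy]; simp only [cb, Pi.smul_apply, smul_eq_mul]
    field_simp
  unfold rho r00
  rw [r1, r2, r3, ca_al, w1]
  unfold RF
  ring

omit hy in
lemma cbb : bb (ca σ a) (cb σ b) x = bb a b x := by
  have he := (Real.exp_pos (σ x)).ne'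
  unfold bb bs
  refine Finset.sum_congr rfl fun k _ => ?_
  rw [Finset.mul_sum, Finset.mul_sum]
  refine Finset.sum_congr rfl fun l _ => ?_
  rw [cinv h hσ hx]; simp only [cb, Pi.smul_apply, smul_eq_mul]
  field_simp
end conf
end

noncomputable section

def Yc {n : ℕ} (u v : Vec n) (t : ℝ) : Vec n := fun i => (1 - t ^ 2) * u i + 2 * t * v i

section curve
open Polynomial
variable {n : ℕ} {U : Set (Vec n)} {a : Vec n → Matrix (Fin n) (Fin n) ℝ} {b : Vec n → Vec n}
  {x : Vec n}

lemma PO_poly (hx : x ∈ U) (u v : Vec n) (hY : ∀ t, Yc u v t ≠ 0) (c : ℝ) (hc : 0 < c)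
    (hα : ∀ t, ralpha a x (Yc u v t) = c * (1 + t ^ 2)) {k : ℕ} {d : ℤ} {f : Vec n → Vec n → ℝ}
    (hf : PO U a b k d f) : k = 0 → ∃ (p : ℝ[X]) (N : ℕ), ∀ t : ℝ,
      f x (Yc u v t) * (1 + t ^ 2) ^ N = p.eval t := by
  induction hf with
  | coef g hg => exact fun _ => ⟨C (g x), 0, fun t => by simp⟩
  | coord i => exact fun _ => ⟨(1 - X ^ 2) * C (u i) + 2 * X * C (v i), 0, fun t => by simp [Yc]⟩
  | al => exact fun _ => ⟨C c * (1 + X ^ 2), 0, fun t => by simp [hα]⟩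
  | ali =>
    refine fun _ => ⟨C c⁻¹, 1, fun t => ?_⟩
    have : (1 + t ^ 2) ≠ 0 := by positivity
    simp only [hα, eval_C]
    field_simp
  | Fi => intro h0; omega
  | add hf hg h1 h2 =>
    intro h0
    obtain ⟨p, N, hp⟩ := h1 h0
    obtain ⟨q, M, hq⟩ := h2 h0
    refine ⟨p * (1 + X ^ 2) ^ M + q * (1 + X ^ 2) ^ N, N + M, fun t => ?_⟩
    simp only [eval_add, eval_mul, eval_pow, eval_one, eval_X, ← hp, ← hq]
    ring
  | mul hf hg h1 h2 =>
    intro h0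
    obtain ⟨p, N, hp⟩ := h1 (by omega)
    obtain ⟨q, M, hq⟩ := h2 (by omega)
    refine ⟨p * q, N + M, fun t => ?_⟩
    simp only [eval_mul, ← hp, ← hq]
    ring
  | mono _ _ => intro h0; omega
  | congr hf h2 h1 =>
    intro h0
    obtain ⟨p, N, hp⟩ := h1 h0
    exact ⟨p, N, fun t => by rw [h2 x hx _ (hY t), hp]⟩

lemma cpx_root {κ : ℝ} (h0 : 0 < κ) (h1 : κ < 1) {wu wv : ℝ} (pA pW : ℝ[X]) (NA NW : ℕ) {C1 C2 : ℝ}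
    (hC1 : C1 ≠ 0)
    (H : ∀ t : ℝ, C1 * ((1 + κ) - (1 - κ) * t ^ 2) *
      (κ * ((1 + κ) + (1 - κ) * t ^ 2) * pA.eval t
        - κ ^ 2 * ((1 + κ) - (1 - κ) * t ^ 2) * ((1 - t ^ 2) * wu + 2 * t * wv) * (1 + t ^ 2) ^ NA) ^ 2
        * (1 + t ^ 2) ^ NW
      = C2 * ((1 + κ) + (1 - κ) * t ^ 2) * pW.eval t * (1 + t ^ 2) ^ (2 * NA)) : wu = 0 ∧ wv = 0 := by
  have HP : C C1 * ((1 + C κ) - (1 - C κ) * X ^ 2) *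
      (C κ * ((1 + C κ) + (1 - C κ) * X ^ 2) * pA
        - C κ ^ 2 * ((1 + C κ) - (1 - C κ) * X ^ 2) * ((1 - X ^ 2) * C wu + 2 * X * C wv) * (1 + X ^ 2) ^ NA) ^ 2
        * (1 + X ^ 2) ^ NW
      = C C2 * ((1 + C κ) + (1 - C κ) * X ^ 2) * pW * (1 + X ^ 2) ^ (2 * NA) := by
    apply Polynomial.funext
    intro t
    simpa using H t
  set s : ℝ := Real.sqrt ((1 + κ) / (1 - κ)) with hs
  have h1' : (0:ℝ) < 1 - κ := by linarith
  have hs2 : s ^ 2 = (1 + κ) / (1 - κ) := Real.sq_sqrt (by positivity)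
  have hs3 : (1 - κ) * s ^ 2 = 1 + κ := by rw [hs2]; field_simp
  have hspos : 0 < s := Real.sqrt_pos.2 (by positivity)
  have hs1 : 1 < s ^ 2 := by
    by_contra hcon
    have : s ^ 2 ≤ 1 := by linarith
    nlinarith
  have HE := congrArg (aeval (Complex.I * (s:ℂ))) HP
  have hI : (Complex.I * (s:ℂ)) ^ 2 = -((s:ℂ) ^ 2) := by rw [mul_pow, Complex.I_sq]; ring
  simp only [map_mul, map_sub, map_add, map_pow, map_one, aeval_C, aeval_X, hI, map_ofNat, 
    Complex.coe_algebraMap] at HE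
  have e1 : (1 + (κ:ℂ)) + (1 - κ) * -((s:ℂ) ^ 2) = 0 := by
    have : ((1 - κ) * s ^ 2 : ℂ) = 1 + κ := by exact_mod_cast hs3
    linear_combination -this
  have e2 : (1 + (κ:ℂ)) - (1 - κ) * -((s:ℂ) ^ 2) = 2 * (1 + κ) := by
    have : ((1 - κ) * s ^ 2 : ℂ) = 1 + κ := by exact_mod_cast hs3
    linear_combination this
  rw [e1, e2] at HE
  simp only [mul_zero, zero_mul, zero_sub] at HE
  have n1 : (C1:ℂ) ≠ 0 := by exact_mod_cast hC1
  have n2 : (κ:ℂ) ≠ 0 := by exact_mod_cast h0.ne'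
  have n3 : (1 + (κ:ℂ)) ≠ 0 := by exact_mod_cast (by linarith : (1 + κ) ≠ 0)
  have n4 : (1 + -((s:ℂ) ^ 2)) ≠ 0 := by exact_mod_cast (by linarith : (1 + -(s ^ 2)) ≠ 0)
  have HF : (1 - -((s:ℂ) ^ 2)) * wu + 2 * (Complex.I * s) * wv = 0 := by
    by_contra hne
    rw [sub_neg_eq_add] at hne
    revert HE
    simp [n1, n2, n3, n4, hne]
  have hre := congrArg Complex.re HF
  have him := congrArg Complex.im HF
  have k1 : (1 - -((s:ℂ) ^ 2)) * wu + 2 * (Complex.I * s) * wv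
     = (((1 + s ^ 2) * wu : ℝ) : ℂ) + ((2 * s * wv : ℝ) : ℂ) * Complex.I := by push_cast; ring
  rw [k1] at hre him
  simp only [Complex.add_re, Complex.ofReal_re, Complex.re_ofReal_mul, Complex.I_re, mul_zero, add_zero,
    Complex.zero_re, Complex.add_im, Complex.ofReal_im, Complex.im_ofReal_mul, Complex.I_im, mul_one,
    zero_add, Complex.zero_im] at hre him
  constructor
  · rcases mul_eq_zero.1 hre with h | h
    · nlinarith
    · exact h
  · rcases mul_eq_zero.1 him with h | h
    · nlinarith
    · exact h

end curve

section main1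
variable {n : ℕ} {U : Set (Vec n)} {a : Vec n → Matrix (Fin n) (Fin n) ℝ} {b : Vec n → Vec n}
  {σ : Vec n → ℝ} {x : Vec n} (hn : 2 ≤ n)
  (h : RD U a b) (hσ : ContDiffOn ℝ (⊤ : ℕ∞) σ U) (hx : x ∈ U) (hb : b x ≠ 0) (lam : ℝ)
  (hrho : ∀ y : Vec n, y ≠ 0 →
    rho a b x y = RF a b x y * (2 * lam * (ralpha a x y - rbeta b x y) - 2 * ss a b x y))
  (θ : Vec n) (μ : ℝ)
  (hw : ∀ y : Vec n, y ≠ 0 → scalarCurv (RF (ca σ a) (cb σ b)) x y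
    = (n : ℝ) * ((n : ℝ) - 1) * ((∑ i, θ i * y i) / RF (ca σ a) (cb σ b) x y + μ))
include h hx

/-- the inner product of a -/
def ip (a : Vec n → Matrix (Fin n) (Fin n) ℝ) (x u v : Vec n) : ℝ := ∑ i, yl a i x u * v i

omit h hx in
lemma ip_lin (u v w : Vec n) (c d : ℝ) :
    ip a x u (fun i => c * v i + d * w i) = c * ip a x u v + d * ip a x u w := by
  unfold ip
  simp only [Finset.mul_sum, ← Finset.sum_add_distrib]
  exact Finset.sum_congr rfl fun i _ => by ring

lemma ip_comm (u v : Vec n) : ip a x u v = ip a x v u := by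
  unfold ip yl
  simp only [Finset.sum_mul]
  rw [Finset.sum_comm]
  exact Finset.sum_congr rfl fun i _ => Finset.sum_congr rfl fun j _ => by rw [h.symm x hx i j]; ring

lemma al_ip (y : Vec n) (hy : y ≠ 0) : ralpha a x y = Real.sqrt (ip a x y y) := by
  have := h.asq hx hy
  rw [ip, ← this, Real.sqrt_mul_self (h.apos hx hy).le]

lemma ip_pos (y : Vec n) (hy : y ≠ 0) : 0 < ip a x y y := by
  have := h.asq hx hy
  rw [ip, ← this]; have := h.apos hx hy; positivity

lemma ip_bs (v : Vec n) : ip a x (fun i => bs a b i x) v = rbeta b x v := by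
  unfold ip rbeta
  exact Finset.sum_congr rfl fun i _ => by rw [← a_bs h hx i]; rfl

lemma ip_bsbs : ip a x (fun i => bs a b i x) (fun i => bs a b i x) = bb a b x := ip_bs h hx _

include hb in
lemma bs_ne : (fun i => bs a b i x) ≠ 0 := by
  intro h0
  apply hb
  funext i
  rw [← a_bs h hx i]
  exact Finset.sum_eq_zero fun j _ => by rw [show bs a b j x = 0 from congrFun h0 j]; simp

include hn hσ hb hrho hw

lemma curve_dir (v : Vec n) (hv1 : rbeta b x v = 0) (hv2 : ip a x v v = bb a b x) :
    ∑ m, pd m σ x * bs a b m x = 0 ∧ ∑ m, pd m σ x * v m = 0 := by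
  set u : Vec n := fun i => bs a b i x with hu
  have hune : u ≠ 0 := bs_ne h hx hb
  have hbbpos : 0 < bb a b x := by rw [← ip_bsbs h hx]; exact ip_pos h hx _ hune
  set κ := Real.sqrt (bb a b x) with hκ
  have hκ2 : κ * κ = bb a b x := Real.mul_self_sqrt hbbpos.le
  have hκ0 : 0 < κ := Real.sqrt_pos.2 hbbpos
  have hβu : rbeta b x u = κ * κ := by rw [hκ2]; exact ip_bs h hx u ▸ ip_bsbs h hx
  have hκ1 : κ < 1 := by
    have := h.Fpos x hx (-u) (neg_ne_zero.2 hune)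
    rw [al_neg, be_neg, al_ip h hx u hune, ip_bsbs h hx, ← hκ, hβu] at this
    nlinarith
  have hβ : ∀ t, rbeta b x (Yc u v t) = κ * κ * (1 - t ^ 2) := by
    intro t
    rw [← ip_bs h hx]
    unfold Yc
    rw [ip_lin, ip_bs h hx, ip_bs h hx, hv1, hβu]; ring
  have hYY : ∀ t, ip a x (Yc u v t) (Yc u v t) = (κ * (1 + t ^ 2)) ^ 2 := by
    intro t
    conv_lhs => arg 4; unfold Yc
    rw [ip_lin, ip_comm h hx _ u, ip_comm h hx _ v]
    unfold Yc
    rw [ip_lin, ip_lin, ip_comm h hx v u, hv2, ip_bs h hx, ip_bs h hx, hβu, hv1, ← hκ2]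
    ring
  have hYne : ∀ t, Yc u v t ≠ 0 := by
    intro t h0
    have := hYY t
    rw [h0] at this
    have h2 : ip a x 0 0 = 0 := by simp [ip]
    rw [h2] at this
    have : 0 < (κ * (1 + t ^ 2)) ^ 2 := by positivity
    linarith
  have hα : ∀ t, ralpha a x (Yc u v t) = κ * (1 + t ^ 2) := by
    intro t
    rw [al_ip h hx _ (hYne t), hYY, Real.sqrt_sq (by positivity)]
  have hF : ∀ t, RF a b x (Yc u v t) = κ * ((1 + κ) + (1 - κ) * t ^ 2) := by
    intro t; unfold RF; rw [hα, hβ]; ring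
  set e := Real.exp (σ x) with he
  have hepos : 0 < e := Real.exp_pos _
  have hα' : ∀ t, ralpha (ca σ a) x (Yc u v t) = e * κ * (1 + t ^ 2) := by
    intro t; rw [ca_al, hα]; ring
  obtain ⟨K, hK, hKe⟩ := scal_lead (cRD h hσ)
  have h' := cRD h hσ
  set wb := ∑ l, bs a b l x * pd l σ x with hwb
  have hA : PO U a b 0 1 (fun x y => (2 * lam) * (ralpha a x y - rbeta b x y) - 2 * ss a b x y
      + wb * ralpha a x y) :=
    (((PO.al.sub (PO.be h)).cmul _).sub ((ss_PO h).cmul _)).add (PO.al.cmul _)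
  have hF' := PO.F h'
  have hF2 := hF'.mul hF'
  have hW : PO U (ca σ a) (cb σ b) 0 4 (fun x y => ((n : ℝ) * ((n : ℝ) - 1)) *
      ((∑ i, θ i * y i) * (RF (ca σ a) (cb σ b) x y * (RF (ca σ a) (cb σ b) x y * RF (ca σ a) (cb σ b) x y))
      + μ * ((RF (ca σ a) (cb σ b) x y * RF (ca σ a) (cb σ b) x y) * (RF (ca σ a) (cb σ b) x y * RF (ca σ a) (cb σ b) x y))) - K x y) :=
    (PO.cmul _ ((((PO.sum (f := fun i x y => θ i * y i) (s := Finset.univ) (fun i _ => PO.cmul (θ i) (PO.coord i))).mul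
      (hF'.mul hF2)).cast (by omega) (by omega)).add (PO.cmul μ ((hF2.mul hF2).cast (by omega) (by omega))))).sub hK
  obtain ⟨pA, NA, hpA⟩ := PO_poly hx u v hYne κ hκ0 hα hA rfl
  obtain ⟨pW, NW, hpW⟩ := PO_poly hx u v hYne (e * κ) (by positivity) hα' hW rfl
  have hn1 : (0:ℝ) < (n:ℝ) - 1 := by
    have : (2:ℝ) ≤ n := by exact_mod_cast hn
    linarith
  have hσ0 : ∀ t, ∑ m, pd m σ x * Yc u v t m = (1 - t ^ 2) * (∑ m, pd m σ x * u m)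
      + 2 * t * ∑ m, pd m σ x * v m := by
    intro t
    unfold Yc
    simp only [Finset.mul_sum, ← Finset.sum_add_distrib]
    exact Finset.sum_congr rfl fun i _ => by ring
  refine cpx_root hκ0 hκ1 (wu := ∑ m, pd m σ x * u m) (wv := ∑ m, pd m σ x * v m) pA pW NA NW
    (C1 := (9/2) * ((n:ℝ) - 1) * e ^ 3 * κ ^ 2) (C2 := e * κ) (by positivity) ?_
  intro t
  have hy := hYne t
  have k1 := hKe x hx _ hy
  rw [hw _ hy, cbb h hσ hx, ca_al, cb_be, crho h hσ hx hy, hrho _ hy] at k1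
  have hF'pos : RF (ca σ a) (cb σ b) x (Yc u v t) ≠ 0 := (h'.Fpos x hx _ hy).ne'
  have k2 : ∀ S : ℝ, (n : ℝ) * ((n : ℝ) - 1) * (S / RF (ca σ a) (cb σ b) x (Yc u v t) + μ)
      * RF (ca σ a) (cb σ b) x (Yc u v t) ^ 5 = (n : ℝ) * ((n : ℝ) - 1) * (S * RF (ca σ a) (cb σ b) x (Yc u v t) ^ 4
        + μ * RF (ca σ a) (cb σ b) x (Yc u v t) ^ 5) := by
    intro S; field_simp
  rw [k2] at k1
  have k3 := hpA t
  have k4 := hpW t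
  rw [← k3, ← k4]
  simp only [cRF] at k1 ⊢
  rw [hσ0, hα, hβ, hF, ← he, ← hκ2, ← hwb] at k1
  rw [hα, hβ, hF, ← he]
  clear_value e κ wb
  generalize ss a b x (Yc u v t) = S at *
  generalize K x (Yc u v t) = KK at *
  generalize (∑ i, θ i * Yc u v t i) = T at *
  generalize (∑ m, pd m σ x * u m) = wu at *
  generalize (∑ m, pd m σ x * v m) = wv at *
  have : (1 + t ^ 2) ^ (2 * NA) = ((1 + t ^ 2) ^ NA) ^ 2 := by rw [← pow_mul]; ring_nf
  rw [this]
  generalize (1 + t ^ 2) ^ NA = P1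
  generalize (1 + t ^ 2) ^ NW = P2
  linear_combination (-P1 ^ 2 * P2) * k1

lemma dsig_zero (i : Fin n) : pd i σ x = 0 := by
  set u : Vec n := fun i => bs a b i x with hu
  have hune : u ≠ 0 := bs_ne h hx hb
  have hbbpos : 0 < bb a b x := by rw [← ip_bsbs h hx]; exact ip_pos h hx _ hune
  have hβu : rbeta b x u = bb a b x := ip_bs h hx u ▸ ip_bsbs h hx
  -- scaled direction
  have key : ∀ z : Vec n, z ≠ 0 → rbeta b x z = 0 →
      ∑ m, pd m σ x * u m = 0 ∧ ∑ m, pd m σ x * z m = 0 := by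
    intro z hz hzb
    have hzp := ip_pos h hx z hz
    set s := Real.sqrt (bb a b x / ip a x z z) with hs
    have hs0 : 0 < s := Real.sqrt_pos.2 (by positivity)
    have hs2 : s * s = bb a b x / ip a x z z := Real.mul_self_sqrt (by positivity)
    have e0 : (fun i => s * z i) = fun i => s * z i + 0 * z i := by funext i; ring
    have := curve_dir hn h hσ hx hb lam hrho θ μ hw (fun i => s * z i) (by
        rw [← ip_bs h hx, e0, ip_lin, ip_bs h hx, hzb]; ring) (by
        rw [e0, ip_lin, ← e0, ip_comm h hx _ z, e0, ip_lin]
        have : s * s * ip a x z z = bb a b x := by rw [hs2]; field_simp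
        linear_combination this)
    refine ⟨this.1, ?_⟩
    have h2 := this.2
    have h3 : ∑ m, pd m σ x * (s * z m) = s * ∑ m, pd m σ x * z m := by
      rw [Finset.mul_sum]; exact Finset.sum_congr rfl fun i _ => by ring
    rw [h3] at h2
    rcases mul_eq_zero.1 h2 with h | h
    · exact absurd h hs0.ne'
    · exact h
  let pr : Vec n → Vec n := fun z i => 1 * z i + (-(rbeta b x z / bb a b x)) * u i
  have hpr : ∀ z, rbeta b x (pr z) = 0 := by
    intro z
    rw [← ip_bs h hx, ip_lin, ip_bs h hx, ip_bs h hx, hβu]; field_simp; ring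
  have hpz : ∀ z, pr z = 0 → ∀ k, z k = (rbeta b x z / bb a b x) * u k := by
    intro z hz k
    have := congrFun hz k
    simp only [pr, Pi.zero_apply] at this
    linarith
  have hsum : ∀ z : Vec n, ∑ m, pd m σ x * pr z m = ∑ m, pd m σ x * z m
      + (-(rbeta b x z / bb a b x)) * ∑ m, pd m σ x * u m := by
    intro z
    simp only [pr, Finset.mul_sum, ← Finset.sum_add_distrib]
    exact Finset.sum_congr rfl fun i _ => by ring
  have hex : ∃ z, pr z ≠ 0 := by
    by_contra hcon
    push Not at hcon
    let i0 : Fin n := ⟨0, by omega⟩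
    let i1 : Fin n := ⟨1, by omega⟩
    have hne : i0 ≠ i1 := by simp [i0, i1]
    have a0 := hpz _ (hcon (Pi.single i0 1)) i0
    have a1 := hpz _ (hcon (Pi.single i0 1)) i1
    have a2 := hpz _ (hcon (Pi.single i1 1)) i1
    simp [hne, hne.symm] at a0 a1 a2
    rcases a1 with a1 | a1
    · rcases a1 with a1 | a1
      · rw [a1] at a0; simp at a0
      · exact hbbpos.ne' a1
    · rw [a1] at a2; simp at a2
  obtain ⟨z0, hz0⟩ := hex
  have hu0 := (key _ hz0 (hpr z0)).1
  have hall : ∀ z : Vec n, ∑ m, pd m σ x * z m = 0 := by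
    intro z
    have e := hsum z
    rw [hu0] at e
    by_cases hz : pr z = 0
    · rw [hz] at e; simp at e; simpa using e.symm
    · rw [(key _ hz (hpr z)).2] at e; linarith
  have := hall (Pi.single i 1)
  simpa [Pi.single_apply] using this
end main1
end

noncomputable section

/-! ### Carleman estimate -/

/-- bundled pointwise differentiability with partial derivatives -/
def HP {n : ℕ} (x : Vec n) (f : Vec n → ℝ) (f' : Fin n → ℝ) : Prop :=
  DifferentiableAt ℝ f x ∧ ∀ j, pd j f x = f' j

section HPs
variable {n : ℕ} {x : Vec n} {f g : Vec n → ℝ} {f' g' : Fin n → ℝ} {U : Set (Vec n)}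

lemma HP.add (hf : HP x f f') (hg : HP x g g') : HP x (fun x => f x + g x) (fun j => f' j + g' j) :=
  ⟨hf.1.add hg.1, fun j => by rw [pd_add j hf.1 hg.1, hf.2, hg.2]⟩

lemma HP.mul (hf : HP x f f') (hg : HP x g g') :
    HP x (fun x => f x * g x) (fun j => f' j * g x + f x * g' j) :=
  ⟨hf.1.mul hg.1, fun j => by rw [pd_mul j hf.1 hg.1, hf.2, hg.2]⟩

lemma HP.const (c : ℝ) : HP x (fun _ => c) (fun _ => 0) :=
  ⟨differentiableAt_const c, fun j => pd_const j c x⟩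

lemma HP.sub (hf : HP x f f') (hg : HP x g g') : HP x (fun x => f x - g x) (fun j => f' j - g' j) := by
  have := hf.add ((HP.const (-1)).mul hg)
  refine ⟨hf.1.sub hg.1, fun j => ?_⟩
  have h2 := this.2 j
  have e : (fun x => f x - g x) = (fun x => f x + -1 * g x) := by funext x; ring
  rw [e, h2]; ring

lemma HP.exp (hf : HP x f f') : HP x (fun x => Real.exp (f x)) (fun j => Real.exp (f x) * f' j) := by
  refine ⟨hf.1.exp, fun j => ?_⟩
  unfold pd
  rw [fderiv_exp hf.1]
  have := hf.2 j
  unfold pd at this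
  simp [this]

lemma HP.of (hU : IsOpen U) (hf : ContDiffOn ℝ (⊤ : ℕ∞) f U) (hx : x ∈ U) :
    HP x f (fun j => pd j f x) :=
  ⟨(hf.contDiffAt (hU.mem_nhds hx)).differentiableAt (by simp), fun _ => rfl⟩

lemma pd_comm (hU : IsOpen U) (hf : ContDiffOn ℝ (⊤ : ℕ∞) f U) (hx : x ∈ U) (i j : Fin n) :
    pd i (pd j f) x = pd j (pd i f) x := by
  have hc := hf.contDiffAt (hU.mem_nhds hx)
  have hs : IsSymmSndFDerivAt ℝ f x := hc.isSymmSndFDerivAt (by simp; exact WithTop.coe_le_coe.2 (le_top : (2:ℕ∞) ≤ ⊤))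
  have hd : DifferentiableAt ℝ (fderiv ℝ f) x :=
    (hc.fderiv_right (m := 1) (by norm_cast)).differentiableAt (by simp)
  have key : ∀ i j : Fin n, pd i (pd j f) x = fderiv ℝ (fderiv ℝ f) x (Pi.single i 1) (Pi.single j 1) := by
    intro i j
    unfold pd
    rw [fderiv_clm_apply hd (differentiableAt_const _)]
    simp
  rw [key, key]; exact hs _ _

lemma contDiff_of_supp (hU : IsOpen U) (hf : ContDiffOn ℝ (⊤ : ℕ∞) f U) {K : Set (Vec n)}
    (hK : IsCompact K) (hKU : K ⊆ U) (h0 : ∀ x, x ∉ K → f x = 0) : ContDiff ℝ (⊤ : ℕ∞) f := by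
  rw [contDiff_iff_contDiffAt]
  intro x
  by_cases hx : x ∈ U
  · exact hf.contDiffAt (hU.mem_nhds hx)
  · have hx' : x ∉ K := fun h => hx (hKU h)
    have : f =ᶠ[nhds x] fun _ => 0 := by
      filter_upwards [hK.isClosed.isOpen_compl.mem_nhds hx'] with z hz
      exact h0 z hz
    exact contDiffAt_const.congr_of_eventuallyEq this

lemma pd_integral_zero (hU : IsOpen U) (hf : ContDiffOn ℝ (⊤ : ℕ∞) f U) {K : Set (Vec n)}
    (hK : IsCompact K) (hKU : K ⊆ U) (h0 : ∀ x, x ∉ K → f x = 0) (i : Fin n) :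
    Integrable (pd i f) ∧ ∫ x, pd i f x = 0 := by
  have hc := contDiff_of_supp hU hf hK hKU h0
  have hcs : HasCompactSupport f := HasCompactSupport.intro hK h0
  have hfd : Continuous (fderiv ℝ f) := hc.continuous_fderiv (by simp)
  have hi : Integrable (pd i f) := by
    have : Continuous (pd i f) := hfd.clm_apply continuous_const
    refine this.integrable_of_hasCompactSupport ?_
    exact hcs.fderiv_apply (𝕜 := ℝ) _
  refine ⟨hi, ?_⟩
  have := integral_mul_fderiv_eq_neg_fderiv_mul_of_integrable (μ := volume) (f := fun _ : Vec n => (1:ℝ)) (g := f)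
    (v := Pi.single i 1) (by simp) (by simp only [one_mul]; exact hi)
    (by simpa using hc.continuous.integrable_of_hasCompactSupport hcs)
    (fun _ _ => differentiableAt_const _) (fun x _ => (hc.differentiable (by simp)) x)
  simpa [pd] using this

lemma carleman_alg (f g fi fk gi gk p q p' pk qi qk φi φk φii φik φkk τ : ℝ) (hq : q ≠ 0) :
    (τ * (φii + 2*p*φik + (p^2+q^2)*φkk + (p' + 2*p*pk + 2*q*qk)*φk + pk*φi
        - qk*q*φk - (qi+p*qk)/q*(φi+p*φk))
      - (qk^2 + ((qi+p*qk)/q)^2)/4) * (f^2+g^2)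
    + (qk*(f*gi - g*fi) + qi*(g*fk-f*gk) + 2*q*(fk*gi-fi*gk)
       - τ*(φii + 2*p*φik + (p^2+q^2)*φkk + (p' + 2*p*pk + 2*q*qk)*φk + pk*φi)*(f^2+g^2)
       - 2*τ*((φi+p*φk)*(f*(fi+p*fk)+g*(gi+p*gk)) + q^2*φk*(f*fk+g*gk)))
    ≤ (fi + p*fk - τ*(φi+p*φk)*f - q*gk + τ*(q*φk)*g)^2
      + (gi + p*gk - τ*(φi+p*φk)*g + q*fk - τ*(q*φk)*f)^2 := by
  obtain ⟨c, hc⟩ : ∃ c, c = (qi+p*qk)/q := ⟨_, rfl⟩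
  have hqi : qi = c*q - p*qk := by rw [hc]; field_simp; ring
  rw [← hc]
  subst hqi
  have h1 := sq_nonneg (fi + p*fk + τ*(q*φk)*g + qk*g/2)
  have h2 := sq_nonneg (gi + p*gk - τ*(q*φk)*f - qk*f/2)
  have h3 := sq_nonneg (-q*gk - τ*(φi+p*φk)*f - c*f/2)
  have h4 := sq_nonneg (q*fk - τ*(φi+p*φk)*g - c*g/2)
  nlinarith [h1, h2, h3, h4]

variable {p q φ : Vec n → ℝ}

def cX (p : Vec n → ℝ) (i k : Fin n) (u : Vec n → ℝ) (x : Vec n) : ℝ := pd i u x + p x * pd k u x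
def cH1 (p q φ f g : Vec n → ℝ) (i k : Fin n) (τ : ℝ) (x : Vec n) : ℝ :=
  q x * (f x * pd i g x - g x * pd i f x)
    - τ * (p x * (pd i φ x + p x * pd k φ x) + q x * q x * pd k φ x) * (f x * f x + g x * g x)
def cH2 (p q φ f g : Vec n → ℝ) (i k : Fin n) (τ : ℝ) (x : Vec n) : ℝ :=
  q x * (g x * pd k f x - f x * pd k g x)
    - τ * (pd i φ x + p x * pd k φ x) * (f x * f x + g x * g x)
def cZ (p q φ : Vec n → ℝ) (i k : Fin n) (x : Vec n) : ℝ :=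
  pd i (pd i φ) x + 2*p x*pd i (pd k φ) x + (p x^2+q x^2)*pd k (pd k φ) x
    + (pd i p x + 2*p x*pd k p x + 2*q x*pd k q x)*pd k φ x + pd k p x*pd i φ x
        - pd k q x*q x*pd k φ x - (pd i q x+p x*pd k q x)/q x*(pd i φ x+p x*pd k φ x)
def cN (p q : Vec n → ℝ) (i k : Fin n) (x : Vec n) : ℝ :=
  (pd k q x^2 + ((pd i q x+p x*pd k q x)/q x)^2)/4

lemma carleman_pt (hU : IsOpen U) (hx : x ∈ U) (hf : ContDiffOn ℝ (⊤ : ℕ∞) f U)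
    (hg : ContDiffOn ℝ (⊤ : ℕ∞) g U) (hp : ContDiffOn ℝ (⊤ : ℕ∞) p U) (hq : ContDiffOn ℝ (⊤ : ℕ∞) q U)
    (hφ : ContDiffOn ℝ (⊤ : ℕ∞) φ U) (hq0 : q x ≠ 0) (i k : Fin n) (τ : ℝ) :
    (τ * cZ p q φ i k x - cN p q i k x) * (f x^2 + g x^2)
      + (pd k (cH1 p q φ f g i k τ) x + pd i (cH2 p q φ f g i k τ) x)
    ≤ (cX p i k f x - τ * cX p i k φ x * f x - q x * pd k g x + τ * (q x * pd k φ x) * g x)^2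
      + (cX p i k g x - τ * cX p i k φ x * g x + q x * pd k f x - τ * (q x * pd k φ x) * f x)^2 := by
  have Hf := HP.of hU hf hx
  have Hg := HP.of hU hg hx
  have Hp := HP.of hU hp hx
  have Hq := HP.of hU hq hx
  have Hfi := HP.of hU (pd_smooth hU hf i) hx
  have Hfk := HP.of hU (pd_smooth hU hf k) hx
  have Hgi := HP.of hU (pd_smooth hU hg i) hx
  have Hgk := HP.of hU (pd_smooth hU hg k) hx
  have Hφi := HP.of hU (pd_smooth hU hφ i) hx
  have Hφk := HP.of hU (pd_smooth hU hφ k) hx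
  have K1 := ((Hq.mul ((Hf.mul Hgi).sub (Hg.mul Hfi))).sub
    (((HP.const τ).mul ((Hp.mul (Hφi.add (Hp.mul Hφk))).add ((Hq.mul Hq).mul Hφk))).mul
      ((Hf.mul Hf).add (Hg.mul Hg)))).2 k
  have K2 := ((Hq.mul ((Hg.mul Hfk).sub (Hf.mul Hgk))).sub
    (((HP.const τ).mul (Hφi.add (Hp.mul Hφk))).mul
      ((Hf.mul Hf).add (Hg.mul Hg)))).2 i
  have e1 : pd k (cH1 p q φ f g i k τ) x = _ := K1
  have e2 : pd i (cH2 p q φ f g i k τ) x = _ := K2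
  rw [e1, e2]
  beta_reduce
  rw [pd_comm hU hf hx k i, pd_comm hU hg hx k i, pd_comm hU hφ hx k i]
  have := carleman_alg (f x) (g x) (pd i f x) (pd k f x) (pd i g x) (pd k g x) (p x) (q x)
    (pd i p x) (pd k p x) (pd i q x) (pd k q x) (pd i φ x) (pd k φ x) (pd i (pd i φ) x)
    (pd i (pd k φ) x) (pd k (pd k φ) x) τ hq0
  unfold cX cZ cN
  convert this using 1
  ring
end HPs
end

noncomputable section

section weight
variable {n : ℕ} {x : Vec n} {f g : Vec n → ℝ} {U : Set (Vec n)} {p q ψ h : Vec n → ℝ}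

def cE (p q ψ : Vec n → ℝ) (i k : Fin n) (x : Vec n) : ℝ := cX p i k ψ x ^ 2 + (q x * pd k ψ x) ^ 2

lemma exp_HP (hψ : ContDiff ℝ (⊤ : ℕ∞) ψ) (γ : ℝ) (x : Vec n) :
    HP x (fun x => Real.exp (γ * ψ x)) (fun j => Real.exp (γ * ψ x) * (γ * pd j ψ x)) := by
  have := ((HP.const γ).mul (HP.of isOpen_univ hψ.contDiffOn (Set.mem_univ x))).exp
  simpa using this

lemma cZ_exp (hψ : ContDiff ℝ (⊤ : ℕ∞) ψ) (γ : ℝ) (i k : Fin n) (x : Vec n) :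
    cZ p q (fun x => Real.exp (γ * ψ x)) i k x
      = Real.exp (γ * ψ x) * (γ ^ 2 * cE p q ψ i k x + γ * cZ p q ψ i k x) := by
  have e1 : ∀ j, pd j (fun x => Real.exp (γ * ψ x)) = fun x => Real.exp (γ * ψ x) * (γ * pd j ψ x) :=
    fun j => funext fun x => (exp_HP hψ γ x).2 j
  have e2 : ∀ j l, pd l (pd j (fun x => Real.exp (γ * ψ x))) x
      = Real.exp (γ * ψ x) * (γ * pd l ψ x) * (γ * pd j ψ x) + Real.exp (γ * ψ x) * (γ * pd l (pd j ψ) x) := by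
    intro j l
    rw [e1]
    have := ((exp_HP hψ γ x).mul ((HP.const γ).mul
      (HP.of isOpen_univ (pd_smooth isOpen_univ hψ.contDiffOn j) (Set.mem_univ x)))).2 l
    rw [this]; ring
  unfold cZ cE cX
  simp only [e2]
  simp only [e1]
  ring

lemma weighted (hU : IsOpen U) (hx : x ∈ U) (hf : ContDiffOn ℝ (⊤ : ℕ∞) f U)
    {φ : Vec n → ℝ} (hφ : ContDiffOn ℝ (⊤ : ℕ∞) φ U) (hh : ContDiffOn ℝ (⊤ : ℕ∞) h U) (τ : ℝ) (j : Fin n) :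
    pd j (fun x => Real.exp (τ * φ x) * (h x * f x)) x
      = Real.exp (τ * φ x) * (h x * pd j f x + f x * pd j h x)
        + τ * pd j φ x * (Real.exp (τ * φ x) * (h x * f x)) := by
  have := (((HP.const τ).mul (HP.of hU hφ hx)).exp.mul ((HP.of hU hh hx).mul (HP.of hU hf hx))).2 j
  rw [this]; ring

lemma bound_fam {s : Finset (Fin n)} {K : Set (Vec n)} (hK : IsCompact K) {u : Fin n → Vec n → ℝ}
    (hu : ∀ k ∈ s, ContinuousOn (u k) K) : ∃ C : ℝ, 1 ≤ C ∧ ∀ k ∈ s, ∀ x ∈ K, |u k x| ≤ C := by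
  have hc : ContinuousOn (fun x => ∑ k ∈ s, |u k x|) K :=
    continuousOn_finsetSum s fun k hk => (hu k hk).abs
  obtain ⟨C, hC⟩ := hK.exists_bound_of_continuousOn hc
  refine ⟨max C 1, le_max_right _ _, fun k hk x hx => ?_⟩
  have h1 := hC x hx
  have h2 : |u k x| ≤ ∑ k ∈ s, |u k x| :=
    Finset.single_le_sum (f := fun k => |u k x|) (fun _ _ => abs_nonneg _) hk
  exact h2.trans ((le_abs_self _).trans (h1.trans (le_max_left _ _)))

/-- single-k pointwise inequality for the weighted functions -/
lemma carleman_w (hU : IsOpen U) (hx : x ∈ U) (hf : ContDiffOn ℝ (⊤ : ℕ∞) f U)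
    (hg : ContDiffOn ℝ (⊤ : ℕ∞) g U) (hp : ContDiffOn ℝ (⊤ : ℕ∞) p U) (hq : ContDiffOn ℝ (⊤ : ℕ∞) q U)
    {φ : Vec n → ℝ}
    (hφ : ContDiffOn ℝ (⊤ : ℕ∞) φ U) (hh : ContDiffOn ℝ (⊤ : ℕ∞) h U)
    (hq0 : q x ≠ 0) (i k : Fin n) (τ : ℝ) (F G : Vec n → ℝ)
    (hF : F = fun x => Real.exp (τ * φ x) * (h x * f x))
    (hG : G = fun x => Real.exp (τ * φ x) * (h x * g x)) :
    (τ * cZ p q φ i k x - cN p q i k x) * (F x^2 + G x^2)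
      + (pd k (cH1 p q φ F G i k τ) x + pd i (cH2 p q φ F G i k τ) x)
    ≤ 2 * (Real.exp (τ * φ x))^2 * (h x ^ 2 * ((cX p i k f x - q x * pd k g x)^2
        + (cX p i k g x + q x * pd k f x)^2) + (f x ^ 2 + g x ^ 2) * cE p q h i k x) := by
  have sF : ContDiffOn ℝ (⊤ : ℕ∞) F U := by
    rw [hF]; exact (contDiffOn_const.mul hφ).exp.mul (hh.mul hf)
  have sG : ContDiffOn ℝ (⊤ : ℕ∞) G U := by
    rw [hG]; exact (contDiffOn_const.mul hφ).exp.mul (hh.mul hg)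
  refine (carleman_pt hU hx sF sG hp hq hφ hq0 i k τ).trans ?_
  have eF : ∀ j, pd j F x = _ := fun j =>
    (congrArg (fun u => pd j u x) hF).trans (weighted hU hx hf hφ hh τ j)
  have eG : ∀ j, pd j G x = _ := fun j =>
    (congrArg (fun u => pd j u x) hG).trans (weighted hU hx hg hφ hh τ j)
  have vF : F x = Real.exp (τ * φ x) * (h x * f x) := by rw [hF]
  have vG : G x = Real.exp (τ * φ x) * (h x * g x) := by rw [hG]
  unfold cX cE
  simp only [eF, eG, vF, vG]
  unfold cX
  generalize Real.exp (τ * φ x) = e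
  obtain ⟨L1, hL1⟩ : ∃ L, L = h x * (pd i f x + p x * pd k f x - q x * pd k g x) := ⟨_, rfl⟩
  obtain ⟨L2, hL2⟩ : ∃ L, L = h x * (pd i g x + p x * pd k g x + q x * pd k f x) := ⟨_, rfl⟩
  obtain ⟨M1, hM1⟩ : ∃ L, L = f x * (pd i h x + p x * pd k h x) - g x * (q x * pd k h x) := ⟨_, rfl⟩
  obtain ⟨M2, hM2⟩ : ∃ L, L = g x * (pd i h x + p x * pd k h x) + f x * (q x * pd k h x) := ⟨_, rfl⟩
  have h1 := mul_nonneg (sq_nonneg e) (sq_nonneg (L1 - M1))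
  have h2 := mul_nonneg (sq_nonneg e) (sq_nonneg (L2 - M2))
  have a1 : (e * (L1 + M1))^2 + (e * (L2 + M2))^2 ≤ 2 * e^2 * (L1^2+L2^2 + (M1^2+M2^2)) := by
    linarith
  subst hL1 hL2 hM1 hM2
  refine le_of_eq_of_le ?_ (a1.trans_eq ?_)
  · ring
  · ring
end weight
end

noncomputable section

section uc
variable {n : ℕ} {U K : Set (Vec n)} {p q f g : Fin n → Vec n → ℝ} {ψ h : Vec n → ℝ}
  {s : Finset (Fin n)} {i : Fin n} {C : Vec n → ℝ} {c1 : ℝ}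

lemma pd_off (hK : IsCompact K) {u : Vec n → ℝ} (h0 : ∀ x, x ∉ K → u x = 0) {x : Vec n} (hx : x ∉ K)
    (j : Fin n) : pd j u x = 0 := by
  have : u =ᶠ[nhds x] fun _ => 0 := by
    filter_upwards [hK.isClosed.isOpen_compl.mem_nhds hx] with z hz
    exact h0 z hz
  unfold pd; rw [this.fderiv_eq]; simp

/-- integrated inequality -/
lemma uc_int (hU : IsOpen U) (hK : IsCompact K) (hKU : K ⊆ U)
    (hp : ∀ k, ContDiffOn ℝ (⊤ : ℕ∞) (p k) U) (hq : ∀ k, ContDiffOn ℝ (⊤ : ℕ∞) (q k) U)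
    (hf : ∀ k, ContDiffOn ℝ (⊤ : ℕ∞) (f k) U) (hg : ∀ k, ContDiffOn ℝ (⊤ : ℕ∞) (g k) U)
    (hq0 : ∀ k ∈ s, ∀ x ∈ U, q k x ≠ 0)
    {φ : Vec n → ℝ} (hφ : ContDiffOn ℝ (⊤ : ℕ∞) φ U) (hh : ContDiffOn ℝ (⊤ : ℕ∞) h U)
    (h0 : ∀ x, x ∉ K → h x = 0) (τ A B : ℝ) 
    (hpt : ∀ x ∈ K, A * ∑ k ∈ s, (f k x ^ 2 + g k x ^ 2) * h x ^ 2 * Real.exp (τ * φ x) ^ 2 ≤ B +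
      ∑ k ∈ s, ((τ * cZ (p k) (q k) φ i k x - cN (p k) (q k) i k x) *
        ((f k x ^ 2 + g k x ^ 2) * h x ^ 2 * Real.exp (τ * φ x) ^ 2)
       - 2 * (Real.exp (τ * φ x))^2 * (h x ^ 2 * ((cX (p k) i k (f k) x - q k x * pd k (g k) x)^2
        + (cX (p k) i k (g k) x + q k x * pd k (f k) x)^2) + (f k x ^ 2 + g k x ^ 2) * cE (p k) (q k) h i k x))) :
    A * ∫ x, ∑ k ∈ s, (f k x ^ 2 + g k x ^ 2) * h x ^ 2 * Real.exp (τ * φ x) ^ 2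
      ≤ B * (volume K).toReal := by
  set F : Fin n → Vec n → ℝ := fun k x => Real.exp (τ * φ x) * (h x * f k x) with hF
  set G : Fin n → Vec n → ℝ := fun k x => Real.exp (τ * φ x) * (h x * g k x) with hG
  have sF : ∀ k, ContDiffOn ℝ (⊤ : ℕ∞) (F k) U := fun k =>
    (contDiffOn_const.mul hφ).exp.mul (hh.mul (hf k))
  have sG : ∀ k, ContDiffOn ℝ (⊤ : ℕ∞) (G k) U := fun k =>
    (contDiffOn_const.mul hφ).exp.mul (hh.mul (hg k))
  have F0 : ∀ k x, x ∉ K → F k x = 0 := fun k x hx => by simp [hF, h0 x hx]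
  have G0 : ∀ k x, x ∉ K → G k x = 0 := fun k x hx => by simp [hG, h0 x hx]
  have s1 : ∀ k, ContDiffOn ℝ (⊤ : ℕ∞) (cH1 (p k) (q k) φ (F k) (G k) i k τ) U := fun k =>
    ((hq k).mul (((sF k).mul (pd_smooth hU (sG k) i)).sub ((sG k).mul (pd_smooth hU (sF k) i)))).sub
      ((contDiffOn_const.mul (((hp k).mul ((pd_smooth hU hφ i).add ((hp k).mul (pd_smooth hU hφ k)))).add
        (((hq k).mul (hq k)).mul (pd_smooth hU hφ k)))).mul
        (((sF k).mul (sF k)).add ((sG k).mul (sG k))))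
  have s2 : ∀ k, ContDiffOn ℝ (⊤ : ℕ∞) (cH2 (p k) (q k) φ (F k) (G k) i k τ) U := fun k =>
    ((hq k).mul (((sG k).mul (pd_smooth hU (sF k) k)).sub ((sF k).mul (pd_smooth hU (sG k) k)))).sub
      ((contDiffOn_const.mul ((pd_smooth hU hφ i).add ((hp k).mul (pd_smooth hU hφ k)))).mul
        (((sF k).mul (sF k)).add ((sG k).mul (sG k))))
  have z1 : ∀ k x, x ∉ K → cH1 (p k) (q k) φ (F k) (G k) i k τ x = 0 := fun k x hx => by
    unfold cH1; rw [F0 k x hx, G0 k x hx]; ring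
  have z2 : ∀ k x, x ∉ K → cH2 (p k) (q k) φ (F k) (G k) i k τ x = 0 := fun k x hx => by
    unfold cH2; rw [F0 k x hx, G0 k x hx]; ring
  have i1 := fun k => pd_integral_zero hU (s1 k) hK hKU (z1 k) k
  have i2 := fun k => pd_integral_zero hU (s2 k) hK hKU (z2 k) i
  set V : Vec n → ℝ := fun x => ∑ k ∈ s, (f k x ^ 2 + g k x ^ 2) * h x ^ 2 * Real.exp (τ * φ x) ^ 2 with hV
  have V0 : ∀ x, x ∉ K → V x = 0 := fun x hx => by simp [hV, h0 x hx]
  have sV : ContDiffOn ℝ (⊤ : ℕ∞) V U := ContDiffOn.sum fun k _ =>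
    (((((hf k).pow 2).add ((hg k).pow 2)).mul (hh.pow 2)).mul ((contDiffOn_const.mul hφ).exp.pow 2))
  have cV := (contDiff_of_supp hU sV hK hKU V0).continuous
  have iV : Integrable V := cV.integrable_of_hasCompactSupport (HasCompactSupport.intro hK V0)
  have iB : Integrable (K.indicator fun _ => B) :=
    (integrable_indicator_iff hK.measurableSet).2 (integrableOn_const hK.measure_lt_top.ne)
  have pt : ∀ x, A * V x + ∑ k ∈ s, (pd k (cH1 (p k) (q k) φ (F k) (G k) i k τ) x
      + pd i (cH2 (p k) (q k) φ (F k) (G k) i k τ) x) ≤ K.indicator (fun _ => B) x := by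
    intro x
    by_cases hx : x ∈ K
    · rw [Set.indicator_of_mem hx]
      have a1 := hpt x hx
      have a2 := Finset.sum_le_sum fun k (hk : k ∈ s) => carleman_w hU (hKU hx) (hf k) (hg k) (hp k) (hq k)
        hφ hh (hq0 k hk x (hKU hx)) i k τ (F k) (G k) rfl rfl
      have e : ∀ k, F k x ^ 2 + G k x ^ 2 = (f k x ^ 2 + g k x ^ 2) * h x ^ 2 * Real.exp (τ * φ x) ^ 2 :=
        fun k => by simp only [hF, hG]; ring
      simp only [e] at a2
      rw [Finset.sum_add_distrib] at a2
      rw [Finset.sum_sub_distrib] at a1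
      change A * V x ≤ _ at a1
      linarith
    · rw [Set.indicator_of_notMem hx, V0 x hx]
      rw [Finset.sum_eq_zero]
      · simp
      · intro k _
        rw [pd_off hK (z1 k) hx, pd_off hK (z2 k) hx, add_zero]
  have iD : Integrable (fun x => ∑ k ∈ s, (pd k (cH1 (p k) (q k) φ (F k) (G k) i k τ) x
      + pd i (cH2 (p k) (q k) φ (F k) (G k) i k τ) x)) :=
    integrable_finsetSum _ fun k _ => (i1 k).1.add (i2 k).1
  have hint := integral_mono ((iV.const_mul A).add iD) iB pt
  simp only [Pi.add_apply] at hint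
  rw [integral_add (iV.const_mul A) iD, integral_const_mul, integral_finsetSum
    (f := fun k x => pd k (cH1 (p k) (q k) φ (F k) (G k) i k τ) x
      + pd i (cH2 (p k) (q k) φ (F k) (G k) i k τ) x) s
    (fun k _ => (i1 k).1.add (i2 k).1)] at hint
  have : ∀ k ∈ s, ∫ x, (pd k (cH1 (p k) (q k) φ (F k) (G k) i k τ) x
      + pd i (cH2 (p k) (q k) φ (F k) (G k) i k τ) x) = 0 := fun k _ => by
    rw [integral_add (i1 k).1 (i2 k).1, (i1 k).2, (i2 k).2, add_zero]
  rw [Finset.sum_eq_zero this, integral_indicator hK.measurableSet, setIntegral_const] at hint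
  simp only [smul_eq_mul, add_zero] at hint
  rw [mul_comm B]
  exact hint

lemma uc_abs (hU : IsOpen U) (hK : IsCompact K) (hKU : K ⊆ U)
    (hp : ∀ k, ContDiffOn ℝ (⊤ : ℕ∞) (p k) U) (hq : ∀ k, ContDiffOn ℝ (⊤ : ℕ∞) (q k) U)
    (hf : ∀ k, ContDiffOn ℝ (⊤ : ℕ∞) (f k) U) (hg : ∀ k, ContDiffOn ℝ (⊤ : ℕ∞) (g k) U)
    (hq0 : ∀ k ∈ s, ∀ x ∈ U, q k x ≠ 0) (hC : ContinuousOn C U)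
    (heq : ∀ x ∈ U, ∀ k ∈ s, (cX (p k) i k (f k) x - q k x * pd k (g k) x)^2
        + (cX (p k) i k (g k) x + q k x * pd k (f k) x)^2 ≤ C x * ∑ k ∈ s, (f k x ^ 2 + g k x ^ 2))
    (hψ : ContDiff ℝ (⊤ : ℕ∞) ψ) (hh : ContDiff ℝ (⊤ : ℕ∞) h)
    (h0 : ∀ x, x ∉ K → h x = 0)
    (hE : ∀ k ∈ s, ∀ x ∈ K, 0 < cE (p k) (q k) ψ i k x)
    (hsp : ∀ x ∈ K, c1 < ψ x → (∀ k ∈ s, f k x = 0 ∧ g k x = 0) ∨ ∀ j, pd j h x = 0)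
    {x : Vec n} (hx : c1 < ψ x) (hhx : h x ≠ 0) : ∀ k ∈ s, f k x = 0 ∧ g k x = 0 := by
  have hψU := hψ.contDiffOn (s := U)
  have hhU := hh.contDiffOn (s := U)
  -- continuity
  have cont : ∀ {u : Vec n → ℝ}, ContDiffOn ℝ (⊤ : ℕ∞) u U → ContinuousOn u K :=
    fun hu => hu.continuousOn.mono hKU
  have cE' : ∀ {ψ : Vec n → ℝ}, ContDiffOn ℝ (⊤ : ℕ∞) ψ U → ∀ k, ContinuousOn (cE (p k) (q k) ψ i k) K :=
    fun hψ k => cont ((((pd_smooth hU hψ i).add ((hp k).mul (pd_smooth hU hψ k))).pow 2).add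
      (((hq k).mul (pd_smooth hU hψ k)).pow 2))
  have cd : ∀ k ∈ s, ContDiffOn ℝ (⊤ : ℕ∞)
      (fun x => (pd i (q k) x + p k x * pd k (q k) x) / q k x) U := fun k hk =>
    ((pd_smooth hU (hq k) i).add ((hp k).mul (pd_smooth hU (hq k) k))).div (hq k) (hq0 k hk)
  have cN' : ∀ k ∈ s, ContinuousOn (cN (p k) (q k) i k) K := fun k hk =>
    cont (((((pd_smooth hU (hq k) k).pow 2).add ((cd k hk).pow 2))).div_const 4)
  have cZ' : ∀ k ∈ s, ContinuousOn (cZ (p k) (q k) ψ i k) K := fun k hk => by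
    refine cont ?_
    have d1 := pd_smooth hU hψU i
    have d2 := pd_smooth hU hψU k
    have e1 := pd_smooth hU (hp k) i
    have e2 := pd_smooth hU (hp k) k
    have e3 := pd_smooth hU (hq k) k
    exact ((((((pd_smooth hU d1 i).add ((contDiffOn_const.mul (hp k)).mul (pd_smooth hU d2 i))).add
      ((((hp k).pow 2).add ((hq k).pow 2)).mul (pd_smooth hU d2 k))).add
      (((e1.add ((contDiffOn_const.mul (hp k)).mul e2)).add ((contDiffOn_const.mul (hq k)).mul e3)).mul d2)).add
      (e2.mul d1)).sub ((e3.mul (hq k)).mul d2)).sub ((cd k hk).mul (d1.add ((hp k).mul d2)))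
  -- bounds
  obtain ⟨B1, B1p, hB1⟩ := bound_fam (s := s) hK (u := fun k x => (cE (p k) (q k) ψ i k x)⁻¹)
    (fun k hk => (cE' hψU k).inv₀ fun x hx => (hE k hk x hx).ne')
  obtain ⟨B2, B2p, hB2⟩ := bound_fam hK cZ'
  obtain ⟨γ, hγ⟩ : ∃ γ, γ = B1 * (B2 + 1) := ⟨_, rfl⟩
  have hγ1 : 1 ≤ γ := by rw [hγ]; nlinarith
  set φ : Vec n → ℝ := fun x => Real.exp (γ * ψ x) with hφd
  have hφ : ContDiff ℝ (⊤ : ℕ∞) φ := (contDiff_const.mul hψ).exp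
  have hφU := hφ.contDiffOn (s := U)
  obtain ⟨B3, B3p, hB3⟩ := bound_fam (s := s) hK (u := fun k x => (φ x)⁻¹)
    (fun k hk => (hφ.continuous.continuousOn).inv₀ fun x hx => (Real.exp_pos _).ne')
  obtain ⟨B4, B4p, hB4⟩ := bound_fam hK cN'
  obtain ⟨B5, B5p, hB5⟩ := bound_fam (s := s) hK (u := fun _ => C) fun _ _ => hC.mono hKU
  obtain ⟨B6, B6p, hB6⟩ := bound_fam (s := s) hK
    (u := fun k x => (f k x ^ 2 + g k x ^ 2) * cE (p k) (q k) h i k x)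
    (fun k _ => ((cont (hf k)).pow 2 |>.add ((cont (hg k)).pow 2)).mul (cE' hhU k))
  have hZ : ∀ k ∈ s, ∀ x ∈ K, B3⁻¹ ≤ cZ (p k) (q k) φ i k x := by
    intro k hk x hx
    rw [hφd, cZ_exp hψ]
    have a1 := hB1 k hk x hx
    have a2 := (abs_le.1 (hB2 k hk x hx)).1
    have a3 := hB3 k hk x hx
    have e0 := hE k hk x hx
    rw [abs_of_pos (inv_pos.2 e0)] at a1
    have e1 : B1⁻¹ ≤ cE (p k) (q k) ψ i k x := inv_le_of_inv_le₀ e0 a1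
    rw [abs_of_pos (inv_pos.2 (Real.exp_pos _))] at a3
    have e3 : B3⁻¹ ≤ φ x := inv_le_of_inv_le₀ (Real.exp_pos _) a3
    have e4 : γ ^ 2 * B1⁻¹ = γ * (B2 + 1) := by
      have : B1 ≠ 0 := by positivity
      rw [hγ]; field_simp
    have e5 : γ ^ 2 * B1⁻¹ ≤ γ ^ 2 * cE (p k) (q k) ψ i k x :=
      mul_le_mul_of_nonneg_left e1 (by positivity)
    have e6 : 1 ≤ γ ^ 2 * cE (p k) (q k) ψ i k x + γ * cZ (p k) (q k) ψ i k x := by nlinarith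
    exact e3.trans (le_mul_of_one_le_right (Real.exp_pos _).le e6)
  set c : ℝ := (s.card : ℝ) with hc
  have hc0 : 0 ≤ c := by positivity
  set φ1 : ℝ := Real.exp (γ * c1) with hφ1
  have main : ∀ τ : ℝ, 0 ≤ τ →
      (τ * B3⁻¹ - (B4 + 2 * c * B5)) * ∫ x, ∑ k ∈ s, (f k x ^ 2 + g k x ^ 2) * h x ^ 2 * Real.exp (τ * φ x) ^ 2
      ≤ (2 * Real.exp (τ * φ1) ^ 2 * (c * B6)) * (volume K).toReal := by
    intro τ hτ
    refine uc_int hU hK hKU hp hq hf hg hq0 hφU hhU h0 τ _ _ ?_ (i := i)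
    intro x hx
    have hxU := hKU hx
    obtain ⟨e, he⟩ : ∃ e, e = Real.exp (τ * φ x) ^ 2 := ⟨_, rfl⟩
    have hepos : 0 < e := by rw [he]; positivity
    obtain ⟨S, hS⟩ : ∃ S, S = ∑ k ∈ s, (f k x ^ 2 + g k x ^ 2) := ⟨_, rfl⟩
    have hS0 : 0 ≤ S := by rw [hS]; exact Finset.sum_nonneg fun k _ => by positivity
    have key : ∀ k ∈ s, (τ * B3⁻¹ - B4) * (f k x ^ 2 + g k x ^ 2) * (h x ^ 2 * e)
        - 2 * h x ^ 2 * e * (B5 * S) - 2 * Real.exp (τ * φ1) ^ 2 * B6 ≤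
      (τ * cZ (p k) (q k) φ i k x - cN (p k) (q k) i k x) *
        ((f k x ^ 2 + g k x ^ 2) * h x ^ 2 * e)
       - 2 * e * (h x ^ 2 * ((cX (p k) i k (f k) x - q k x * pd k (g k) x)^2
        + (cX (p k) i k (g k) x + q k x * pd k (f k) x)^2) + (f k x ^ 2 + g k x ^ 2) * cE (p k) (q k) h i k x) := by
      intro k hk
      have a1 : τ * B3⁻¹ - B4 ≤ τ * cZ (p k) (q k) φ i k x - cN (p k) (q k) i k x := by
        have := mul_le_mul_of_nonneg_left (hZ k hk x hx) hτ
        have := (abs_le.1 (hB4 k hk x hx)).2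
        linarith
      have a2 := mul_le_mul_of_nonneg_right a1
        (show 0 ≤ (f k x ^ 2 + g k x ^ 2) * h x ^ 2 * e by positivity)
      have a3 := heq x hxU k hk
      rw [← hS] at a3
      have a4 : C x * S ≤ B5 * S := mul_le_mul_of_nonneg_right (abs_le.1 (hB5 k hk x hx)).2 hS0
      have a5 := mul_le_mul_of_nonneg_left (a3.trans a4) (show 0 ≤ 2 * h x ^ 2 * e by positivity)
      have a6 : e * ((f k x ^ 2 + g k x ^ 2) * cE (p k) (q k) h i k x) ≤ Real.exp (τ * φ1) ^ 2 * B6 := by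
        have b1 := (abs_le.1 (hB6 k hk x hx)).2
        have b0 : 0 ≤ (f k x ^ 2 + g k x ^ 2) * cE (p k) (q k) h i k x := by unfold cE; positivity
        by_cases hcx : c1 < ψ x
        · have : (f k x ^ 2 + g k x ^ 2) * cE (p k) (q k) h i k x = 0 := by
            rcases hsp x hx hcx with h1 | h1
            · rw [(h1 k hk).1, (h1 k hk).2]; ring
            · unfold cE cX; rw [h1, h1]; ring
          rw [this, mul_zero]; positivity
        · refine mul_le_mul ?_ b1 b0 (by positivity)
          rw [he]
          have : φ x ≤ φ1 := Real.exp_le_exp.2 (mul_le_mul_of_nonneg_left (not_lt.1 hcx) (by linarith))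
          have : Real.exp (τ * φ x) ≤ Real.exp (τ * φ1) :=
            Real.exp_le_exp.2 (mul_le_mul_of_nonneg_left this hτ)
          exact pow_le_pow_left₀ (Real.exp_pos _).le this 2
      linarith
    have := Finset.sum_le_sum key
    rw [Finset.sum_sub_distrib, Finset.sum_sub_distrib, ← Finset.sum_mul, ← Finset.mul_sum, ← hS] at this
    simp only [Finset.sum_const, nsmul_eq_mul, ← hc] at this
    rw [← he, ← Finset.sum_mul, ← Finset.sum_mul, ← hS]
    linarith
  -- conclude
  set W : Vec n → ℝ := fun x => max (φ x - φ1) 0 * ∑ k ∈ s, (f k x ^ 2 + g k x ^ 2) * h x ^ 2 with hW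
  set V : Vec n → ℝ := fun x => ∑ k ∈ s, (f k x ^ 2 + g k x ^ 2) * h x ^ 2 with hV
  have V0 : ∀ x, x ∉ K → V x = 0 := fun x hx => by simp [hV, h0 x hx]
  have sV : ContDiffOn ℝ (⊤ : ℕ∞) V U := ContDiffOn.sum fun k _ =>
    ((((hf k).pow 2).add ((hg k).pow 2)).mul (hhU.pow 2))
  have cV := (contDiff_of_supp hU sV hK hKU V0).continuous
  have Vn : ∀ x, 0 ≤ V x := fun x => Finset.sum_nonneg fun k _ => by positivity
  have cW : Continuous W := ((hφ.continuous.sub continuous_const).max continuous_const).mul cV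
  have W0 : ∀ x, x ∉ K → W x = 0 := fun x hx => by
    change max (φ x - φ1) 0 * V x = 0
    rw [V0 x hx, mul_zero]
  have Wn : ∀ x, 0 ≤ W x := fun x => mul_nonneg (le_max_right _ _) (Vn x)
  have csW := HasCompactSupport.intro hK W0
  have lo : ∀ τ : ℝ, 1 ≤ τ → Real.exp (τ * φ1) ^ 2 * ∫ x, W x ≤
      ∫ x, ∑ k ∈ s, (f k x ^ 2 + g k x ^ 2) * h x ^ 2 * Real.exp (τ * φ x) ^ 2 := by
    intro τ hτ
    rw [← integral_const_mul]
    have ee : ∀ x, ∑ k ∈ s, (f k x ^ 2 + g k x ^ 2) * h x ^ 2 * Real.exp (τ * φ x) ^ 2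
        = V x * Real.exp (τ * φ x) ^ 2 := fun x => by rw [hV, Finset.sum_mul]
    simp only [ee]
    refine integral_mono ((cW.integrable_of_hasCompactSupport csW).const_mul _) ?_ ?_
    · refine Continuous.integrable_of_hasCompactSupport
        (cV.mul ((continuous_const.mul hφ.continuous).rexp.pow 2)) (HasCompactSupport.intro hK ?_)
      intro x hx; simp [V0 x hx]
    · intro x
      change Real.exp (τ * φ1) ^ 2 * (max (φ x - φ1) 0 * V x) ≤ V x * Real.exp (τ * φ x) ^ 2
      have : Real.exp (τ * φ1) ^ 2 * max (φ x - φ1) 0 ≤ Real.exp (τ * φ x) ^ 2 := by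
        have e1 : Real.exp (τ * φ x) ^ 2 = Real.exp (τ * φ1) ^ 2 * Real.exp (2 * τ * (φ x - φ1)) := by
          rw [← Real.exp_nat_mul, ← Real.exp_nat_mul, ← Real.exp_add]; congr 1; push_cast; ring
        rw [e1]
        refine mul_le_mul_of_nonneg_left (max_le ?_ (Real.exp_pos _).le) (by positivity)
        rcases le_or_gt (φ x - φ1) 0 with hd | hd
        · exact hd.trans (Real.exp_pos _).le
        · have := Real.add_one_le_exp (2 * τ * (φ x - φ1))
          nlinarith
      nlinarith [mul_le_mul_of_nonneg_right this (Vn x)]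
  have Wint : ∫ x, W x = 0 := by
    have I0 : 0 ≤ ∫ x, W x := integral_nonneg Wn
    by_contra hne
    have I1 : 0 < ∫ x, W x := lt_of_le_of_ne I0 (Ne.symm hne)
    obtain ⟨I, hI⟩ : ∃ I, I = ∫ x, W x := ⟨_, rfl⟩
    rw [← hI] at I1
    obtain ⟨vK, hvK⟩ : ∃ v, v = (volume K).toReal := ⟨_, rfl⟩
    have fin : ∀ τ : ℝ, 1 ≤ τ → 0 ≤ τ * B3⁻¹ - (B4 + 2 * c * B5) →
        (τ * B3⁻¹ - (B4 + 2 * c * B5)) * I ≤ 2 * (c * B6) * vK := by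
      intro τ h1 h2
      have m := main τ (by linarith)
      have l := mul_le_mul_of_nonneg_left (lo τ h1) h2
      rw [← hI] at l
      rw [← hvK] at m
      have ep : 0 < Real.exp (τ * φ1) ^ 2 := by positivity
      have := l.trans m
      refine le_of_mul_le_mul_left ?_ ep
      linarith
    have B3pos : 0 < B3 := by linarith
    have hcB : 0 ≤ c * B5 := mul_nonneg hc0 (by linarith)
    have hcB6 : 0 ≤ c * B6 := mul_nonneg hc0 (by linarith)
    have hv0 : 0 ≤ vK := by rw [hvK]; positivity
    obtain ⟨D, hD⟩ : ∃ D, D = (2 * (c * B6) * vK + 1) / I := ⟨_, rfl⟩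
    have hD0 : 0 ≤ D := by rw [hD]; positivity
    have hDI : D * I = 2 * (c * B6) * vK + 1 := by rw [hD]; field_simp
    have ht : (B3 * (B4 + 2 * c * B5 + D)) * B3⁻¹ - (B4 + 2 * c * B5) = D := by field_simp; ring
    have := fin (B3 * (B4 + 2 * c * B5 + D)) (by nlinarith) (by rw [ht]; exact hD0)
    rw [ht, hDI] at this
    linarith
  have Wx : W x = 0 := by
    by_contra hne
    have := cW.integral_pos_of_hasCompactSupport_nonneg_nonzero (μ := volume) csW Wn hne
    linarith
  have hmax : 0 < max (φ x - φ1) 0 := lt_max_of_lt_left (sub_pos.2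
    (Real.exp_lt_exp.2 (mul_lt_mul_of_pos_left hx (by linarith))))
  have Vx : V x = 0 := (mul_eq_zero.1 Wx).resolve_left hmax.ne'
  intro k hk
  have := (Finset.sum_eq_zero_iff_of_nonneg (fun k _ => by positivity)).1 Vx k hk
  have h2 : f k x ^ 2 + g k x ^ 2 = 0 := (mul_eq_zero.1 this).resolve_right (pow_ne_zero 2 hhx)
  constructor
  · exact pow_eq_zero_iff (two_ne_zero) |>.1 (by nlinarith [sq_nonneg (f k x), sq_nonneg (g k x)])
  · exact pow_eq_zero_iff (two_ne_zero) |>.1 (by nlinarith [sq_nonneg (f k x), sq_nonneg (g k x)])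
end uc
end

noncomputable section

section step
variable {n : ℕ} {U : Set (Vec n)} {p q f g : Fin n → Vec n → ℝ}
  {s : Finset (Fin n)} {i : Fin n} {C : Vec n → ℝ}

def psi0 (i : Fin n) (o : Vec n) (ε Kc : ℝ) (x : Vec n) : ℝ :=
  ε * (x i - o i) + Kc * ∑ k ∈ Finset.univ.erase i, (x k - o k) ^ 2

lemma psi0_smooth (i : Fin n) (o : Vec n) (ε Kc : ℝ) : ContDiff ℝ (⊤ : ℕ∞) (psi0 i o ε Kc) := by
  unfold psi0; fun_prop

lemma psi0_pd (i : Fin n) (o : Vec n) (ε Kc : ℝ) (x : Vec n) :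
    pd i (fun x => - psi0 i o ε Kc x) x = - ε := by
  unfold pd psi0
  have h1 : HasFDerivAt (fun x : Vec n => x i)
    (ContinuousLinearMap.proj (R := ℝ) (φ := fun _ : Fin n => ℝ) i) x := hasFDerivAt_apply i x
  have h2 : HasFDerivAt (fun x : Vec n => ∑ k ∈ Finset.univ.erase i, (x k - o k) ^ 2)
      (∑ k ∈ Finset.univ.erase i, ((2 : ℕ) • (x k - o k) ^ (2-1)) •
        ContinuousLinearMap.proj (R := ℝ) (φ := fun _ : Fin n => ℝ) k) x := by
    refine HasFDerivAt.fun_sum fun k _ => ?_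
    exact ((hasFDerivAt_apply k x).sub_const (o k)).pow 2
  have h3 := (((h1.sub_const (o i)).const_mul ε).add (h2.const_mul Kc)).neg
  have h4 := h3.fderiv
  change fderiv ℝ (fun x => -(ε * (x i - o i) + Kc * ∑ k ∈ Finset.univ.erase i, (x k - o k) ^ 2)) x = _ at h4
  rw [h4]
  simp only [ContinuousLinearMap.neg_apply, ContinuousLinearMap.add_apply,
    ContinuousLinearMap.smul_apply, ContinuousLinearMap.sum_apply, ContinuousLinearMap.proj_apply]
  rw [Finset.sum_eq_zero]
  · simp
  · intro k hk
    simp [Finset.ne_of_mem_erase hk]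

lemma cE_pos {p q ψ : Vec n → ℝ} {i k : Fin n} {x : Vec n} (hq : q x ≠ 0) (h : pd i ψ x ≠ 0) :
    0 < cE p q ψ i k x := by
  unfold cE cX
  by_cases h2 : pd k ψ x = 0
  · rw [h2]; simp; positivity
  · have : 0 < (q x * pd k ψ x) ^ 2 := by positivity
    have := sq_nonneg (pd i ψ x + p x * pd k ψ x)
    linarith

lemma uc_step (hU : IsOpen U)
    (hp : ∀ k, ContDiffOn ℝ (⊤ : ℕ∞) (p k) U) (hq : ∀ k, ContDiffOn ℝ (⊤ : ℕ∞) (q k) U)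
    (hf : ∀ k, ContDiffOn ℝ (⊤ : ℕ∞) (f k) U) (hg : ∀ k, ContDiffOn ℝ (⊤ : ℕ∞) (g k) U)
    (hq0 : ∀ k ∈ s, ∀ x ∈ U, q k x ≠ 0) (hC : ContinuousOn C U)
    (heq : ∀ x ∈ U, ∀ k ∈ s, (cX (p k) i k (f k) x - q k x * pd k (g k) x)^2
        + (cX (p k) i k (g k) x + q k x * pd k (f k) x)^2 ≤ C x * ∑ k ∈ s, (f k x ^ 2 + g k x ^ 2))
    {o : Vec n} {ε δ R t : ℝ} (hε : |ε| = 1) (hδ : 0 < δ) (ht : 0 ≤ t) (htR : t < R)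
    (hz : ∀ x, dist x o < δ → ∀ k ∈ s, f k x = 0 ∧ g k x = 0)
    (hbox : ∀ x : Vec n, -(δ/2) ≤ ε * (x i - o i) → ε * (x i - o i) ≤ R →
      (∀ k, k ≠ i → |x k - o k| ≤ δ/2) → x ∈ U) :
    ∀ k ∈ s, f k (o + Pi.single i (ε * t)) = 0 ∧ g k (o + Pi.single i (ε * t)) = 0 := by
  obtain ⟨Kc, hKc⟩ : ∃ Kc, Kc = (R + δ/2) / (δ/2)^2 := ⟨_, rfl⟩
  have hRpos : 0 < R := by linarith
  have hKpos : 0 < Kc := by rw [hKc]; positivity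
  have hKe : Kc * (δ/2)^2 = R + δ/2 := by rw [hKc]; field_simp
  have hεε : ε * ε = 1 := by rw [← abs_mul_abs_self, hε]; norm_num
  have hε0 : ε ≠ 0 := by intro h; rw [h] at hεε; norm_num at hεε
  have hab : ∀ z : ℝ, |z| = |ε * z| := fun z => by rw [abs_mul, hε, one_mul]
  obtain ⟨s1, hs1⟩ : ∃ s1, s1 = (t + R)/2 := ⟨_, rfl⟩
  have hts : t < s1 := by linarith
  have hsR : s1 < R := by linarith
  set ρ := psi0 i o ε Kc with hρ
  have hρs := psi0_smooth i o ε Kc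
  have hρc : Continuous ρ := hρs.continuous
  have hsum : ∀ x : Vec n, 0 ≤ ∑ k ∈ Finset.univ.erase i, (x k - o k) ^ 2 :=
    fun x => Finset.sum_nonneg fun k _ => sq_nonneg _
  set K : Set (Vec n) := {x | -(δ/2) ≤ ε * (x i - o i) ∧ ρ x ≤ R} with hK
  have hKle : ∀ x ∈ K, ε * (x i - o i) ≤ R := fun x hx => by
    have h1 : ε * (x i - o i) + Kc * _ ≤ R := hx.2
    have := mul_nonneg hKpos.le (hsum x)
    linarith
  have hKlat : ∀ x ∈ K, ∀ k, k ≠ i → |x k - o k| ≤ δ/2 := by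
    intro x hx k hk
    have h1 : ε * (x i - o i) + Kc * ∑ k ∈ Finset.univ.erase i, (x k - o k) ^ 2 ≤ R := hx.2
    have h2 : (x k - o k)^2 ≤ ∑ k ∈ Finset.univ.erase i, (x k - o k) ^ 2 :=
      Finset.single_le_sum (f := fun k => (x k - o k)^2) (fun _ _ => sq_nonneg _)
        (Finset.mem_erase.2 ⟨hk, Finset.mem_univ k⟩)
    have h3 := hx.1
    have h4 : Kc * (x k - o k)^2 ≤ Kc * (δ/2)^2 := by
      rw [hKe]; have := mul_le_mul_of_nonneg_left h2 hKpos.le; linarith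
    exact abs_le_of_sq_le_sq (le_of_mul_le_mul_left h4 hKpos) (by positivity)
  have hKclosed : IsClosed K := by
    refine IsClosed.inter ?_ ?_
    · exact isClosed_le (f := fun _ : Vec n => -(δ/2)) (g := fun x : Vec n => ε * (x i - o i))
        continuous_const (by fun_prop)
    · exact isClosed_le hρc continuous_const
  have hKc' : IsCompact K := by
    refine (isCompact_closedBall o (R + δ)).of_isClosed_subset hKclosed ?_
    intro x hx
    rw [Metric.mem_closedBall, dist_pi_le_iff (by positivity)]
    intro k
    rw [Real.dist_eq]
    by_cases hk : k = i
    · subst hk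
      rw [hab, abs_le]
      exact ⟨by linarith [hx.1], by linarith [hKle x hx]⟩
    · linarith [hKlat x hx k hk]
  have hKU : K ⊆ U := fun x hx => hbox x hx.1 (hKle x hx) (hKlat x hx)
  set h : Vec n → ℝ := fun x => Real.smoothTransition ((2/δ) * (ε * (x i - o i)) + 1) *
    Real.smoothTransition ((R - ρ x) / (R - s1)) with hh
  have sh : ContDiff ℝ (⊤ : ℕ∞) h := by
    refine (Real.smoothTransition.contDiff.comp (by fun_prop)).mul (Real.smoothTransition.contDiff.comp ?_)
    exact (contDiff_const.sub hρs).div_const _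
  have h0 : ∀ x, x ∉ K → h x = 0 := by
    intro x hx
    by_cases h1 : -(δ/2) ≤ ε * (x i - o i)
    · have h2 : R < ρ x := by by_contra h2; exact hx ⟨h1, not_lt.1 h2⟩
      have : Real.smoothTransition ((R - ρ x) / (R - s1)) = 0 :=
        Real.smoothTransition.zero_of_nonpos (div_nonpos_of_nonpos_of_nonneg (by linarith) (by linarith))
      simp [hh, this]
    · have : Real.smoothTransition ((2/δ) * (ε * (x i - o i)) + 1) = 0 := by
        refine Real.smoothTransition.zero_of_nonpos ?_
        have h2 : (2/δ) * (ε * (x i - o i)) ≤ (2/δ) * (-(δ/2)) :=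
          mul_le_mul_of_nonneg_left (not_le.1 h1).le (by positivity)
        have h3 : (2/δ) * (-(δ/2)) = -1 := by field_simp
        linarith
      simp [hh, this]
  have hone : ∀ x, 0 ≤ ε * (x i - o i) → ρ x ≤ s1 → h x = 1 := by
    intro x h1 h2
    have a1 : Real.smoothTransition ((2/δ) * (ε * (x i - o i)) + 1) = 1 :=
      Real.smoothTransition.one_of_one_le (by
        have : 0 ≤ (2/δ) * (ε * (x i - o i)) := by positivity
        linarith)
    have a2 : Real.smoothTransition ((R - ρ x) / (R - s1)) = 1 :=
      Real.smoothTransition.one_of_one_le (by rw [le_div_iff₀ (by linarith)]; linarith)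
    simp [hh, a1, a2]
  have hρt : ρ (o + Pi.single i (ε * t)) = t := by
    change ε * _ + Kc * _ = t
    rw [Finset.sum_eq_zero]
    · simp [← mul_assoc, hεε]
    · intro k hk; simp [Finset.ne_of_mem_erase hk]
  refine uc_abs (K := K) (C := C) (i := i) (ψ := fun x => - ρ x) (h := h) (c1 := -s1)
    hU hKc' hKU hp hq hf hg hq0 hC heq hρs.neg sh h0 ?_ ?_ ?_ ?_
  · intro k hk x hx
    refine cE_pos (hq0 k hk x (hKU hx)) ?_
    rw [psi0_pd]; exact neg_ne_zero.2 hε0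
  · intro x hx hc
    have hc' : ρ x < s1 := by linarith
    by_cases h1 : 0 < ε * (x i - o i)
    · right
      intro j
      have : h =ᶠ[nhds x] fun _ => 1 := by
        have o1 : ∀ᶠ z in nhds x, 0 < ε * (z i - o i) :=
          (isOpen_lt continuous_const (by fun_prop)).mem_nhds h1
        have o2 : ∀ᶠ z in nhds x, ρ z < s1 := (isOpen_lt hρc continuous_const).mem_nhds hc'
        filter_upwards [o1, o2] with z z1 z2
        exact hone z z1.le z2.le
      unfold pd; rw [this.fderiv_eq]; simp
    · left
      refine hz x ?_
      rw [dist_pi_lt_iff hδ]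
      intro k
      rw [Real.dist_eq]
      by_cases hk : k = i
      · subst hk
        rw [hab, abs_lt]
        exact ⟨by linarith [hx.1], by linarith⟩
      · linarith [hKlat x hx k hk]
  · rw [hρt]; linarith
  · rw [hone _ ?_ (by rw [hρt]; exact hts.le)]
    · norm_num
    · simp [← mul_assoc, hεε, ht]
end step
end

noncomputable section

def IsOb {n : ℕ} (U : Set (Vec n)) (b : Vec n → Vec n) (u : Vec n → ℝ) : Prop :=
  ∃ d : Fin n → Vec n → ℝ, (∀ j, ContinuousOn (d j) U) ∧ ∀ x ∈ U, u x = ∑ j, b x j * d j x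

section ob
variable {n : ℕ} {U : Set (Vec n)} {a : Vec n → Matrix (Fin n) (Fin n) ℝ} {b : Vec n → Vec n}
  {u v c : Vec n → ℝ}

lemma IsOb.add (hu : IsOb U b u) (hv : IsOb U b v) : IsOb U b (fun x => u x + v x) := by
  obtain ⟨d, hd, h1⟩ := hu
  obtain ⟨e, he, h2⟩ := hv
  refine ⟨fun j x => d j x + e j x, fun j => (hd j).add (he j), fun x hx => ?_⟩
  simp only [h1 x hx, h2 x hx, mul_add, Finset.sum_add_distrib]

lemma IsOb.smul (hu : IsOb U b u) (hc : ContinuousOn c U) : IsOb U b (fun x => c x * u x) := by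
  obtain ⟨d, hd, h1⟩ := hu
  refine ⟨fun j x => c x * d j x, fun j => hc.mul (hd j), fun x hx => ?_⟩
  simp only [h1 x hx, Finset.mul_sum]
  exact Finset.sum_congr rfl fun j _ => by ring

lemma IsOb.coord (k : Fin n) : IsOb U b (fun x => b x k) :=
  ⟨fun j _ => if j = k then 1 else 0, fun j => continuousOn_const, fun x _ => by simp⟩

lemma IsOb.congr (hu : IsOb U b u) (huv : ∀ x ∈ U, v x = u x) : IsOb U b v := by
  obtain ⟨d, hd, h1⟩ := hu
  exact ⟨d, hd, fun x hx => by rw [huv x hx, h1 x hx]⟩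

lemma Sm.contx {f : Vec n → Vec n → ℝ} (hf : Sm U f) {y : Vec n} (hy : y ≠ 0) :
    ContinuousOn (fun x => f x y) U :=
  ContinuousOn.comp (g := fun p : Vec n × Vec n => f p.1 p.2) (f := fun x => (x, y))
    (ContDiffOn.continuousOn hf) (by fun_prop) (fun x hx => ⟨hx, hy⟩)

variable (h : RD U a b) {lam : Vec n → ℝ} (hlam : ContinuousOn lam U)
  (hS : ∀ x ∈ U, ∀ y : Vec n, y ≠ 0 → SCurv (RF a b) x y = ((n:ℝ)+1) * lam x * RF a b x y)
include h hlam hS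

lemma ob_quad {y : Vec n} (hy : y ≠ 0) : IsOb U b (fun x => ∑ m, B1 b m x y * y m
    - 2 * lam x * ∑ i, ∑ j, a x i j * y i * y j) := by
  refine ⟨fun j x => 2 * Ga a j x y - 2 * lam x * rbeta b x y * y j - 2 * rbeta b x y * sU a b j x y,
    fun j => ?_, fun x hx => ?_⟩
  · have h1 := ((Ga_PO h j).sm h).contx hy
    have h2 := ((sU_PO h j).sm h).contx hy
    have h3 := h.be_sm.contx hy
    fun_prop
  · have h1 := iso_r00 h hx hy (lam x) (hS x hx)
    have h2 : ralpha a x y ^ 2 = ∑ i, ∑ j, a x i j * y i * y j := Real.sq_sqrt (h.Qpos hx hy).le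
    rw [h2] at h1
    have h3 : ∑ j, b x j * (2 * Ga a j x y - 2 * lam x * rbeta b x y * y j - 2 * rbeta b x y * sU a b j x y)
        = 2 * ∑ j, b x j * Ga a j x y - 2 * lam x * rbeta b x y * rbeta b x y
          - 2 * rbeta b x y * ss a b x y := by
      rw [show (2 * lam x * rbeta b x y * rbeta b x y) = ∑ j, 2 * lam x * rbeta b x y * (b x j * y j) by
        rw [← Finset.mul_sum]; rfl, ss, Finset.mul_sum, Finset.mul_sum, ← Finset.sum_sub_distrib,
        ← Finset.sum_sub_distrib]
      exact Finset.sum_congr rfl fun j _ => by ring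
    rw [h3]
    unfold r00 at h1
    linarith

lemma ob_diag (i : Fin n) : IsOb U b (fun x => pd i (fun x => b x i) x - 2 * lam x * a x i i) := by
  have := ob_quad h hlam hS (y := Pi.single i 1) (by simp)
  refine this.congr fun x hx => ?_
  simp [B1, Pi.single_apply]

lemma ob_off {i k : Fin n} (hik : k ≠ i) :
    IsOb U b (fun x => pd i (fun x => b x k) x + pd k (fun x => b x i) x - 4 * lam x * a x i k) := by
  have hy : (Pi.single i 1 + Pi.single k 1 : Vec n) ≠ 0 := by
    intro h0
    have := congrFun h0 i
    simp [hik.symm] at this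
  have h1 := ob_quad h hlam hS hy
  have h2 := (ob_diag h hlam hS i).add (ob_diag h hlam hS k)
  refine (h1.add (h2.smul (continuousOn_const (c := (-1:ℝ))))).congr fun x hx => ?_
  have := h.symm x hx i k
  simp [B1, Pi.single_apply, mul_add, add_mul, Finset.sum_add_distrib]
  rw [h.symm x hx k i]
  ring
end ob

section pq
variable {n : ℕ} {U : Set (Vec n)} {a : Vec n → Matrix (Fin n) (Fin n) ℝ} {b : Vec n → Vec n}

def cp (a : Vec n → Matrix (Fin n) (Fin n) ℝ) (i k : Fin n) (x : Vec n) : ℝ := - a x i k / a x k k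
def cdd (a : Vec n → Matrix (Fin n) (Fin n) ℝ) (i k : Fin n) (x : Vec n) : ℝ :=
  if k = i then 1 else a x i i * a x k k - a x i k ^ 2
def cq (a : Vec n → Matrix (Fin n) (Fin n) ℝ) (i k : Fin n) (x : Vec n) : ℝ :=
  Real.sqrt (cdd a i k x) / a x k k

variable (h : RD U a b)
include h
lemma akk_pos {x : Vec n} (hx : x ∈ U) (k : Fin n) : 0 < a x k k := by
  have := h.Qpos hx (y := Pi.single k 1) (by simp)
  simpa [Pi.single_apply] using this

lemma cdd_pos {x : Vec n} (hx : x ∈ U) (i k : Fin n) : 0 < cdd a i k x := by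
  unfold cdd
  split_ifs with hk
  · exact one_pos
  · have ha := akk_pos h hx k
    have hy : (Pi.single i (a x k k) + Pi.single k (- a x i k) : Vec n) ≠ 0 := by
      intro h0
      have := congrFun h0 i
      simp [Ne.symm hk, ha.ne'] at this
    have h1 := h.Qpos hx hy
    have h2 : ∑ u, ∑ v, a x u v * (Pi.single i (a x k k) + Pi.single k (- a x i k) : Vec n) u
        * (Pi.single i (a x k k) + Pi.single k (- a x i k) : Vec n) v
        = a x k k * (a x i i * a x k k - a x i k ^ 2) := by
      simp [Pi.single_apply, mul_add, add_mul, Finset.sum_add_distrib]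
      rw [h.symm x hx k i]
      ring
    rw [h2] at h1
    exact (mul_pos_iff_of_pos_left ha).1 h1

lemma cp_sm (i k : Fin n) : ContDiffOn ℝ (⊤ : ℕ∞) (cp a i k) U :=
  ((h.sa i k).neg).div (h.sa k k) fun x hx => (akk_pos h hx k).ne'

lemma cdd_sm (i k : Fin n) : ContDiffOn ℝ (⊤ : ℕ∞) (cdd a i k) U := by
  unfold cdd
  split_ifs with hk
  · exact contDiffOn_const
  · exact ((h.sa i i).mul (h.sa k k)).sub ((h.sa i k).pow 2)

lemma cq_sm (i k : Fin n) : ContDiffOn ℝ (⊤ : ℕ∞) (cq a i k) U :=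
  ((cdd_sm h i k).sqrt fun x hx => (cdd_pos h hx i k).ne').div (h.sa k k)
    fun x hx => (akk_pos h hx k).ne'

lemma cq_pos {x : Vec n} (hx : x ∈ U) (i k : Fin n) : 0 < cq a i k x :=
  div_pos (Real.sqrt_pos.2 (cdd_pos h hx i k)) (akk_pos h hx k)

lemma pq_one {x : Vec n} (hx : x ∈ U) {i k : Fin n} :
    a x i k + cp a i k x * a x k k = 0 := by
  have := akk_pos h hx k
  unfold cp; field_simp; ring

lemma pq_two {x : Vec n} (hx : x ∈ U) {i k : Fin n} (hik : k ≠ i) :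
    a x i i + 2 * cp a i k x * a x i k + (cp a i k x ^ 2 - cq a i k x ^ 2) * a x k k = 0 := by
  have := akk_pos h hx k
  unfold cp cq
  rw [div_pow, div_pow, Real.sq_sqrt (cdd_pos h hx i k).le, cdd, if_neg hik]
  field_simp; ring
end pq
end

noncomputable section
section app
variable {n : ℕ} {U : Set (Vec n)} {a : Vec n → Matrix (Fin n) (Fin n) ℝ} {b : Vec n → Vec n}

def cf (a : Vec n → Matrix (Fin n) (Fin n) ℝ) (b : Vec n → Vec n) (i k : Fin n) (x : Vec n) : ℝ :=
  b x i + cp a i k x * b x k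
def cg (a : Vec n → Matrix (Fin n) (Fin n) ℝ) (b : Vec n → Vec n) (i k : Fin n) (x : Vec n) : ℝ :=
  cq a i k x * b x k

variable (h : RD U a b) {lam : Vec n → ℝ} (hlam : ContinuousOn lam U)
  (hS : ∀ x ∈ U, ∀ y : Vec n, y ≠ 0 → SCurv (RF a b) x y = ((n:ℝ)+1) * lam x * RF a b x y)
include h

lemma cf_hp {x : Vec n} (hx : x ∈ U) (i k : Fin n) : HP x (cf a b i k) (fun j =>
    pd j (fun x => b x i) x + (pd j (cp a i k) x * b x k + cp a i k x * pd j (fun x => b x k) x)) :=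
  (HP.of h.op (h.sb i) hx).add ((HP.of h.op (cp_sm h i k) hx).mul (HP.of h.op (h.sb k) hx))

lemma cg_hp {x : Vec n} (hx : x ∈ U) (i k : Fin n) : HP x (cg a b i k) (fun j =>
    (pd j (cq a i k) x * b x k + cq a i k x * pd j (fun x => b x k) x)) :=
  (HP.of h.op (cq_sm h i k) hx).mul (HP.of h.op (h.sb k) hx)

include hlam hS

lemma ob_L1 {i k : Fin n} (hik : k ≠ i) : IsOb U b (fun x =>
    cX (cp a i k) i k (cf a b i k) x - cq a i k x * pd k (cg a b i k) x) := by
  have P := (cp_sm h i k).continuousOn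
  have Q := (cq_sm h i k).continuousOn
  have P1 := (pd_smooth h.op (cp_sm h i k) i).continuousOn
  have Pk := (pd_smooth h.op (cp_sm h i k) k).continuousOn
  have Qk := (pd_smooth h.op (cq_sm h i k) k).continuousOn
  refine ((((ob_diag h hlam hS i).add ((ob_off h hlam hS hik).smul P)).add
    ((ob_diag h hlam hS k).smul ((P.mul P).sub (Q.mul Q)))).add
    ((IsOb.coord k).smul ((P1.add (P.mul Pk)).sub (Q.mul Qk)))).congr fun x hx => ?_
  unfold cX
  rw [(cf_hp h hx i k).2, (cf_hp h hx i k).2, (cg_hp h hx i k).2]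
  simp only [Pi.add_apply, Pi.mul_apply, Pi.sub_apply]
  linear_combination (2 * lam x) * pq_two h hx hik

lemma ob_L2 {i k : Fin n} (hik : k ≠ i) : IsOb U b (fun x =>
    cX (cp a i k) i k (cg a b i k) x + cq a i k x * pd k (cf a b i k) x) := by
  have P := (cp_sm h i k).continuousOn
  have Q := (cq_sm h i k).continuousOn
  have Qi := (pd_smooth h.op (cq_sm h i k) i).continuousOn
  have Pk := (pd_smooth h.op (cp_sm h i k) k).continuousOn
  have Qk := (pd_smooth h.op (cq_sm h i k) k).continuousOn
  refine ((((ob_off h hlam hS hik).smul Q).add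
    ((ob_diag h hlam hS k).smul ((continuousOn_const (c := (2:ℝ))).mul (P.mul Q)))).add
    ((IsOb.coord k).smul ((Qi.add (P.mul Qk)).add (Q.mul Pk)))).congr fun x hx => ?_
  unfold cX
  rw [(cf_hp h hx i k).2, (cg_hp h hx i k).2, (cg_hp h hx i k).2]
  simp only [Pi.add_apply, Pi.mul_apply, Pi.sub_apply]
  linear_combination (4 * lam x * cq a i k x) * pq_one h hx (i := i) (k := k)

lemma ob_sq {u v : Vec n → ℝ} (hu : IsOb U b u) (hv : IsOb U b v) :
    ∃ E : Vec n → ℝ, ContinuousOn E U ∧ ∀ x ∈ U, 0 ≤ E x ∧ u x ^ 2 + v x ^ 2 ≤ E x * ∑ j, b x j ^ 2 := by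
  obtain ⟨d, hd, h1⟩ := hu
  obtain ⟨e, he, h2⟩ := hv
  refine ⟨fun x => ∑ j, d j x ^ 2 + ∑ j, e j x ^ 2, ?_, fun x hx => ⟨by positivity, ?_⟩⟩
  · exact (continuousOn_finsetSum _ fun j _ => (hd j).pow 2).add
      (continuousOn_finsetSum _ fun j _ => (he j).pow 2)
  · rw [h1 x hx, h2 x hx]
    have e1 := Finset.sum_mul_sq_le_sq_mul_sq Finset.univ (b x) (fun j => d j x)
    have e2 := Finset.sum_mul_sq_le_sq_mul_sq Finset.univ (b x) (fun j => e j x)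
    linarith

omit hlam hS in
lemma b_bound (i k0 : Fin n) (hk0 : k0 ≠ i) : ∃ D : Vec n → ℝ, ContinuousOn D U ∧ ∀ x ∈ U,
    ∑ j, b x j ^ 2 ≤ D x * ∑ k ∈ Finset.univ.erase i, (cf a b i k x ^ 2 + cg a b i k x ^ 2) := by
  have Q : ∀ k, ContinuousOn (fun x => (cq a i k x)⁻¹) U := fun k =>
    (cq_sm h i k).continuousOn.inv₀ fun x hx => (cq_pos h hx i k).ne'
  have P := (cp_sm h i k0).continuousOn
  refine ⟨fun x => (2 + 2 * (cp a i k0 x * (cq a i k0 x)⁻¹) ^ 2)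
    + ∑ k ∈ Finset.univ.erase i, ((cq a i k x)⁻¹) ^ 2, ?_, fun x hx => ?_⟩
  · exact (continuousOn_const.add (continuousOn_const.mul ((P.mul (Q k0)).pow 2))).add
      (continuousOn_finsetSum _ fun j _ => (Q j).pow 2)
  · set T := ∑ k ∈ Finset.univ.erase i, (cf a b i k x ^ 2 + cg a b i k x ^ 2) with hT
    have hle : ∀ k ∈ Finset.univ.erase i, cf a b i k x ^ 2 + cg a b i k x ^ 2 ≤ T := fun k hk =>
      Finset.single_le_sum (f := fun k => cf a b i k x ^ 2 + cg a b i k x ^ 2)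
        (fun k _ => by positivity) hk
    have hb : ∀ k, b x k = (cq a i k x)⁻¹ * cg a b i k x := by
      intro k; unfold cg
      have := cq_pos h hx i k
      field_simp
    rw [← Finset.add_sum_erase _ _ (Finset.mem_univ i), add_mul, Finset.sum_mul]
    refine add_le_add ?_ (Finset.sum_le_sum fun k hk => ?_)
    · have h1 := hle k0 (Finset.mem_erase.2 ⟨hk0, Finset.mem_univ _⟩)
      have h2 : b x i = cf a b i k0 x - (cp a i k0 x * (cq a i k0 x)⁻¹) * cg a b i k0 x := by
        rw [mul_assoc, ← hb]; unfold cf; ring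
      rw [h2]
      set w := cp a i k0 x * (cq a i k0 x)⁻¹
      have h3 : (cf a b i k0 x - w * cg a b i k0 x)^2 ≤ (2 + 2*w^2) * (cf a b i k0 x ^ 2 + cg a b i k0 x ^ 2) := by
        nlinarith [sq_nonneg (cf a b i k0 x + w * cg a b i k0 x), sq_nonneg (w * cf a b i k0 x), sq_nonneg (cg a b i k0 x)]
      exact h3.trans (mul_le_mul_of_nonneg_left h1 (by positivity))
    · rw [hb k, mul_pow]
      refine mul_le_mul_of_nonneg_left ?_ (by positivity)
      linarith [hle k hk, sq_nonneg (cf a b i k x)]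

lemma b_step (hn : 2 ≤ n) {i : Fin n} {o : Vec n} {ε δ R t : ℝ} (hε : |ε| = 1) (hδ : 0 < δ)
    (ht : 0 ≤ t) (htR : t < R) (hz : ∀ x, dist x o < δ → b x = 0)
    (hbox : ∀ x : Vec n, -(δ/2) ≤ ε * (x i - o i) → ε * (x i - o i) ≤ R →
      (∀ k, k ≠ i → |x k - o k| ≤ δ/2) → x ∈ U) : b (o + Pi.single i (ε * t)) = 0 := by
  have : Nontrivial (Fin n) := Fin.nontrivial_iff_two_le.2 hn
  obtain ⟨k0, hk0⟩ := exists_ne i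
  obtain ⟨D, hD, hDb⟩ := b_bound h i k0 hk0
  have hE : ∀ k, ∃ E : Vec n → ℝ, ContinuousOn E U ∧ ∀ x ∈ U, 0 ≤ E x ∧ (k ≠ i →
      (cX (cp a i k) i k (cf a b i k) x - cq a i k x * pd k (cg a b i k) x) ^ 2 +
      (cX (cp a i k) i k (cg a b i k) x + cq a i k x * pd k (cf a b i k) x) ^ 2 ≤ E x * ∑ j, b x j ^ 2) := by
    intro k
    by_cases hk : k = i
    · exact ⟨fun _ => 0, continuousOn_const, fun x _ => ⟨le_rfl, fun h => absurd hk h⟩⟩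
    · obtain ⟨E, h1, h2⟩ := ob_sq h hlam hS (ob_L1 h hlam hS hk) (ob_L2 h hlam hS hk)
      exact ⟨E, h1, fun x hx => ⟨(h2 x hx).1, fun _ => (h2 x hx).2⟩⟩
  choose E hEc hEb using hE
  have hU' : o + Pi.single i (ε * t) ∈ U := by
    have : ε * ε = 1 := by rw [← abs_mul_abs_self, hε, one_mul]
    refine hbox _ ?_ ?_ ?_
    · simp [← mul_assoc, this]; linarith
    · simp [← mul_assoc, this]; linarith
    · intro k hk; simp [hk]; linarith
  have key := uc_step (s := Finset.univ.erase i) (p := cp a i) (q := cq a i) (f := cf a b i) (g := cg a b i)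
    (C := fun x => (∑ k, E k x) * D x) (i := i) h.op (cp_sm h i) (cq_sm h i)
    (fun k => (h.sb i).add ((cp_sm h i k).mul (h.sb k))) (fun k => (cq_sm h i k).mul (h.sb k))
    (fun k _ x hx => (cq_pos h hx i k).ne')
    ((continuousOn_finsetSum _ fun k _ => hEc k).mul hD) ?_ hε hδ ht htR ?_ hbox
  · have hbk : ∀ k, k ≠ i → b (o + Pi.single i (ε * t)) k = 0 := by
      intro k hk
      have := (key k (Finset.mem_erase.2 ⟨hk, Finset.mem_univ _⟩)).2
      exact (mul_eq_zero.1 this).resolve_left (cq_pos h hU' i k).ne'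
    funext k
    by_cases hk : k = i
    · subst hk
      have := (key k0 (Finset.mem_erase.2 ⟨hk0, Finset.mem_univ _⟩)).1
      rw [cf, hbk k0 hk0] at this
      simpa using this
    · exact hbk k hk
  · intro x hx k hk
    refine ((hEb k x hx).2 (Finset.ne_of_mem_erase hk)).trans ?_
    have h1 : E k x ≤ ∑ k, E k x :=
      Finset.single_le_sum (f := fun k => E k x) (fun k _ => (hEb k x hx).1) (Finset.mem_univ k)
    rw [mul_assoc]
    exact mul_le_mul h1 (hDb x hx) (by positivity) (Finset.sum_nonneg fun k _ => (hEb k x hx).1)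
  · intro x hx k _
    simp [cf, cg, hz x hx]
end app
end

noncomputable section
section clopen
variable {n : ℕ} {U : Set (Vec n)} {a : Vec n → Matrix (Fin n) (Fin n) ℝ} {b : Vec n → Vec n}

def cZs (U : Set (Vec n)) (b : Vec n → Vec n) : Set (Vec n) := interior {x | x ∈ U ∧ b x = 0}

variable (h : RD U a b) {lam : Vec n → ℝ} (hlam : ContinuousOn lam U)
  (hS : ∀ x ∈ U, ∀ y : Vec n, y ≠ 0 → SCurv (RF a b) x y = ((n:ℝ)+1) * lam x * RF a b x y)
include h hlam hS

lemma cZ_move (hn : 2 ≤ n) {x0 o : Vec n} {r s : ℝ} {i : Fin n} (hb : Metric.ball x0 r ⊆ U)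
    (ho : o ∈ cZs U b) (hor : dist o x0 < r) (hor' : dist (o + Pi.single i s) x0 < r) :
    o + Pi.single i s ∈ cZs U b := by
  obtain ⟨δ0, hδ0, hB⟩ := Metric.mem_nhds_iff.1 (mem_interior_iff_mem_nhds.1 ho)
  obtain ⟨δ, hδ, h1, h2, h3⟩ : ∃ δ, 0 < δ ∧ 2 * δ ≤ δ0 ∧ dist o x0 + 2 * δ ≤ r ∧
      dist (o + Pi.single i s) x0 + 2 * δ ≤ r := by
    refine ⟨min (δ0/2) (min ((r - dist o x0)/2) ((r - dist (o + Pi.single i s) x0)/2)), ?_, ?_, ?_, ?_⟩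
    · refine lt_min (by linarith) (lt_min (by linarith) (by linarith))
    · have := min_le_left (δ0/2) (min ((r - dist o x0)/2) ((r - dist (o + Pi.single i s) x0)/2))
      linarith
    · have := (min_le_right (δ0/2) (min ((r - dist o x0)/2) ((r - dist (o + Pi.single i s) x0)/2))).trans
        (min_le_left _ _)
      linarith
    · have := (min_le_right (δ0/2) (min ((r - dist o x0)/2) ((r - dist (o + Pi.single i s) x0)/2))).trans
        (min_le_right _ _)
      linarith
  have hr : 0 < r := by linarith [dist_nonneg (x := o) (y := x0)]
  refine mem_interior_iff_mem_nhds.2 (Metric.mem_nhds_iff.2 ⟨δ, hδ, fun z hz => ?_⟩)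
  rw [Metric.mem_ball] at hz
  refine ⟨hb ?_, ?_⟩
  · rw [Metric.mem_ball]
    linarith [dist_triangle z (o + Pi.single i s) x0]
  obtain ⟨ε, hε, hs⟩ : ∃ ε : ℝ, (ε = 1 ∨ ε = -1) ∧ s = ε * |s| := by
    rcases le_total 0 s with h0 | h0
    · exact ⟨1, Or.inl rfl, by rw [abs_of_nonneg h0]; ring⟩
    · exact ⟨-1, Or.inr rfl, by rw [abs_of_nonpos h0]; ring⟩
  have hoz : dist (z - Pi.single i s) o < δ := by
    rw [dist_eq_norm] at hz ⊢
    rwa [show z - Pi.single i s - o = z - (o + Pi.single i s) by abel]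
  have hco : ∀ k, |z k - (o + Pi.single i s : Vec n) k| < δ := fun k => by
    rw [← Real.dist_eq]; exact (dist_le_pi_dist z _ k).trans_lt hz
  have hcx : ∀ k, |(o + Pi.single i s : Vec n) k - x0 k| ≤ r - 2 * δ := fun k => by
    rw [← Real.dist_eq]; exact le_trans (dist_le_pi_dist (o + Pi.single i s : Vec n) x0 k) (le_sub_iff_add_le.2 h3)
  have hcy : ∀ k, |o k - x0 k| ≤ r - 2 * δ := fun k => by
    rw [← Real.dist_eq]; exact (dist_le_pi_dist o x0 k).trans (by linarith)
  have := b_step h hlam hS hn (i := i) (o := z - Pi.single i s) (ε := ε) (δ := δ) (R := |s| + δ) (t := |s|)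
    (by rcases hε with h | h <;> simp [h]) hδ (abs_nonneg s) (by linarith) ?_ ?_
  · rw [← hs] at this
    simpa using this
  · intro x hx
    refine (hB (Metric.mem_ball.2 ?_)).2
    linarith [dist_triangle x (z - Pi.single i s) o]
  · intro x e1 e2 e3
    refine hb (Metric.mem_ball.2 ((dist_pi_lt_iff hr).2 fun k => ?_))
    rw [Real.dist_eq, abs_lt]
    have c1 := abs_lt.1 (hco k)
    have c2 := abs_le.1 (hcx k)
    have c3 := abs_le.1 (hcy k)
    by_cases hk : k = i
    · subst hk
      simp only [Pi.add_apply, Pi.sub_apply, Pi.single_eq_same] at c1 c2 e1 e2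
      rcases hε with rfl | rfl
      · constructor <;> linarith
      · constructor <;> linarith
    · have c4 := abs_le.1 (e3 k hk)
      simp only [Pi.add_apply, Pi.sub_apply, Pi.single_eq_of_ne hk] at c1 c2 c4
      constructor <;> linarith

lemma cZ_closed (hn : 2 ≤ n) : closure (cZs U b) ∩ U ⊆ cZs U b := by
  rintro x0 ⟨hc, hx⟩
  obtain ⟨r, hr, hb⟩ := Metric.mem_nhds_iff.1 (h.op.mem_nhds hx)
  obtain ⟨p, hp, hpd⟩ := Metric.mem_closure_iff.1 hc r hr
  rw [dist_comm] at hpd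
  have hin : ∀ s : Finset (Fin n), dist (fun j => if j ∈ s then x0 j else p j : Vec n) x0 < r := by
    intro s
    rw [dist_pi_lt_iff hr]
    intro k
    by_cases hk : k ∈ s
    · simpa [hk] using hr
    · simp only [hk, if_false]
      exact (dist_le_pi_dist p x0 k).trans_lt hpd
  have key : ∀ s : Finset (Fin n), (fun j => if j ∈ s then x0 j else p j : Vec n) ∈ cZs U b := by
    intro s
    induction s using Finset.induction_on with
    | empty => simpa using hp
    | insert i s hi ih =>
      have e : (fun j => if j ∈ insert i s then x0 j else p j : Vec n)
          = (fun j => if j ∈ s then x0 j else p j) + Pi.single i (x0 i - p i) := by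
        funext j
        by_cases hj : j = i
        · subst hj; simp [hi]
        · simp [hj]
      have h2 := hin (insert i s)
      rw [e] at h2 ⊢
      exact cZ_move h hlam hS hn hb ih (hin s) h2
  simpa using key Finset.univ

lemma b_dense (hn : 2 ≤ n) (hc : IsPreconnected U) (hne : ∃ x ∈ U, b x ≠ 0) {x : Vec n} (hx : x ∈ U) :
    x ∉ cZs U b := by
  intro hz
  obtain ⟨z, hzU, hbz⟩ := hne
  have := hc.subset_of_closure_inter_subset isOpen_interior ⟨x, hx, hz⟩ (cZ_closed h hlam hS hn)
  exact hbz (interior_subset (this hzU)).2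
end clopen
end

/-- **Lemma 4.1.** If a non-Riemannian Randers metric `F` has isotropic
S-curvature `S = (n+1)λ(x)F` and the conformally related metric `F̄ = e^σ F` is
of weakly isotropic scalar curvature, then `σ` is constant. -/
theorem conformal_factor_constant_of_isotropic_S_and_weakly_isotropic_scalar
    {n : ℕ} (hn : 2 ≤ n)
    (U : Set (Vec n)) (hUopen : IsOpen U) (hUconn : IsConnected U)
    (a : Vec n → Matrix (Fin n) (Fin n) ℝ) (b : Vec n → Vec n)
    (hRanders : IsRandersOn a b U)
    (F : Vec n → Vec n → ℝ)
    (hFdef : ∀ x y, F x y = ralpha a x y + rbeta b x y)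
    (hnonRiemannian : ∃ x ∈ U, b x ≠ 0)
    (lam : Vec n → ℝ) (hlam : ContDiffOn ℝ (⊤ : ℕ∞) lam U)
    (hisoS : ∀ x ∈ U, ∀ y : Vec n, y ≠ 0 →
      SCurv F x y = ((n : ℝ) + 1) * lam x * F x y)
    (σ : Vec n → ℝ) (hσ : ContDiffOn ℝ (⊤ : ℕ∞) σ U)
    (Fbar : Vec n → Vec n → ℝ)
    (hFbar : ∀ x y, Fbar x y = Real.exp (σ x) * F x y)
    (θ : Vec n → Vec n) (μ : Vec n → ℝ)
    (hθ : ContDiffOn ℝ (⊤ : ℕ∞) θ U) (hμ : ContDiffOn ℝ (⊤ : ℕ∞) μ U)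
    (hwisc : ∀ x ∈ U, ∀ y : Vec n, y ≠ 0 →
      scalarCurv Fbar x y =
        (n : ℝ) * ((n : ℝ) - 1) * ((∑ i, θ x i * y i) / Fbar x y + μ x)) :
    ∀ x₁ ∈ U, ∀ x₂ ∈ U, σ x₁ = σ x₂ := by
  have hF : F = RF a b := by funext x y; exact hFdef x y
  have hFb : Fbar = RF (ca σ a) (cb σ b) := by
    funext x y; rw [hFbar, hF, cRF]
  subst hF hFb
  have h : RD U a b :=
    { op := hUopen
      sa := hRanders.1
      sb := fun i => contDiffOn_pi.1 hRanders.2.1 i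
      symm := fun x hx i j => ((hRanders.2.2.1 x hx).1.apply j i)
      pos := fun x hx => (hRanders.2.2.1 x hx).2.1
      Fpos := fun x hx y hy => (hRanders.2.2.2.2 x hx y hy).1 }
  have hlc := hlam.continuousOn
  have hpd : ∀ x ∈ U, ∀ i, pd i σ x = 0 := by
    intro x hx i
    by_contra hne
    have hct : ContinuousAt (pd i σ) x :=
      (pd_smooth hUopen hσ i).continuousOn.continuousAt (hUopen.mem_nhds hx)
    refine b_dense h hlc hisoS hn hUconn.isPreconnected hnonRiemannian hx ?_
    refine mem_interior_iff_mem_nhds.2 ?_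
    filter_upwards [hUopen.mem_nhds hx, hct.eventually_ne hne] with z hz hz'
    refine ⟨hz, ?_⟩
    by_contra hbz
    exact hz' (dsig_zero hn h hσ hz hbz (lam z) (fun y hy => iso_rho h hz hy (lam z) (hisoS z hz))
      (θ z) (μ z) (hwisc z hz) i)
  have hfd : ∀ x ∈ U, fderiv ℝ σ x = 0 := by
    intro x hx
    ext v
    have : v = ∑ i, v i • (Pi.single i 1 : Vec n) := by
      funext j; simp [Finset.sum_apply, Pi.single_apply]
    rw [this, map_sum]
    simp only [map_smul]
    simp [show ∀ i, fderiv ℝ σ x (Pi.single i 1) = 0 from hpd x hx]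
  intro x₁ h₁ x₂ h₂
  exact hUopen.is_const_of_fderiv_eq_zero hUconn.isPreconnected
    (hσ.differentiableOn (by simp)) hfd h₁ h₂
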